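/- arXiv:0909.5674 — 2 statements merged into one kernel-verified Lean document; each statement's English description precedes it below -/
import Mathlib

section
/- Existence for non-vanishing mean curvature (Theorem 3.6 / Proposition 3.26): Suppose |t| > 1 and that η ≠ 0 or μ ≠ 0. Then there exist d > 0 and a solution ψ of the model Lichnerowicz equation L_d (with parameters t, γ, η, μ) satisfying ψ(0) = 1. -/
open Real Filter

/-- The 2π-periodic function equal to −1 on (−π,0) and 1 on (0,π). -/
noncomputable def lam (x : ℝ) : ℝ := if 0 < Real.sin x then 1 else -1

/-- The critical exponent q = 2n/(n−2). -/
noncomputable def qex (n : ℕ) : ℝ := 2 * n / ((n : ℝ) - 2)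

/-- The coupling constant κ = (n−1)/n. -/
noncomputable def kap (n : ℕ) : ℝ := ((n : ℝ) - 1) / n

/-- A solution of the model Lichnerowicz equation `L_d` with parameters t, γ, η, μ:
a 2π-periodic, positive, C¹ function, twice differentiable off the multiples of π,
satisfying the equation there. -/
def IsModelSolution (n : ℕ) (t γ η μ d : ℝ) (ψ : ℝ → ℝ) : Prop :=
  (∀ x, ψ (x + 2 * Real.pi) = ψ x) ∧
  (∀ x, 0 < ψ x) ∧
  ContDiff ℝ 1 ψ ∧
  ∀ x : ℝ, (∀ k : ℤ, x ≠ (k : ℝ) * Real.pi) →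
    DifferentiableAt ℝ (deriv ψ) x ∧
    -2 * kap n * qex n * d ^ (-(qex n - 2)) * deriv (deriv ψ) x
      - 2 * η ^ 2 * d ^ (-(2 * qex n)) * ψ x ^ (-qex n - 1)
      - kap n * (μ * d ^ (-qex n) + γ + lam x) ^ 2 * ψ x ^ (-qex n - 1)
      + kap n * (t + lam x) ^ 2 * ψ x ^ (qex n - 1) = 0

open Set MeasureTheory Topology

/-- The exponential average `∫₀^∞ e^{-kz} g(x - z) dz`, the bounded inverse of `k + d/dx`. -/
noncomputable def expAvg (k : ℝ) (g : ℝ → ℝ) (x : ℝ) : ℝ :=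
  ∫ z in Ioi (0 : ℝ), exp (-k * z) * g (x - z)

/-- The bounded inverse of `k² - d²/dx²` on the real line. -/
noncomputable def green (k : ℝ) (h : ℝ → ℝ) (x : ℝ) : ℝ :=
  (expAvg k h x + expAvg k (fun y => h (-y)) (-x)) / (2 * k)

section ExpAvg

variable {k C : ℝ} {g g₁ g₂ : ℝ → ℝ}

lemma integrableOn_expAvg (hk : 0 < k) (hg : Measurable g) (hC : ∀ x, |g x| ≤ C) (x : ℝ) :
    IntegrableOn (fun z => exp (-k * z) * g (x - z)) (Ioi 0) :=
  (exp_neg_integrableOn_Ioi 0 hk).mul_bdd (c := C)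
    (by fun_prop : Measurable fun z => g (x - z)).aestronglyMeasurable (.of_forall fun z => hC _)

lemma expAvg_mono (hk : 0 < k) (hg₁ : Measurable g₁) (hg₂ : Measurable g₂) {C₁ C₂ : ℝ}
    (hC₁ : ∀ x, |g₁ x| ≤ C₁) (hC₂ : ∀ x, |g₂ x| ≤ C₂) (h : ∀ x, g₁ x ≤ g₂ x) (x : ℝ) :
    expAvg k g₁ x ≤ expAvg k g₂ x :=
  integral_mono (integrableOn_expAvg hk hg₁ hC₁ x) (integrableOn_expAvg hk hg₂ hC₂ x)
    fun _ => mul_le_mul_of_nonneg_left (h _) (exp_pos _).le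

lemma expAvg_const (hk : 0 < k) (c x : ℝ) : expAvg k (fun _ => c) x = c / k := by
  simp only [expAvg, integral_mul_const, integral_exp_mul_Ioi (neg_lt_zero.2 hk)]
  simp [field]

lemma expAvg_add_const (hk : 0 < k) (hg : Measurable g) (hC : ∀ x, |g x| ≤ C) (c x : ℝ) :
    expAvg k (fun y => g y + c) x = expAvg k g x + c / k := by
  rw [← expAvg_const hk c x]
  simp only [expAvg, mul_add]
  exact integral_add (integrableOn_expAvg hk hg hC x)
    ((exp_neg_integrableOn_Ioi 0 hk).mul_const c)

lemma expAvg_eq_integral_Iic (x : ℝ) :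
    expAvg k g x = exp (-k * x) * ∫ y in Iic x, exp (k * y) * g y := by
  have h := (Measure.measurePreserving_sub_left volume x).setIntegral_preimage_emb
    (Homeomorph.subLeft x).measurableEmbedding (fun y => exp (-k * (x - y)) * g y) (Iio x)
  rw [integral_Iic_eq_integral_Iio, ← integral_const_mul, expAvg]
  have hs : (fun t => x - t) ⁻¹' Iio x = Ioi 0 := by ext; simp
  rw [hs] at h
  simp only [sub_sub_cancel] at h
  rw [h]
  refine integral_congr_ae (.of_forall fun y => ?_)
  simp only [← mul_assoc, ← exp_add]
  ring_nf

lemma integrableOn_exp_mul (hk : 0 < k) (hg : Measurable g) (hC : ∀ x, |g x| ≤ C) (x : ℝ) :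
    IntegrableOn (fun y => exp (k * y) * g y) (Iic x) :=
  (integrableOn_exp_mul_Iic hk x).mul_bdd (c := C) (by fun_prop) (.of_forall fun z => hC _)

lemma expAvg_eq_primitive (hk : 0 < k) (hg : Measurable g) (hC : ∀ x, |g x| ≤ C) (x : ℝ) :
    expAvg k g x =
      exp (-k * x) * ((∫ y in Iic 0, exp (k * y) * g y) + ∫ y in (0)..x, exp (k * y) * g y) := by
  rw [expAvg_eq_integral_Iic, ← intervalIntegral.integral_Iic_sub_Iic
    (integrableOn_exp_mul hk hg hC 0) (integrableOn_exp_mul hk hg hC x), add_sub_cancel]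

lemma intervalIntegrable_exp_mul (hk : 0 < k) (hg : Measurable g) (hC : ∀ x, |g x| ≤ C)
    (x y : ℝ) : IntervalIntegrable (fun y => exp (k * y) * g y) volume x y :=
  ((integrableOn_exp_mul hk hg hC (max x y)).mono_set
    fun _ hz => hz.2).intervalIntegrable

lemma continuous_expAvg (hk : 0 < k) (hg : Measurable g) (hC : ∀ x, |g x| ≤ C) :
    Continuous (expAvg k g) := by
  have := intervalIntegral.continuous_primitive (intervalIntegrable_exp_mul hk hg hC) 0
  rw [funext (expAvg_eq_primitive hk hg hC)]
  fun_prop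

lemma hasDerivAt_expAvg (hk : 0 < k) (hg : Measurable g) (hC : ∀ x, |g x| ≤ C) {x : ℝ}
    (hx : ContinuousAt g x) : HasDerivAt (expAvg k g) (g x - k * expAvg k g x) x := by
  have h1 : HasDerivAt (fun x => ∫ y in (0)..x, exp (k * y) * g y) (exp (k * x) * g x) x :=
    intervalIntegral.integral_hasDerivAt_right (intervalIntegrable_exp_mul hk hg hC 0 x)
      (by fun_prop : Measurable fun y => exp (k * y) * g y).stronglyMeasurable.stronglyMeasurableAtFilter
      (by fun_prop)
  have h2 : HasDerivAt (fun x => exp (-k * x)) (exp (-k * x) * (-k)) x := by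
    simpa using ((hasDerivAt_id x).const_mul (-k)).exp
  have h3 := h2.mul (h1.const_add (∫ y in Iic 0, exp (k * y) * g y))
  rw [funext (expAvg_eq_primitive hk hg hC)]
  refine h3.congr_deriv ?_
  have : exp (-k * x) * exp (k * x) = 1 := by rw [← exp_add]; simp
  linear_combination g x * this

lemma expAvg_mul_add_deriv (hk : 0 < k) {w w' : ℝ → ℝ} (hw : ∀ x, HasDerivAt w (w' x) x)
    (hw' : Continuous w') {C C' : ℝ} (hC : ∀ x, |w x| ≤ C) (hC' : ∀ x, |w' x| ≤ C') (x : ℝ) :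
    expAvg k (fun y => k * w y + w' y) x = w x := by
  have hwc : Continuous w := continuous_iff_continuousAt.2 fun x => (hw x).continuousAt
  have hd : ∀ z ∈ Ici (0 : ℝ), HasDerivAt (fun z => -(exp (-k * z) * w (x - z)))
      (exp (-k * z) * (k * w (x - z) + w' (x - z))) z := by
    intro z _
    have h2 : HasDerivAt (fun x => exp (-k * x)) (exp (-k * z) * (-k)) z := by
      simpa using ((hasDerivAt_id z).const_mul (-k)).exp
    have h3 : HasDerivAt (fun z => w (x - z)) (-w' (x - z)) z := by
      simpa [Function.comp_def] using (hw (x - z)).comp z ((hasDerivAt_id z).const_sub x)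
    refine (h2.mul h3).neg.congr_deriv ?_
    ring
  have hint := integrableOn_expAvg hk (by fun_prop : Measurable fun y => k * w y + w' y)
    (C := k * C + C') (fun y => (abs_add_le _ _).trans (by
      rw [abs_mul, abs_of_pos hk]
      exact add_le_add (mul_le_mul_of_nonneg_left (hC y) hk.le) (hC' y))) x
  have hlim : Tendsto (fun z => -(exp (-k * z) * w (x - z))) atTop (𝓝 0) := by
    have : Tendsto (fun z => exp (-k * z)) atTop (𝓝 0) :=
      tendsto_exp_atBot.comp (tendsto_id.const_mul_atTop_of_neg (neg_lt_zero.2 hk))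
    simpa using (this.zero_mul_isBoundedUnder_le (isBoundedUnder_of ⟨C, fun z => hC (x - z)⟩)).neg
  have := integral_Ioi_of_hasDerivAt_of_tendsto' hd hint hlim
  simpa [expAvg] using this

end ExpAvg

section Green

variable {k C C₁ C₂ : ℝ} {h h₁ h₂ : ℝ → ℝ}

lemma green_mono (hk : 0 < k) (hh₁ : Measurable h₁) (hh₂ : Measurable h₂)
    (hC₁ : ∀ x, |h₁ x| ≤ C₁) (hC₂ : ∀ x, |h₂ x| ≤ C₂) (h : ∀ x, h₁ x ≤ h₂ x) (x : ℝ) :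
    green k h₁ x ≤ green k h₂ x := by
  unfold green
  have := expAvg_mono hk hh₁ hh₂ hC₁ hC₂ h x
  have := expAvg_mono hk (hh₁.comp measurable_neg) (hh₂.comp measurable_neg)
    (fun x => hC₁ (-x)) (fun x => hC₂ (-x)) (fun x => h (-x)) (-x)
  simp only [Function.comp_def] at this
  gcongr

lemma green_add_const (hk : 0 < k) (hh : Measurable h) (hC : ∀ x, |h x| ≤ C) (c x : ℝ) :
    green k (fun y => h y + c) x = green k h x + c / k ^ 2 := by
  unfold green
  have := expAvg_add_const hk (hh.comp measurable_neg) (fun x => hC (-x)) c (-x)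
  simp only [Function.comp_def] at this
  rw [expAvg_add_const hk hh hC, this]
  field_simp
  ring

lemma green_const (hk : 0 < k) (c x : ℝ) : green k (fun _ => c) x = c / k ^ 2 := by
  unfold green
  rw [expAvg_const hk, expAvg_const hk]
  field_simp
  ring

lemma green_comp_add (c x : ℝ) : green k (fun y => h (y + c)) x = green k h (x + c) := by
  simp only [green, expAvg]
  congr! 5 <;> ring_nf

lemma green_comp_sub_left (c x : ℝ) : green k (fun y => h (c - y)) x = green k h (c - x) := by
  simp only [green, expAvg, sub_neg_eq_add]
  rw [add_comm]
  congr! 6 <;> ring_nf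

lemma green_mul_sub_deriv (hk : 0 < k) {w w' w'' : ℝ → ℝ} (hw : ∀ x, HasDerivAt w (w' x) x)
    (hw' : ∀ x, HasDerivAt w' (w'' x) x) (hw'' : Continuous w'') {C C' C'' : ℝ}
    (hC : ∀ x, |w x| ≤ C) (hC' : ∀ x, |w' x| ≤ C') (hC'' : ∀ x, |w'' x| ≤ C'') (x : ℝ) :
    green k (fun y => k ^ 2 * w y - w'' y) x = w x := by
  have hc' : Continuous w' := continuous_iff_continuousAt.2 fun x => (hw' x).continuousAt
  have e1 := expAvg_mul_add_deriv hk (w := fun y => k * w y - w' y)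
    (w' := fun y => k * w' y - w'' y) (fun x => ((hw x).const_mul k).sub (hw' x)) (by fun_prop)
    (C := k * C + C') (C' := k * C' + C'')
    (fun y => (abs_sub _ _).trans (by rw [abs_mul, abs_of_pos hk]; gcongr <;> simp [*]))
    (fun y => (abs_sub _ _).trans (by rw [abs_mul, abs_of_pos hk]; gcongr <;> simp [*])) x
  have hn : ∀ x, HasDerivAt (fun y => w (-y)) (-w' (-x)) x := fun x => by
    simpa [Function.comp_def] using (hw (-x)).comp x (hasDerivAt_neg x)
  have hn' : ∀ x, HasDerivAt (fun y => w' (-y)) (-w'' (-x)) x := fun x => by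
    simpa [Function.comp_def] using (hw' (-x)).comp x (hasDerivAt_neg x)
  have e2 := expAvg_mul_add_deriv hk (w := fun y => k * w (-y) + w' (-y))
    (w' := fun y => k * (-w' (-y)) + (-w'' (-y)))
    (fun x => ((hn x).const_mul k).add (hn' x)) (by fun_prop)
    (C := k * C + C') (C' := k * C' + C'')
    (fun y => (abs_add_le _ _).trans (by rw [abs_mul, abs_of_pos hk]; gcongr <;> simp [*]))
    (fun y => (abs_add_le _ _).trans (by
      rw [abs_mul, abs_of_pos hk, abs_neg, abs_neg]; gcongr <;> simp [*])) (-x)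
  have f1 : (fun y => k ^ 2 * w y - w'' y) =
      fun y => k * (k * w y - w' y) + (k * w' y - w'' y) := by ext; ring
  have f2 : (fun y => k ^ 2 * w (-y) - w'' (-y)) =
      fun y => k * (k * w (-y) + w' (-y)) + (k * (-w' (-y)) + (-w'' (-y))) := by ext; ring
  simp only [green]
  rw [f2, e2, f1, e1, neg_neg]
  field_simp
  ring

/-- The derivative of `green k h`. -/
noncomputable def greenDeriv (k : ℝ) (h : ℝ → ℝ) (x : ℝ) : ℝ :=
  (expAvg k (fun y => h (-y)) (-x) - expAvg k h x) / 2

lemma continuous_green (hk : 0 < k) (hh : Measurable h) (hC : ∀ x, |h x| ≤ C) :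
    Continuous (green k h) := by
  have := continuous_expAvg hk hh hC
  have : Continuous (expAvg k fun y => h (-y)) :=
    continuous_expAvg hk (hh.comp measurable_neg) (fun x => hC (-x))
  unfold green
  fun_prop

lemma continuous_greenDeriv (hk : 0 < k) (hh : Measurable h) (hC : ∀ x, |h x| ≤ C) :
    Continuous (greenDeriv k h) := by
  have := continuous_expAvg hk hh hC
  have : Continuous (expAvg k fun y => h (-y)) :=
    continuous_expAvg hk (hh.comp measurable_neg) (fun x => hC (-x))
  unfold greenDeriv
  fun_prop

lemma hasDerivAt_expAvg_neg (hk : 0 < k) (hh : Measurable h) (hC : ∀ x, |h x| ≤ C) {x : ℝ}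
    (hx : ContinuousAt h x) : HasDerivAt (fun x => expAvg k (fun y => h (-y)) (-x))
      (k * expAvg k (fun y => h (-y)) (-x) - h x) x := by
  have := hasDerivAt_expAvg hk (hh.comp measurable_neg) (fun x => hC (-x)) (x := -x)
    (ContinuousAt.comp (by simpa using hx) continuous_neg.continuousAt)
  simpa [Function.comp_def] using this.comp x (hasDerivAt_neg x)

lemma hasDerivAt_greenDeriv (hk : 0 < k) (hh : Measurable h) (hC : ∀ x, |h x| ≤ C) {x : ℝ}
    (hx : ContinuousAt h x) : HasDerivAt (greenDeriv k h) (k ^ 2 * green k h x - h x) x := by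
  refine (((hasDerivAt_expAvg_neg hk hh hC hx).sub
    (hasDerivAt_expAvg hk hh hC hx)).div_const 2).congr_deriv ?_
  simp only [green]
  field_simp
  ring

lemma hasDerivAt_green (hk : 0 < k) (hh : Measurable h) (hC : ∀ x, |h x| ≤ C) {E : Set ℝ}
    (hE : E.Countable) (hcont : ∀ x ∉ E, ContinuousAt h x) (x : ℝ) :
    HasDerivAt (green k h) (greenDeriv k h x) x := by
  have hc := continuous_greenDeriv hk hh hC
  have key : ∀ x, green k h x = green k h 0 + ∫ y in (0)..x, greenDeriv k h y := by
    intro x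
    rw [integral_eq_of_hasDerivAt_off_countable (green k h) (greenDeriv k h) hE
      (continuous_green hk hh hC).continuousOn _ (hc.intervalIntegrable _ _)]
    · ring
    · intro y hy
      have hy := hcont y hy.2
      refine (((hasDerivAt_expAvg hk hh hC hy).add
        (hasDerivAt_expAvg_neg hk hh hC hy)).div_const (2 * k)).congr_deriv ?_
      simp only [greenDeriv]
      field_simp
      ring
  rw [funext key]
  exact (intervalIntegral.integral_hasDerivAt_right (hc.intervalIntegrable _ _)
    (hc.stronglyMeasurableAtFilter _ _) hc.continuousAt).const_add _

end Green

section FixedPoint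

/-- A one-sided stability estimate for sub- and supersolutions of `u = green k (H u)`. -/
lemma sub_le_of_le_green {k Λ ε : ℝ} (hk : 0 < k) (hΛ : 0 ≤ Λ) (hΛk : Λ < k ^ 2) (hε : 0 ≤ ε)
    {u v hu hv : ℝ → ℝ} {Cu Cv Bu Bv : ℝ} (mu : Measurable hu) (mv : Measurable hv)
    (bu : ∀ x, |hu x| ≤ Cu) (bv : ∀ x, |hv x| ≤ Cv) (bu' : ∀ x, |u x| ≤ Bu)
    (bv' : ∀ x, |v x| ≤ Bv) (hv_le : ∀ x, v x ≤ green k hv x) (hu_ge : ∀ x, green k hu x ≤ u x)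
    (h : ∀ x, hv x - hu x ≤ Λ * max (v x - u x) 0 + ε) (x : ℝ) :
    v x - u x ≤ ε / (k ^ 2 - Λ) := by
  have hbdd : BddAbove (range fun x => max (v x - u x) 0) := by
    refine ⟨max (Bv + Bu) 0, ?_⟩
    rintro _ ⟨y, rfl⟩
    have h1 := abs_le.1 (bu' y)
    have h2 := abs_le.1 (bv' y)
    exact max_le_max (by linarith) le_rfl
  set M := ⨆ x, max (v x - u x) 0
  have hM : ∀ y, max (v y - u y) 0 ≤ M := fun y => le_ciSup hbdd y
  have hM0 : 0 ≤ M := (le_max_right _ _).trans (hM 0)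
  have key : ∀ y, v y - u y ≤ (Λ * M + ε) / k ^ 2 := by
    intro y
    have h1 : green k hv y ≤ green k (fun y => hu y + (Λ * M + ε)) y := by
      refine green_mono hk mv (mu.add_const _) bv
        (fun z => (abs_add_le _ _).trans (add_le_add_left (bu z) _)) (fun z => ?_) y
      have := h z
      have := mul_le_mul_of_nonneg_left (hM z) hΛ
      linarith
    rw [green_add_const hk mu bu] at h1
    linarith [hv_le y, hu_ge y]
  have hM' : M ≤ (Λ * M + ε) / k ^ 2 := ciSup_le fun y => max_le (key y) (by positivity)
  rw [le_div_iff₀ (by positivity)] at hM'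
  rw [le_div_iff₀ (by linarith)]
  have := (le_max_left _ _).trans (hM x)
  nlinarith

lemma exists_eq_green {k Λ C : ℝ} (hk : 0 < k) (hΛ : 0 ≤ Λ) (hΛk : Λ < k ^ 2)
    {H : ℝ → ℝ → ℝ} (hm : ∀ u : ℝ → ℝ, Continuous u → Measurable fun x => H x (u x))
    (hC : ∀ x p, |H x p| ≤ C) (hL : ∀ x p p', |H x p - H x p'| ≤ Λ * |p - p'|) :
    ∃ u : ℝ → ℝ, Continuous u ∧ (∃ B, ∀ x, |u x| ≤ B) ∧
      ∀ x, u x = green k (fun y => H y (u y)) x := by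
  have hb : ∀ u : ℝ → ℝ, Continuous u → ∀ x, |green k (fun y => H y (u y)) x| ≤ C / k ^ 2 := by
    intro u hu x
    rw [abs_le, ← neg_div, ← green_const hk (-C) x, ← green_const hk C x]
    exact ⟨green_mono hk measurable_const (hm u hu) (fun _ => le_rfl) (fun x => hC _ _)
        (fun x => (abs_le.1 (hC _ _)).1) x,
      green_mono hk (hm u hu) measurable_const (fun x => hC _ _) (fun _ => le_rfl)
        (fun x => (abs_le.1 (hC _ _)).2) x⟩
  let T : BoundedContinuousFunction ℝ ℝ → BoundedContinuousFunction ℝ ℝ := fun u =>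
    .ofNormedAddCommGroup (green k fun y => H y (u y))
      (continuous_green hk (hm u u.continuous) fun x => hC _ _) (C / k ^ 2) (hb u u.continuous)
  have hle : ∀ u w : BoundedContinuousFunction ℝ ℝ, ∀ x,
      T u x ≤ T w x + Λ / k ^ 2 * dist u w := by
    intro u w x
    have h1 : green k (fun y => H y (u y)) x ≤
        green k (fun y => H y (w y) + Λ * dist u w) x := by
      refine green_mono hk (hm u u.continuous) ((hm w w.continuous).add_const _)
        (fun x => hC _ _) (fun z => (abs_add_le _ _).trans (add_le_add_left (hC _ _) _))
        (fun z => ?_) x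
      have h2 := (abs_le.1 (hL z (u z) (w z))).2
      have h3 := mul_le_mul_of_nonneg_left (u.dist_coe_le_dist (g := w) z) hΛ
      rw [Real.dist_eq] at h3
      linarith
    rw [green_add_const hk (hm w w.continuous) (fun x => hC _ _)] at h1
    calc T u x ≤ _ := h1
      _ = _ := by rw [mul_div_right_comm]; rfl
  have hc : ContractingWith (Real.toNNReal (Λ / k ^ 2)) T := by
    refine ⟨?_, LipschitzWith.of_dist_le_mul fun u w => ?_⟩
    · rw [← Real.toNNReal_one]
      exact (Real.toNNReal_lt_toNNReal_iff one_pos).2 ((div_lt_one (by positivity)).2 hΛk)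
    · rw [Real.coe_toNNReal _ (by positivity),
        BoundedContinuousFunction.dist_le (by positivity)]
      intro x
      have h1 := hle u w x
      have h2 := hle w u x
      rw [dist_comm w u] at h2
      rw [Real.dist_eq, abs_le]
      constructor <;> linarith
  obtain ⟨w, hw⟩ : ∃ w, T w = w := ⟨_, hc.fixedPoint_isFixedPt⟩
  exact ⟨w, w.continuous, ⟨‖w‖, fun x => w.norm_coe_le_norm x⟩,
    fun x => (DFunLike.congr_fun hw x).symm⟩

end FixedPoint

section Reaction

/-- The function equal to `cp` where `sin` is positive and to `cm` elsewhere. -/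
noncomputable def stepCoeff (cp cm x : ℝ) : ℝ := if 0 < sin x then cp else cm

/-- The Lichnerowicz nonlinearity. -/
noncomputable def reaction (q b a p : ℝ) : ℝ := b * p ^ (q - 1) - a * p ^ (-q - 1)

lemma stepCoeff_mem {cp cm : ℝ} {s : Set ℝ} (hp : cp ∈ s) (hm : cm ∈ s) (x : ℝ) :
    stepCoeff cp cm x ∈ s := by
  unfold stepCoeff; split_ifs <;> assumption

lemma hasDerivAt_reaction {q b a p : ℝ} (hp : 0 < p) :
    HasDerivAt (reaction q b a) (b * ((q - 1) * p ^ (q - 2)) + a * ((q + 1) * p ^ (-q - 2))) p := by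
  have h1 := (hasDerivAt_rpow_const (p := q - 1) (Or.inl hp.ne')).const_mul b
  have h2 := (hasDerivAt_rpow_const (p := -q - 1) (Or.inl hp.ne')).const_mul a
  refine (h1.sub h2).congr_deriv ?_
  rw [show q - 1 - 1 = q - 2 by ring, show -q - 1 - 1 = -q - 2 by ring]
  ring

lemma reaction_slope_mem {q β B A m M b a : ℝ} (hq : 2 < q) (hβ : 0 < β) (hb : b ∈ Icc β B)
    (ha : a ∈ Icc 0 A) (hm : 0 < m) {p p' : ℝ} (hp : p ∈ Icc m M) (hp' : p' ∈ Icc m M)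
    (hpp : p ≤ p') :
    β * ((q - 1) * m ^ (q - 2)) * (p' - p) ≤ reaction q b a p' - reaction q b a p ∧
    reaction q b a p' - reaction q b a p ≤
      (B * ((q - 1) * M ^ (q - 2)) + A * ((q + 1) * m ^ (-q - 2))) * (p' - p) := by
  have hd : ∀ p ∈ Icc m M, HasDerivAt (reaction q b a) _ p := fun p hp =>
    hasDerivAt_reaction (hm.trans_le hp.1)
  have hc : ContinuousOn (reaction q b a) (Icc m M) := fun p hp =>
    (hd p hp).continuousAt.continuousWithinAt
  have hi : DifferentiableOn ℝ (reaction q b a) (interior (Icc m M)) := fun p hp =>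
    (hd p (interior_subset hp)).differentiableAt.differentiableWithinAt
  constructor
  · refine (convex_Icc m M).mul_sub_le_image_sub_of_le_deriv hc hi (fun x hx => ?_) p hp p' hp' hpp
    have hx := interior_subset hx
    have hx0 := hm.trans_le hx.1
    rw [(hd x hx).deriv]
    have h1 : m ^ (q - 2) ≤ x ^ (q - 2) := rpow_le_rpow hm.le hx.1 (by linarith)
    have h2 : β * ((q - 1) * m ^ (q - 2)) ≤ b * ((q - 1) * x ^ (q - 2)) := by
      have := hb.1
      have : 0 ≤ b := hβ.le.trans hb.1
      have : 0 ≤ q - 1 := by linarith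
      have : 0 ≤ m ^ (q - 2) := by positivity
      gcongr
    have : 0 ≤ a * ((q + 1) * x ^ (-q - 2)) := by
      have := ha.1
      have : 0 ≤ q + 1 := by linarith
      positivity
    linarith
  · refine (convex_Icc m M).image_sub_le_mul_sub_of_deriv_le hc hi (fun x hx => ?_) p hp p' hp' hpp
    have hx := interior_subset hx
    have hx0 := hm.trans_le hx.1
    rw [(hd x hx).deriv]
    have h1 : x ^ (q - 2) ≤ M ^ (q - 2) := rpow_le_rpow hx0.le hx.2 (by linarith)
    have h2 : x ^ (-q - 2) ≤ m ^ (-q - 2) :=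
      rpow_le_rpow_of_nonpos hm hx.1 (by linarith)
    have := hb.2
    have := ha.2
    have := ha.1
    have : 0 ≤ b := hβ.le.trans hb.1
    have : 0 ≤ B := by linarith
    have : 0 ≤ A := by linarith
    have : 0 ≤ q - 1 := by linarith
    have : 0 ≤ q + 1 := by linarith
    have : 0 ≤ x ^ (q - 2) := by positivity
    have : 0 ≤ x ^ (-q - 2) := by positivity
    gcongr

/-- The coefficient pairs for which solutions are bounded below uniformly. -/
def admissible (α A : ℝ) : Set (ℝ × ℝ) :=
  {a | a.1 ∈ Icc 0 A ∧ a.2 ∈ Icc 0 A ∧ α ≤ a.1 + a.2}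

lemma exists_subsolution {q B α A bp bm : ℝ} (hq : 2 < q) (hB : 0 < B) (hα : 0 < α)
    (hbp : bp ∈ Ioc 0 B) (hbm : bm ∈ Ioc 0 B) :
    ∃ m, 0 < m ∧ ∀ a ∈ admissible α A, ∃ w w' w'' : ℝ → ℝ,
      (∀ x, HasDerivAt w (w' x) x) ∧ (∀ x, HasDerivAt w' (w'' x) x) ∧ Continuous w'' ∧
      (∀ x, |w' x| ≤ 2) ∧ (∀ x, |w'' x| ≤ 2) ∧ (∀ x, w x ∈ Icc m 1) ∧
      ∀ x, reaction q (stepCoeff bp bm x) (stepCoeff a.1 a.2 x) (w x) ≤ w'' x := by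
  obtain ⟨e, he0, he1, heα, heB⟩ : ∃ e : ℝ, 0 < e ∧ e ≤ 1 ∧ e ≤ α ∧ B * e ^ (q - 2) ≤ 1 / 8 := by
    have h1 : Tendsto (fun e : ℝ => B * e ^ (q - 2)) (𝓝[>] 0) (𝓝 (B * 0 ^ (q - 2))) :=
      ((continuous_rpow_const (by linarith)).const_mul B).continuousWithinAt
    rw [zero_rpow (by linarith), mul_zero] at h1
    have := (h1.eventually_le_const (by norm_num : (0 : ℝ) < 1 / 8)).and
      ((Ioc_mem_nhdsGT (lt_min one_pos hα)))
    obtain ⟨e, h, he⟩ := this.exists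
    exact ⟨e, he.1, he.2.trans (min_le_left _ _), he.2.trans (min_le_right _ _), h⟩
  refine ⟨e / 8, by positivity, fun a ha => ?_⟩
  obtain ⟨σ, hσ, hside⟩ : ∃ σ : ℝ, (σ = 1 ∨ σ = -1) ∧
      ∀ x, σ * sin x < 0 → α / 2 ≤ stepCoeff a.1 a.2 x := by
    rcases le_total (α / 2) a.1 with h | h
    · refine ⟨-1, Or.inr rfl, fun x hx => ?_⟩
      rw [stepCoeff, if_pos (by linarith)]
      exact h
    · refine ⟨1, Or.inl rfl, fun x hx => ?_⟩
      rw [stepCoeff, if_neg (by linarith)]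
      linarith [ha.2.2]
  have hσ2 : σ ^ 2 = 1 := by rcases hσ with rfl | rfl <;> norm_num
  have hσs : ∀ x, |σ * sin x| ≤ 1 := fun x => by
    rcases hσ with rfl | rfl <;> simpa using abs_sin_le_one x
  have hσc : ∀ x, |σ * cos x| ≤ 1 := fun x => by
    rcases hσ with rfl | rfl <;> simpa using abs_cos_le_one x
  have hw : ∀ x, e / 4 * (2 - σ * sin x - cos (2 * x) / 8) ∈ Icc (e / 8) e := fun x => by
    have h1 := abs_le.1 (hσs x)
    have h2 := neg_one_le_cos (2 * x)
    have h3 := cos_le_one (2 * x)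
    constructor <;> nlinarith
  refine ⟨fun x => e / 4 * (2 - σ * sin x - cos (2 * x) / 8),
    fun x => e / 4 * (-(σ * cos x) + sin (2 * x) / 4),
    fun x => e / 4 * (σ * sin x + cos (2 * x) / 2), fun x => ?_, fun x => ?_, by fun_prop,
    fun x => ?_, fun x => ?_, fun x => ⟨(hw x).1, (hw x).2.trans he1⟩, fun x => ?_⟩
  · have h2 : HasDerivAt (fun x => cos (2 * x)) (-sin (2 * x) * 2) x := by
      simpa using ((hasDerivAt_id x).const_mul 2).cos
    refine (((((hasDerivAt_sin x).const_mul σ).const_sub 2).sub (h2.div_const 8)).const_mul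
      (e / 4)).congr_deriv ?_
    ring
  · have h2 : HasDerivAt (fun x => sin (2 * x)) (cos (2 * x) * 2) x := by
      simpa using ((hasDerivAt_id x).const_mul 2).sin
    refine ((((hasDerivAt_cos x).const_mul σ).neg.add (h2.div_const 4)).const_mul
      (e / 4)).congr_deriv ?_
    ring
  · have h1 := abs_le.1 (hσc x)
    have h2 := neg_one_le_sin (2 * x)
    have h3 := sin_le_one (2 * x)
    rw [abs_le]
    constructor <;> nlinarith
  · have h1 := abs_le.1 (hσs x)
    have h2 := neg_one_le_cos (2 * x)
    have h3 := cos_le_one (2 * x)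
    rw [abs_le]
    constructor <;> nlinarith
  · have hb := stepCoeff_mem hbp hbm x
    have ha' := stepCoeff_mem ha.1 ha.2.1 x
    have hside := hside x
    have hwx := hw x
    have hs := abs_le.1 (hσs x)
    have hcos : cos (2 * x) = 1 - 2 * (σ * sin x) ^ 2 := by
      rw [cos_two_mul, cos_sq', mul_pow, hσ2]; ring
    have hcos1 := neg_one_le_cos (2 * x)
    simp only
    generalize e / 4 * (2 - σ * sin x - cos (2 * x) / 8) = p at hwx ⊢
    generalize stepCoeff bp bm x = b at hb ⊢
    generalize stepCoeff a.1 a.2 x = c at ha' hside ⊢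
    have hp0 : 0 < p := by linarith [hwx.1]
    have h1 : b * p ^ (q - 1) ≤ e / 8 := by
      have : p ^ (q - 1) = p ^ (q - 2) * p := by
        rw [← rpow_add_one hp0.ne']; ring_nf
      rw [this, ← mul_assoc]
      have h2 : p ^ (q - 2) ≤ e ^ (q - 2) := rpow_le_rpow hp0.le hwx.2 (by linarith)
      have h3 : b * p ^ (q - 2) ≤ 1 / 8 := le_trans (mul_le_mul hb.2 h2 (by positivity) hB.le) heB
      calc b * p ^ (q - 2) * p ≤ 1 / 8 * e := mul_le_mul h3 hwx.2 hp0.le (by norm_num)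
        _ = e / 8 := by ring
    have h2 : 1 ≤ p ^ (-q - 1) :=
      one_le_rpow_of_pos_of_le_one_of_nonpos hp0 (hwx.2.trans he1) (by linarith)
    unfold reaction
    rcases lt_or_ge (σ * sin x) 0 with hneg | hpos
    · have := mul_le_mul (hside hneg) h2 zero_le_one ha'.1
      nlinarith
    · have : 0 ≤ c * p ^ (-q - 1) := mul_nonneg ha'.1 (by linarith)
      have h3 : 1 / 2 ≤ σ * sin x + (1 - 2 * (σ * sin x) ^ 2) / 2 := by nlinarith
      have h4 := mul_le_mul_of_nonneg_left h3 (by positivity : 0 ≤ e / 4)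
      rw [hcos]
      linarith

end Reaction

section PeriodicSolution

/-- A positive `2π`-periodic `C¹` solution `u`, with derivative `v`, of the normalized equation
`u'' = b u^(q-1) - a u^(-q-1)` with step coefficients, symmetric about `π/2`. -/
structure IsPeriodicSolution (q bp bm : ℝ) (a : ℝ × ℝ) (u v : ℝ → ℝ) : Prop where
  pos : ∀ x, 0 < u x
  hasDerivAt : ∀ x, HasDerivAt u (v x) x
  continuous_deriv : Continuous v
  hasDerivAt_deriv : ∀ x, sin x ≠ 0 →
    HasDerivAt v (reaction q (stepCoeff bp bm x) (stepCoeff a.1 a.2 x) (u x)) x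
  periodic : ∀ x, u (x + 2 * π) = u x
  symm : ∀ x, u (π - x) = u x

lemma measurable_stepCoeff (cp cm : ℝ) : Measurable (stepCoeff cp cm) :=
  Measurable.ite (measurableSet_lt measurable_const measurable_sin) measurable_const
    measurable_const

lemma continuousAt_stepCoeff (cp cm : ℝ) {x : ℝ} (hx : sin x ≠ 0) :
    ContinuousAt (stepCoeff cp cm) x := by
  rcases hx.lt_or_gt with h | h
  · refine (continuousAt_const (y := cm)).congr ?_
    filter_upwards [continuous_sin.continuousAt.eventually_lt_const h] with y hy
    rw [stepCoeff, if_neg hy.not_gt]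
  · refine (continuousAt_const (y := cp)).congr ?_
    filter_upwards [continuous_sin.continuousAt.eventually_const_lt h] with y hy
    rw [stepCoeff, if_pos hy]

lemma stepCoeff_congr {x y : ℝ} (h : sin x = sin y) (cp cm : ℝ) :
    stepCoeff cp cm x = stepCoeff cp cm y := by
  rw [stepCoeff, h, stepCoeff]

lemma abs_stepCoeff_sub_le (a a' : ℝ × ℝ) (x : ℝ) :
    |stepCoeff a.1 a.2 x - stepCoeff a'.1 a'.2 x| ≤ dist a a' := by
  unfold stepCoeff
  rw [Prod.dist_eq]
  split_ifs
  · exact le_max_left _ _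
  · exact le_max_right _ _

/-- The truncated shifted nonlinearity. -/
noncomputable def truncated (q bp bm K m M : ℝ) (a : ℝ × ℝ) (x p : ℝ) : ℝ :=
  K * max m (min M p) -
    reaction q (stepCoeff bp bm x) (stepCoeff a.1 a.2 x) (max m (min M p))

variable {q bp bm β B α A K c m M : ℝ} {a a' : ℝ × ℝ}

lemma truncated_sub_mem (hmM : m ≤ M)
    (hslope : ∀ x, ∀ p ∈ Icc m M, ∀ p' ∈ Icc m M, p ≤ p' →
      c * (p' - p) ≤ reaction q (stepCoeff bp bm x) (stepCoeff a.1 a.2 x) p' -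
        reaction q (stepCoeff bp bm x) (stepCoeff a.1 a.2 x) p ∧
      reaction q (stepCoeff bp bm x) (stepCoeff a.1 a.2 x) p' -
        reaction q (stepCoeff bp bm x) (stepCoeff a.1 a.2 x) p ≤ K * (p' - p))
    (hcK : c ≤ K) {p p' : ℝ} (hpp : p ≤ p') (x : ℝ) :
    truncated q bp bm K m M a x p' - truncated q bp bm K m M a x p ∈
      Icc 0 ((K - c) * (p' - p)) := by
  have hmem : ∀ p, max m (min M p) ∈ Icc m M := fun p =>
    ⟨le_max_left _ _, max_le hmM (min_le_left _ _)⟩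
  have hmono : max m (min M p) ≤ max m (min M p') := by gcongr
  have hlip : max m (min M p') - max m (min M p) ≤ p' - p := by
    rcases le_total M p with h1 | h1 <;> rcases le_total M p' with h2 | h2 <;>
      rcases le_total m p with h3 | h3 <;> rcases le_total m p' with h4 | h4 <;>
      simp only [min_eq_left, min_eq_right, max_eq_left, max_eq_right, *] <;> linarith
  obtain ⟨h1, h2⟩ := hslope x _ (hmem p) _ (hmem p') hmono
  have h3 := mul_le_mul_of_nonneg_left hlip (sub_nonneg.2 hcK)
  unfold truncated
  constructor <;> nlinarith

lemma abs_truncated_le (hm : 0 < m) (hmM : m ≤ M) (hq : 2 < q) (hK : 0 ≤ K)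
    (hbp : bp ∈ Icc 0 B) (hbm : bm ∈ Icc 0 B) (ha : a ∈ admissible α A) (x p : ℝ) :
    |truncated q bp bm K m M a x p| ≤ K * M + B * M ^ (q - 1) + A * m ^ (-q - 1) := by
  have hP : max m (min M p) ∈ Icc m M := ⟨le_max_left _ _, max_le hmM (min_le_left _ _)⟩
  have hb := stepCoeff_mem hbp hbm x
  have ha' := stepCoeff_mem ha.1 ha.2.1 x
  have hP0 := hm.trans_le hP.1
  unfold truncated reaction
  have h1 : K * max m (min M p) ≤ K * M := mul_le_mul_of_nonneg_left hP.2 hK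
  have h2 : stepCoeff bp bm x * max m (min M p) ^ (q - 1) ≤ B * M ^ (q - 1) :=
    mul_le_mul hb.2 (rpow_le_rpow hP0.le hP.2 (by linarith)) (by positivity) (hb.1.trans hb.2)
  have h3 : stepCoeff a.1 a.2 x * max m (min M p) ^ (-q - 1) ≤ A * m ^ (-q - 1) :=
    mul_le_mul ha'.2 (rpow_le_rpow_of_nonpos hm hP.1 (by linarith)) (by positivity)
      (ha'.1.trans ha'.2)
  have h4 : 0 ≤ K * max m (min M p) := by positivity
  have h5 : 0 ≤ stepCoeff bp bm x * max m (min M p) ^ (q - 1) :=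
    mul_nonneg hb.1 (by positivity)
  have h6 : 0 ≤ stepCoeff a.1 a.2 x * max m (min M p) ^ (-q - 1) :=
    mul_nonneg ha'.1 (by positivity)
  rw [abs_le]
  constructor <;> linarith

lemma measurable_truncated {u : ℝ → ℝ} (hu : Continuous u) :
    Measurable fun x => truncated q bp bm K m M a x (u x) := by
  have := measurable_stepCoeff bp bm
  have := measurable_stepCoeff a.1 a.2
  have := hu.measurable
  unfold truncated reaction
  fun_prop

lemma continuousAt_truncated (hm : 0 < m) {u : ℝ → ℝ} (hu : Continuous u) {x : ℝ}
    (hx : sin x ≠ 0) : ContinuousAt (fun x => truncated q bp bm K m M a x (u x)) x := by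
  have h1 := continuousAt_stepCoeff bp bm hx
  have h2 := continuousAt_stepCoeff a.1 a.2 hx
  have h3 : ContinuousAt (fun x => max m (min M (u x))) x := by fun_prop
  have h4 : max m (min M (u x)) ≠ 0 := (hm.trans_le (le_max_left _ _)).ne'
  unfold truncated reaction
  exact (h3.const_mul K).sub ((h1.mul (h3.rpow_const (Or.inl h4))).sub
    (h2.mul (h3.rpow_const (Or.inl h4))))

lemma truncated_sub_truncated_le (hm : 0 < m) (hq : 2 < q) (x p : ℝ) :
    truncated q bp bm K m M a' x p - truncated q bp bm K m M a x p ≤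
      dist a a' * m ^ (-q - 1) := by
  have hP := le_max_left m (min M p)
  have h1 := (abs_stepCoeff_sub_le a a' x)
  have h2 : max m (min M p) ^ (-q - 1) ≤ m ^ (-q - 1) :=
    rpow_le_rpow_of_nonpos hm hP (by linarith)
  have h3 : 0 ≤ max m (min M p) ^ (-q - 1) := rpow_nonneg (hm.le.trans hP) _
  calc _ = (stepCoeff a'.1 a'.2 x - stepCoeff a.1 a.2 x) * max m (min M p) ^ (-q - 1) := by
        unfold truncated reaction; ring
    _ ≤ dist a a' * m ^ (-q - 1) := by
        refine mul_le_mul ?_ h2 h3 dist_nonneg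
        rw [abs_sub_comm] at h1
        exact (le_abs_self _).trans h1

theorem exists_solution_family (hq : 2 < q) (hbp : 0 < bp) (hbm : 0 < bm) (hα : 0 < α)
    (hA : 0 ≤ A) : ∃ U V : ℝ × ℝ → ℝ → ℝ,
      (∀ a ∈ admissible α A, IsPeriodicSolution q bp bm a (U a) (V a)) ∧
      ContinuousOn (fun a => U a 0) (admissible α A) := by
  set β := min bp bm
  set B := max bp bm
  have hβ : 0 < β := lt_min hbp hbm
  have hB : 0 < B := lt_max_of_lt_left hbp
  have hbpI : bp ∈ Icc β B := ⟨min_le_left _ _, le_max_left _ _⟩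
  have hbmI : bm ∈ Icc β B := ⟨min_le_right _ _, le_max_right _ _⟩
  obtain ⟨m, hm, hsub⟩ := exists_subsolution (q := q) (B := B) (α := α) (A := A) hq hB hα
    ⟨hbp, hbpI.2⟩ ⟨hbm, hbmI.2⟩
  set M := max m (1 + A / β)
  have hmM : m ≤ M := le_max_left _ _
  have hAM : 1 + A / β ≤ M := le_max_right _ _
  have hM1 : 1 ≤ M := le_trans (by have := div_nonneg hA hβ.le; linarith) hAM
  set c := β * ((q - 1) * m ^ (q - 2))
  set Λ := B * ((q - 1) * M ^ (q - 2)) + A * ((q + 1) * m ^ (-q - 2))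
  have hq1 : 0 < q - 1 := by linarith
  have hq2 : 0 < q + 1 := by linarith
  have hc : 0 < c := by positivity
  have hΛ : 0 ≤ Λ := by positivity
  set k := √(Λ + c)
  have hk : 0 < k := Real.sqrt_pos.2 (by positivity)
  have hk2 : k ^ 2 = Λ + c := Real.sq_sqrt (by positivity)
  have hbp0 : bp ∈ Icc 0 B := ⟨hbp.le, hbpI.2⟩
  have hbm0 : bm ∈ Icc 0 B := ⟨hbm.le, hbmI.2⟩
  set H : ℝ × ℝ → ℝ → ℝ → ℝ := truncated q bp bm (k ^ 2) m M
  have hH1 : ∀ a ∈ admissible α A, ∀ p p', p ≤ p' → ∀ x,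
      H a x p' - H a x p ∈ Icc 0 (Λ * (p' - p)) := by
    intro a ha p p' hpp x
    have := truncated_sub_mem (q := q) (bp := bp) (bm := bm) (K := k ^ 2) (c := c) (a := a) hmM
      (fun x p hp p' hp' hpp => ?_) (by linarith) hpp x
    · rwa [show k ^ 2 - c = Λ by linarith] at this
    · obtain ⟨h1, h2⟩ := reaction_slope_mem hq hβ (stepCoeff_mem hbpI hbmI x)
        (stepCoeff_mem ha.1 ha.2.1 x) hm hp hp' hpp
      refine ⟨h1, h2.trans ?_⟩
      rw [hk2]
      nlinarith [mul_nonneg hc.le (sub_nonneg.2 hpp)]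
  have hHmax : ∀ a ∈ admissible α A, ∀ p p' x,
      H a x p' - H a x p ≤ Λ * max (p' - p) 0 := by
    intro a ha p p' x
    rcases le_total p p' with h | h
    · rw [max_eq_left (sub_nonneg.2 h)]
      exact (hH1 a ha p p' h x).2
    · rw [max_eq_right (sub_nonpos.2 h)]
      linarith [(hH1 a ha p' p h x).1]
  have hHlip : ∀ a ∈ admissible α A, ∀ x p p', |H a x p - H a x p'| ≤ Λ * |p - p'| := by
    intro a ha x p p'
    have h1 := hHmax a ha p' p x
    have h2 := hHmax a ha p p' x
    have h3 : max (p - p') 0 ≤ |p - p'| := max_le (le_abs_self _) (abs_nonneg _)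
    have h4 : max (p' - p) 0 ≤ |p - p'| :=
      max_le (by rw [abs_sub_comm]; exact le_abs_self _) (abs_nonneg _)
    have h5 := mul_le_mul_of_nonneg_left h3 hΛ
    have h6 := mul_le_mul_of_nonneg_left h4 hΛ
    rw [abs_le]
    constructor <;> linarith
  have hHb : ∀ a ∈ admissible α A, ∀ x p, |H a x p| ≤ _ := fun a ha =>
    abs_truncated_le hm hmM hq (sq_nonneg k) hbp0 hbm0 ha
  have hHm : ∀ a, ∀ u : ℝ → ℝ, Continuous u → Measurable fun x => H a x (u x) :=
    fun a u hu => measurable_truncated hu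
  have hΛk : Λ < k ^ 2 := by linarith
  have hex : ∀ a, ∃ u : ℝ → ℝ, a ∈ admissible α A → Continuous u ∧ (∃ B, ∀ x, |u x| ≤ B) ∧
      ∀ x, u x = green k (fun y => H a y (u y)) x := by
    intro a
    by_cases ha : a ∈ admissible α A
    · obtain ⟨u, hu⟩ := exists_eq_green hk hΛ hΛk (hHm a) (hHb a ha) (hHlip a ha)
      exact ⟨u, fun _ => hu⟩
    · exact ⟨0, fun h => absurd h ha⟩
  choose U hU using hex
  refine ⟨U, fun a => greenDeriv k (fun y => H a y (U a y)), fun a ha => ?_, ?_⟩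
  · obtain ⟨hUc, ⟨D, hD⟩, hUg⟩ := hU a ha
    have hh := hHm a (U a) hUc
    have hhb : ∀ x, |H a x (U a x)| ≤ _ := fun x => hHb a ha x (U a x)
    have huniq : ∀ w : ℝ → ℝ, Continuous w → (∀ x, |w x| ≤ D) →
        (∀ x, w x = green k (fun y => H a y (w y)) x) → ∀ x, w x = U a x := by
      intro w hw hwD hwg x
      have h1 := sub_le_of_le_green hk hΛ hΛk le_rfl hh (hHm a w hw) hhb
        (fun x => hHb a ha x (w x)) hD hwD (fun x => (hwg x).le) (fun x => (hUg x).ge)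
        (fun x => by rw [add_zero]; exact hHmax a ha _ _ x) x
      have h2 := sub_le_of_le_green hk hΛ hΛk le_rfl (hHm a w hw) hh
        (fun x => hHb a ha x (w x)) hhb hwD hD (fun x => (hUg x).le) (fun x => (hwg x).ge)
        (fun x => by rw [add_zero]; exact hHmax a ha _ _ x) x
      rw [zero_div] at h1 h2
      linarith
    have hHcongr : ∀ x y p, sin x = sin y → H a x p = H a y p := by
      intro x y p hxy
      simp only [H, truncated, stepCoeff_congr hxy]
    have hlow : ∀ x, m ≤ U a x := by
      intro x
      obtain ⟨w, w', w'', hw, hw', hcw, bw', bw'', hwI, hwr⟩ := hsub a ha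
      have hwc : Continuous w := continuous_iff_continuousAt.2 fun x => (hw x).continuousAt
      have bw : ∀ x, |w x| ≤ 1 := fun x =>
        abs_le.2 ⟨by linarith [(hwI x).1], (hwI x).2⟩
      have h1 := sub_le_of_le_green hk hΛ hΛk le_rfl hh
        (by fun_prop : Measurable fun y => k ^ 2 * w y - w'' y) hhb
        (Cv := k ^ 2 * 1 + 2) (fun y => (abs_sub _ _).trans (by
          rw [abs_mul, abs_of_pos (pow_pos hk 2)]
          exact add_le_add (mul_le_mul_of_nonneg_left (bw y) (sq_nonneg k)) (bw'' y)))
        hD bw (fun x => (green_mul_sub_deriv hk hw hw' hcw bw bw' bw'' x).ge)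
        (fun x => (hUg x).ge) (fun x => ?_) x
      · rw [zero_div] at h1
        linarith [(hwI x).1]
      · have h2 := hHmax a ha (U a x) (w x) x
        have h3 : H a x (w x) = k ^ 2 * w x -
            reaction q (stepCoeff bp bm x) (stepCoeff a.1 a.2 x) (w x) := by
          simp only [H, truncated, min_eq_right ((hwI x).2.trans hM1), max_eq_right (hwI x).1]
        linarith [hwr x]
    have hup : ∀ x, U a x ≤ M := by
      intro x
      have hM0 : 0 < M := by linarith
      have h1 := sub_le_of_le_green hk hΛ hΛk le_rfl
        (measurable_const : Measurable fun _ : ℝ => k ^ 2 * M) hh (fun _ => le_rfl) hhb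
        (fun _ => le_rfl : ∀ _ : ℝ, |M| ≤ |M|) hD (fun x => (hUg x).le)
        (fun x => by rw [green_const hk]; field_simp; rfl) (fun x => ?_) x
      · rw [zero_div] at h1
        linarith
      · have h2 := hHmax a ha M (U a x) x
        have h3 : H a x M = k ^ 2 * M -
            reaction q (stepCoeff bp bm x) (stepCoeff a.1 a.2 x) M := by
          simp only [H, truncated, min_self, max_eq_right hmM]
        have h4 : 0 ≤ reaction q (stepCoeff bp bm x) (stepCoeff a.1 a.2 x) M := by
          have hb := stepCoeff_mem hbpI hbmI x
          have ha' := stepCoeff_mem ha.1 ha.2.1 x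
          have h5 : M ≤ M ^ (q - 1) := by
            simpa using rpow_le_rpow_of_exponent_le hM1 (by linarith : (1 : ℝ) ≤ q - 1)
          have h6 : M ^ (-q - 1) ≤ 1 := rpow_le_one_of_one_le_of_nonpos hM1 (by linarith)
          have h7 : A ≤ β * M := by
            have := mul_le_mul_of_nonneg_left hAM hβ.le
            rw [mul_add, mul_div_cancel₀ _ hβ.ne'] at this
            linarith
          have h8 := mul_le_mul hb.1 h5 hM0.le (hβ.le.trans hb.1)
          have h9 := mul_le_mul ha'.2 h6 (by positivity) hA
          unfold reaction
          linarith
        linarith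
    refine ⟨fun x => hm.trans_le (hlow x), fun x => ?_, continuous_greenDeriv hk hh hhb,
      fun x hx => ?_, ?_, ?_⟩
    · have hE : {x : ℝ | sin x = 0}.Countable := by
        refine (countable_range fun n : ℤ => (n : ℝ) * π).mono fun x hx => ?_
        exact sin_eq_zero_iff.1 hx
      have := hasDerivAt_green hk hh hhb hE (fun x hx => continuousAt_truncated hm hUc hx) x
      rwa [← funext hUg] at this
    · refine (hasDerivAt_greenDeriv hk hh hhb
        (continuousAt_truncated hm hUc hx)).congr_deriv ?_
      rw [← hUg x]
      simp only [H, truncated, min_eq_right (hup x), max_eq_right (hlow x)]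
      ring
    · refine huniq (fun x => U a (x + 2 * π)) (by fun_prop) (fun x => hD _) fun x => ?_
      rw [hUg, ← green_comp_add]
      congr! 2 with y
      exact hHcongr _ _ _ (sin_add_two_pi y)
    · refine huniq (fun x => U a (π - x)) (by fun_prop) (fun x => hD _) fun x => ?_
      rw [hUg, ← green_comp_sub_left]
      congr! 2 with y
      exact hHcongr _ _ _ (sin_pi_sub y)
  · have hlip : ∀ a ∈ admissible α A, ∀ a' ∈ admissible α A,
        U a' 0 - U a 0 ≤ m ^ (-q - 1) / c * dist a a' := by
      intro a ha a' ha'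
      obtain ⟨hUc, ⟨D, hD⟩, hUg⟩ := hU a ha
      obtain ⟨hUc', ⟨D', hD'⟩, hUg'⟩ := hU a' ha'
      have h1 := sub_le_of_le_green (ε := dist a a' * m ^ (-q - 1)) hk hΛ hΛk (by positivity)
        (hHm a _ hUc) (hHm a' _ hUc') (fun x => hHb a ha x _) (fun x => hHb a' ha' x _) hD hD'
        (fun x => (hUg' x).le) (fun x => (hUg x).ge) (fun x => ?_) 0
      · rw [show k ^ 2 - Λ = c by linarith] at h1
        exact h1.trans_eq (by ring)
      · have h2 := hHmax a ha (U a x) (U a' x) x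
        have h3 : H a' x (U a' x) - H a x (U a' x) ≤ _ := truncated_sub_truncated_le hm hq x _
        linarith
    refine LipschitzOnWith.continuousOn (K := (m ^ (-q - 1) / c).toNNReal)
      (LipschitzOnWith.of_dist_le_mul fun a ha a' ha' => ?_)
    rw [Real.coe_toNNReal _ (by positivity), Real.dist_eq, abs_le]
    have h1 := hlip a ha a' ha'
    have h2 := hlip a' ha' a ha
    rw [dist_comm a' a] at h2
    constructor <;> linarith

end PeriodicSolution

section HalfPeriod

lemma reaction_eq {q b a p : ℝ} (hp : 0 < p) :
    reaction q b a p = p ^ (-q - 1) * (b * (p ^ q) ^ 2 - a) := by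
  have h : p ^ (q - 1) = p ^ (-q - 1) * (p ^ q) ^ 2 := by
    rw [← rpow_natCast (p ^ q), ← rpow_mul hp.le, ← rpow_add hp]
    congr 1
    push_cast
    ring
  rw [reaction, h]
  ring

lemma reaction_mono {q b a p p' : ℝ} (hq : 2 < q) (hb : 0 ≤ b) (ha : 0 ≤ a) (hp : 0 < p)
    (hpp : p ≤ p') : reaction q b a p ≤ reaction q b a p' := by
  have h1 : p ^ (q - 1) ≤ p' ^ (q - 1) := rpow_le_rpow hp.le hpp (by linarith)
  have h2 : p' ^ (-q - 1) ≤ p ^ (-q - 1) := rpow_le_rpow_of_nonpos hp hpp (by linarith)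
  unfold reaction
  gcongr

/-- A positive solution of the autonomous equation `u'' = N (b u^(q-1) - a u^(-q-1))` on `[0, L]`
with a Neumann condition at `L`. -/
structure IsNeumannSolution (q N b a L : ℝ) (u v : ℝ → ℝ) : Prop where
  pos : ∀ y, 0 < u y
  hasDerivAt : ∀ y, HasDerivAt u (v y) y
  continuous_deriv : Continuous v
  hasDerivAt_deriv : ∀ y ∈ Ioo 0 L, HasDerivAt v (N * reaction q b a (u y)) y
  deriv_right : v L = 0

namespace IsNeumannSolution

variable {q N b a L : ℝ} {u v : ℝ → ℝ}

lemma continuous (h : IsNeumannSolution q N b a L u v) : Continuous u :=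
  continuous_iff_continuousAt.2 fun y => (h.hasDerivAt y).continuousAt

lemma energy (h : IsNeumannSolution q N b a L u v) (hq : 2 < q) (hL : 0 < L) :
    v 0 ^ 2 = 2 * N / q *
      (b * u 0 ^ q + a / u 0 ^ q - (b * u L ^ q + a / u L ^ q)) := by
  have hq0 : q ≠ 0 := by linarith
  have hd : ∀ y ∈ Ioo 0 L,
      HasDerivAt (fun y => v y ^ 2 - 2 * N / q * (b * u y ^ q + a * u y ^ (-q))) 0 y := by
    intro y hy
    have hu := h.hasDerivAt y
    have h1 := (h.hasDerivAt_deriv y hy).fun_pow 2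
    have h2 := (hu.rpow_const (p := q) (Or.inl (h.pos y).ne')).const_mul b
    have h3 := (hu.rpow_const (p := -q) (Or.inl (h.pos y).ne')).const_mul a
    refine (h1.sub ((h2.add h3).const_mul (2 * N / q))).congr_deriv ?_
    unfold reaction
    field_simp
    ring
  have hc : ContinuousOn (fun y => v y ^ 2 - 2 * N / q * (b * u y ^ q + a * u y ^ (-q)))
      (Icc 0 L) := by
    have hcu := h.continuous
    have hcv := h.continuous_deriv
    have hcr : ∀ s : ℝ, Continuous fun y => u y ^ s := fun s =>
      hcu.rpow_const fun y => Or.inl (h.pos y).ne'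
    have := hcr q
    have := hcr (-q)
    fun_prop
  obtain ⟨y, _, hy⟩ := exists_hasDerivAt_eq_slope _ _ hL hc hd
  have h0 := (div_eq_zero_iff.1 hy.symm).resolve_right (by linarith)
  simp only [rpow_neg (h.pos _).le, h.deriv_right] at h0
  linear_combination (-1) * h0

lemma deriv_sq_le (h : IsNeumannSolution q N b a L u v) (hq : 2 < q) (hN : 0 < N) (hb : 0 < b)
    (ha : 0 < a) (hL : 0 < L) : v 0 ^ 2 ≤ 2 * N / q * (b * u 0 ^ q + a / u 0 ^ q) := by
  rw [h.energy hq hL]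
  have := rpow_pos_of_pos (h.pos L) q
  have : 0 ≤ b * u L ^ q + a / u L ^ q := by positivity
  have : 0 < q := by linarith
  gcongr
  linarith

lemma monotoneOn_sub_mul (h : IsNeumannSolution q N b a L u v) (hq : 2 < q) (hN : 0 < N)
    (hb : 0 < b) {m : ℝ} (hm : 0 < m) (hma : b * (m ^ q) ^ 2 = a) :
    MonotoneOn (fun y => (u y - m) * v y) (Icc 0 L) := by
  have hcu := h.continuous
  have hcv := h.continuous_deriv
  have hd : ∀ y ∈ Ioo 0 L, HasDerivAt (fun y => (u y - m) * v y)
      (v y * v y + (u y - m) * (N * reaction q b a (u y))) y := fun y hy =>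
    ((h.hasDerivAt y).sub_const m).mul (h.hasDerivAt_deriv y hy)
  refine monotoneOn_of_deriv_nonneg (convex_Icc _ _) (by fun_prop) (fun y hy => ?_) fun y hy => ?_
  · rw [interior_Icc] at hy
    exact (hd y hy).differentiableAt.differentiableWithinAt
  · rw [interior_Icc] at hy
    rw [(hd y hy).deriv]
    have hr : 0 ≤ (u y - m) * reaction q b a (u y) := by
      have hu := h.pos y
      have h1 : 0 < u y ^ (-q - 1) := by positivity
      have h2 : 0 < u y ^ q := by positivity
      have h3 : 0 < m ^ q := by positivity
      rw [reaction_eq hu, ← hma]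
      rcases le_total m (u y) with hle | hle
      · have : m ^ q ≤ u y ^ q := rpow_le_rpow hm.le hle (by linarith)
        refine mul_nonneg (by linarith) (mul_nonneg h1.le ?_)
        rw [sub_nonneg]
        gcongr
      · have : u y ^ q ≤ m ^ q := rpow_le_rpow hu.le hle (by linarith)
        refine mul_nonneg_of_nonpos_of_nonpos (by linarith)
          (mul_nonpos_of_nonneg_of_nonpos h1.le ?_)
        rw [sub_nonpos]
        gcongr
    have := mul_nonneg hN.le hr
    nlinarith [mul_self_nonneg (v y)]

lemma sub_mul_deriv_nonpos (h : IsNeumannSolution q N b a L u v) (hq : 2 < q) (hN : 0 < N)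
    (hb : 0 < b) {m : ℝ} (hm : 0 < m) (hma : b * (m ^ q) ^ 2 = a) {y : ℝ} (hy : y ∈ Icc 0 L) :
    (u y - m) * v y ≤ 0 := by
  have := h.monotoneOn_sub_mul hq hN hb hm hma hy ⟨hy.1.trans hy.2, le_rfl⟩ hy.2
  simpa [h.deriv_right] using this

lemma antitoneOn_sub_sq (h : IsNeumannSolution q N b a L u v) (hq : 2 < q) (hN : 0 < N)
    (hb : 0 < b) {m : ℝ} (hm : 0 < m) (hma : b * (m ^ q) ^ 2 = a) :
    AntitoneOn (fun y => (u y - m) ^ 2) (Icc 0 L) := by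
  have hcu := h.continuous
  have hd : ∀ y, HasDerivAt (fun y => (u y - m) ^ 2) (2 * ((u y - m) * v y)) y := fun y => by
    refine (((h.hasDerivAt y).sub_const m).fun_pow 2).congr_deriv ?_
    push_cast
    ring
  refine antitoneOn_of_deriv_nonpos (convex_Icc _ _) (by fun_prop)
    (fun y _ => (hd y).differentiableAt.differentiableWithinAt) fun y hy => ?_
  rw [(hd y).deriv]
  linarith [h.sub_mul_deriv_nonpos hq hN hb hm hma (interior_subset hy)]

lemma exists_equilibrium (hq : 2 < q) (hb : 0 < b) (ha : 0 < a) :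
    ∃ m : ℝ, 0 < m ∧ b * (m ^ q) ^ 2 = a := by
  have hq0 : q ≠ 0 := by linarith
  refine ⟨√(a / b) ^ q⁻¹, by positivity, ?_⟩
  rw [rpow_inv_rpow (by positivity) hq0, sq_sqrt (by positivity)]
  field_simp

/-- Slope bounds when the left value lies above the equilibrium. -/
lemma slope_of_above (h : IsNeumannSolution q N b a L u v) (hq : 2 < q) (hN : 0 < N)
    (hb : 0 < b) (ha : 0 < a) (hL : 0 < L) (h1 : 1 ≤ u 0) {r : ℝ} (hr0 : 0 < r) (hr1 : r < 1)
    (har : a < b * r ^ 2) :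
    v 0 ≤ 0 ∧ (N * reaction q b a (r ^ q⁻¹) * L ≤ -v 0 ∨
      2 * N / q * (b + a - (b * r + a / r)) ≤ v 0 ^ 2) := by
  have hq0 : 0 < q := by linarith
  obtain ⟨m, hm, hma⟩ := exists_equilibrium hq hb ha
  have hμ : 0 < m ^ q := by positivity
  have hμr : m ^ q < r := by
    rw [← hma] at har
    exact lt_of_pow_lt_pow_left₀ 2 hr0.le (lt_of_mul_lt_mul_left har hb.le)
  set ρ := r ^ q⁻¹ with hρ
  have hρ0 : 0 < ρ := by positivity
  have hρr : ρ ^ q = r := rpow_inv_rpow hr0.le hq0.ne'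
  have hmρ : m < ρ := by
    rw [← hρr] at hμr
    exact (rpow_lt_rpow_iff hm.le hρ0.le hq0).1 hμr
  have hρ1 : ρ < 1 := rpow_lt_one hr0.le hr1 (by positivity)
  have h0L : (0 : ℝ) ∈ Icc 0 L := ⟨le_rfl, hL.le⟩
  have hLL : L ∈ Icc 0 L := ⟨hL.le, le_rfl⟩
  have hsq := h.antitoneOn_sub_sq hq hN hb hm hma
  have hcu := h.continuous
  refine ⟨?_, ?_⟩
  · have := h.sub_mul_deriv_nonpos hq hN hb hm hma h0L
    by_contra! hv
    have := mul_pos (show 0 < u 0 - m by linarith) hv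
    linarith
  rcases lt_or_ge ρ (u L) with hlt | hge
  · left
    have hge : ∀ y ∈ Icc 0 L, ρ ≤ u y := by
      intro y hy
      have hy2 : (u L - m) ^ 2 ≤ (u y - m) ^ 2 := hsq hy hLL hy.2
      have hpos : m ≤ u y := by
        by_contra! hneg
        obtain ⟨z, hz, hzm⟩ := intermediate_value_Icc hy.2 hcu.continuousOn
          (show m ∈ Icc (u y) (u L) from ⟨hneg.le, by linarith⟩)
        have h2 : (u L - m) ^ 2 ≤ (u z - m) ^ 2 := hsq ⟨hy.1.trans hz.1, hz.2⟩ hLL hz.2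
        rw [hzm] at h2
        nlinarith
      have := abs_le_of_sq_le_sq' hy2 (by linarith)
      linarith [this.2]
    obtain ⟨y, hy, hslope⟩ := exists_hasDerivAt_eq_slope v _ hL h.continuous_deriv.continuousOn
      h.hasDerivAt_deriv
    rw [h.deriv_right, sub_zero, zero_sub, eq_div_iff hL.ne'] at hslope
    rw [← hslope]
    have := reaction_mono hq hb.le ha.le hρ0 (hge y ⟨hy.1.le, hy.2.le⟩)
    gcongr
  · right
    have hmL : m ≤ u L := by
      by_contra! hneg
      obtain ⟨z, hz, hzm⟩ := intermediate_value_Icc' hL.le hcu.continuousOn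
        (show m ∈ Icc (u L) (u 0) from ⟨hneg.le, by linarith⟩)
      have h2 : (u L - m) ^ 2 ≤ (u z - m) ^ 2 := hsq hz hLL hz.2
      rw [hzm] at h2
      nlinarith
    rw [h.energy hq hL]
    have hYm : m ^ q ≤ u L ^ q := rpow_le_rpow hm.le hmL hq0.le
    have hYr : u L ^ q ≤ r := by
      rw [← hρr]
      exact rpow_le_rpow (h.pos L).le hge hq0.le
    have hX : 1 ≤ u 0 ^ q := one_le_rpow h1 hq0.le
    generalize u 0 ^ q = X at hX ⊢
    generalize u L ^ q = Y at hYm hYr ⊢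
    generalize m ^ q = μ at hμ hμr hma hYm
    have hY : 0 < Y := by linarith
    have hX0 : 0 < X := by linarith
    have e1 : b * Y + a / Y ≤ b * r + a / r := by
      have : b * r + a / r - (b * Y + a / Y) = (r - Y) * (b * (r * Y) - a) / (r * Y) := by
        field_simp
        ring
      have h3 : a ≤ b * (r * Y) := by
        rw [← hma]
        refine mul_le_mul_of_nonneg_left ?_ hb.le
        nlinarith
      have := div_nonneg (mul_nonneg (sub_nonneg.2 hYr) (sub_nonneg.2 h3)) (mul_pos hr0 hY).le
      linarith
    have e2 : b + a ≤ b * X + a / X := by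
      have : b * X + a / X - (b + a) = (X - 1) * (b * X - a) / X := by
        field_simp
        ring
      have h3 : r ^ 2 ≤ 1 := pow_le_one₀ hr0.le hr1.le
      have h4 := mul_le_mul_of_nonneg_left (h3.trans hX) hb.le
      have h5 : a ≤ b * X := by linarith
      have := div_nonneg (mul_nonneg (sub_nonneg.2 hX) (sub_nonneg.2 h5)) hX0.le
      linarith
    gcongr 2 * N / q * ?_
    linarith

/-- Slope bounds when the solution starts at a value at least `1` with positive slope. -/
lemma slope_of_pos (h : IsNeumannSolution q N b a L u v) (hq : 2 < q) (hN : 0 < N)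
    (hb : 0 < b) (ha : 0 < a) (hL : 0 < L) (h1 : 1 ≤ u 0) (hv : 0 < v 0) :
    b * (u 0 ^ q) ^ 2 ≤ a ∧ v 0 ^ 2 ≤ 2 * N / q * (√a - √b) ^ 2 := by
  have hq0 : 0 < q := by linarith
  obtain ⟨m, hm, hma⟩ := exists_equilibrium hq hb ha
  have h0 := h.sub_mul_deriv_nonpos hq hN hb hm hma ⟨le_rfl, hL.le⟩
  have hum : u 0 ≤ m := by
    by_contra! hlt
    have := mul_pos (sub_pos.2 hlt) hv
    linarith
  have hX : 1 ≤ u 0 ^ q := one_le_rpow h1 hq0.le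
  have hXm : u 0 ^ q ≤ m ^ q := rpow_le_rpow (h.pos 0).le hum hq0.le
  have hXa : b * (u 0 ^ q) ^ 2 ≤ a := by
    rw [← hma]
    gcongr
  refine ⟨hXa, ?_⟩
  rw [h.energy hq hL]
  have hY : 0 < u L ^ q := rpow_pos_of_pos (h.pos L) q
  generalize u 0 ^ q = X at hX hXa ⊢
  generalize u L ^ q = Y at hY ⊢
  have hX0 : 0 < X := by linarith
  have e1 : 2 * (√a * √b) ≤ b * Y + a / Y := by
    have h2 : 0 ≤ (√b * Y - √a) ^ 2 / Y := by positivity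
    have h3 : (√b * Y - √a) ^ 2 / Y = √b ^ 2 * Y + √a ^ 2 / Y - 2 * (√a * √b) := by
      field_simp
      ring
    rw [sq_sqrt ha.le, sq_sqrt hb.le] at h3
    linarith
  have e2 : b * X + a / X ≤ b + a := by
    have : b + a - (b * X + a / X) = (X - 1) * (a - b * X) / X := by
      field_simp
      ring
    have h3 : b * X ≤ a := by nlinarith
    have := div_nonneg (mul_nonneg (sub_nonneg.2 hX) (sub_nonneg.2 h3)) hX0.le
    linarith
  have e3 : (√a - √b) ^ 2 = a + b - 2 * (√a * √b) := by
    rw [sub_sq, sq_sqrt ha.le, sq_sqrt hb.le]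
    ring
  rw [e3]
  gcongr 2 * N / q * ?_
  linarith

end IsNeumannSolution

/-- Two Neumann solutions with common left value and opposite slopes cannot start at a value at
least `1` if the energy of the first exceeds that of the second. -/
lemma left_value_lt_one {q N b a b' a' L r : ℝ} {u v u' v' : ℝ → ℝ}
    (h : IsNeumannSolution q N b a L u v) (h' : IsNeumannSolution q N b' a' L u' v')
    (hq : 2 < q) (hN : 0 < N) (hb : 0 < b) (ha : 0 < a) (hb' : 0 < b') (ha' : 0 < a')
    (hL : 0 < L) (hu : u' 0 = u 0) (hv : v' 0 = -v 0) (hr0 : 0 < r) (hr1 : r < 1)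
    (har : a < b * r ^ 2) (hF : 0 < b + a - (b * r + a / r))
    (hFF : b' ≤ a' → (√a' - √b') ^ 2 < b + a - (b * r + a / r))
    (hσ : 0 < reaction q b a (r ^ q⁻¹))
    (hNσ : 2 / q * (b * (a' / b') + a) < N * (reaction q b a (r ^ q⁻¹) * L) ^ 2) :
    u 0 < 1 := by
  by_contra! h1
  have hq0 : 0 < q := by linarith
  obtain ⟨hv0, hcase⟩ := h.slope_of_above hq hN hb ha hL h1 hr0 hr1 har
  have hneg : 0 < -v 0 := by
    rcases hcase with hc | hc
    · exact lt_of_lt_of_le (by positivity) hc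
    · have : 0 < v 0 ^ 2 := lt_of_lt_of_le (by positivity) hc
      have := (sq_pos_iff.1 this)
      exact neg_pos.2 (lt_of_le_of_ne hv0 this)
  obtain ⟨hX, hup⟩ := h'.slope_of_pos hq hN hb' ha' hL (by rwa [hu]) (by rwa [hv])
  rw [hu] at hX
  have hX1 : 1 ≤ u 0 ^ q := one_le_rpow h1 hq0.le
  have hab : b' ≤ a' := by
    have := mul_le_mul_of_nonneg_left (one_le_pow₀ hX1 : 1 ≤ (u 0 ^ q) ^ 2) hb'.le
    linarith
  rcases hcase with hc | hc
  · have h2 := h.deriv_sq_le hq hN hb ha hL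
    have h3 : u 0 ^ q ≤ a' / b' := by
      rw [le_div_iff₀ hb']
      nlinarith
    have h4 : a / u 0 ^ q ≤ a := div_le_self ha.le hX1
    have h5 : (N * reaction q b a (r ^ q⁻¹) * L) ^ 2 ≤ v 0 ^ 2 := by
      rw [← neg_sq (v 0)]
      gcongr
    have h6 : 2 * N / q * (b * u 0 ^ q + a / u 0 ^ q) ≤ 2 * N / q * (b * (a' / b') + a) := by
      gcongr
    have h7 := mul_lt_mul_of_pos_left hNσ hN
    have h8 : N * (N * (reaction q b a (r ^ q⁻¹) * L) ^ 2) =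
      (N * reaction q b a (r ^ q⁻¹) * L) ^ 2 := by ring
    have h9 : N * (2 / q * (b * (a' / b') + a)) = 2 * N / q * (b * (a' / b') + a) := by ring
    linarith
  · rw [hv, neg_sq] at hup
    have := mul_lt_mul_of_pos_left (hFF hab) (show 0 < 2 * N / q by positivity)
    linarith

end HalfPeriod

section Existence

lemma exists_energy_gap {α β K : ℝ} (hα : 0 < α) (hK : 0 ≤ K) (hαβ : K < β - α) :
    ∃ r : ℝ, 0 < r ∧ r < 1 ∧ α ^ 2 < β ^ 2 * r ^ 2 ∧
      K ^ 2 < β ^ 2 + α ^ 2 - (β ^ 2 * r + α ^ 2 / r) := by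
  have hβ : 0 < β := by linarith
  have hr0 : 0 < α / β := by positivity
  have hr1 : α / β < 1 := (div_lt_one hβ).2 (by linarith)
  have hc : ContinuousAt (fun r : ℝ => β ^ 2 + α ^ 2 - (β ^ 2 * r + α ^ 2 / r)) (α / β) := by
    have := hr0.ne'
    fun_prop (disch := assumption)
  have hval : K ^ 2 < β ^ 2 + α ^ 2 - (β ^ 2 * (α / β) + α ^ 2 / (α / β)) := by
    have : β ^ 2 + α ^ 2 - (β ^ 2 * (α / β) + α ^ 2 / (α / β)) = (β - α) ^ 2 := by
      field_simp
      ring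
    rw [this]
    gcongr
  have h1 := (hc.eventually (lt_mem_nhds hval)).filter_mono
    (nhdsWithin_le_nhds (s := Ioi (α / β)))
  obtain ⟨r, h2, h3, h4⟩ := (h1.and (Ioo_mem_nhdsGT hr1)).exists
  refine ⟨r, hr0.trans h3, h4, ?_, h2⟩
  rw [← mul_pow]
  gcongr
  rwa [div_lt_iff₀' hβ] at h3

/-- As the coupling `N` tends to infinity, two matched Neumann solutions start below `1`. -/
lemma eventually_left_value_lt_one {q α β α' β' L : ℝ} {N a a' : ℝ → ℝ} (hq : 2 < q)
    (hL : 0 < L) (hα : 0 < α) (hαβ : α < β) (hα' : 0 < α') (hβ' : 0 < β')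
    (hsum : α + α' < β + β') (hN : Tendsto N atTop atTop)
    (ha : Tendsto a atTop (𝓝 (α ^ 2))) (ha' : Tendsto a' atTop (𝓝 (α' ^ 2))) :
    ∀ᶠ D in atTop, ∀ u v u' v' : ℝ → ℝ, IsNeumannSolution q (N D) (β ^ 2) (a D) L u v →
      IsNeumannSolution q (N D) (β' ^ 2) (a' D) L u' v' → u' 0 = u 0 → v' 0 = -v 0 →
      u 0 < 1 := by
  have hβ : 0 < β := hα.trans hαβ
  obtain ⟨r, hr0, hr1, hαr, hgap⟩ := exists_energy_gap (K := max (α' - β') 0) (β := β) hα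
    (le_max_right _ _) (max_lt (by linarith) (by linarith))
  have hpos : ∀ {x}, x < β ^ 2 * r ^ 2 → 0 < reaction q (β ^ 2) x (r ^ q⁻¹) := by
    intro x hx
    have hrq : 0 < r ^ q⁻¹ := rpow_pos_of_pos hr0 _
    rw [reaction_eq hrq, rpow_inv_rpow hr0.le (by linarith)]
    exact mul_pos (rpow_pos_of_pos hrq _) (sub_pos.2 hx)
  have hE : Tendsto (fun D => β ^ 2 + a D - (β ^ 2 * r + a D / r)) atTop
      (𝓝 (β ^ 2 + α ^ 2 - (β ^ 2 * r + α ^ 2 / r))) :=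
    (ha.const_add _).sub ((ha.div_const _).const_add _)
  have hK : Tendsto (fun D => max (√(a' D) - β') 0 ^ 2) atTop (𝓝 (max (α' - β') 0 ^ 2)) := by
    have h1 : Tendsto (fun D => √(a' D)) atTop (𝓝 α') := by
      simpa [sqrt_sq hα'.le] using ha'.sqrt
    exact ((h1.sub_const _).max tendsto_const_nhds).pow 2
  have hR : Tendsto (fun D => N D * (reaction q (β ^ 2) (a D) (r ^ q⁻¹) * L) ^ 2)
      atTop atTop := by
    refine hN.atTop_mul_pos (C := (reaction q (β ^ 2) (α ^ 2) (r ^ q⁻¹) * L) ^ 2)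
      (pow_pos (mul_pos (hpos hαr) hL) 2) ?_
    unfold reaction
    exact (((ha.mul_const _).const_sub _).mul_const _).pow 2
  have hB : Tendsto (fun D => 2 / q * (β ^ 2 * (a' D / β' ^ 2) + a D)) atTop
      (𝓝 (2 / q * (β ^ 2 * (α' ^ 2 / β' ^ 2) + α ^ 2))) :=
    (((ha'.div_const _).const_mul _).add ha).const_mul _
  filter_upwards [hN.eventually_gt_atTop 0, ha.eventually_lt_const hαr,
    ha.eventually_const_lt (show 0 < α ^ 2 by positivity),
    ha'.eventually_const_lt (show 0 < α' ^ 2 by positivity), hK.eventually_lt hE hgap,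
    hB.eventually_lt_const (lt_add_one _), hR.eventually_gt_atTop _]
    with D h1 h2 h3 h4 h5 h6 h7 u v u' v' h h' hu hv
  refine left_value_lt_one h h' hq h1 (by positivity) h3 (by positivity) h4 hL hu hv hr0 hr1 h2
    (lt_of_le_of_lt (by positivity) h5) (fun hab => ?_) (hpos h2) (h6.trans h7)
  rw [sqrt_sq hβ'.le]
  refine lt_of_le_of_lt ?_ h5
  have : β' ≤ √(a' D) := le_sqrt_of_sq_le hab
  rw [max_eq_left (sub_nonneg.2 this)]

lemma reaction_rescale {q c B A D x : ℝ} (hD : 0 < D) (hx : 0 < x) :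
    reaction q (c * B) (c * A) x / D =
      c * D ^ (q - 2) * reaction q B (A * D ^ (-(2 * q))) (x / D) := by
  have h1 : D ^ (q - 2) = D ^ (q - 1) / D := by
    rw [← rpow_sub_one hD.ne']
    ring_nf
  have h2 : D ^ (-(2 * q)) * D ^ (q - 1) = D ^ (-q - 1) := by
    rw [← rpow_add hD]
    ring_nf
  have h3 := rpow_pos_of_pos hD (q - 1)
  have h4 := rpow_pos_of_pos hD (-q - 1)
  unfold reaction
  rw [div_rpow hx.le hD.le, div_rpow hx.le hD.le, h1, ← h2]
  have h5 := rpow_pos_of_pos hD (-(2 * q))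
  field_simp

namespace IsPeriodicSolution

variable {q bp bm c D Bp Bm : ℝ} {a A : ℝ × ℝ} {u v : ℝ → ℝ}

lemma deriv_symm (h : IsPeriodicSolution q bp bm a u v) (x : ℝ) : v (π - x) = -v x := by
  have h1 := (h.hasDerivAt (π - x)).comp x ((hasDerivAt_id x).const_sub π)
  have h2 : u ∘ HSub.hSub π = u := funext h.symm
  rw [h2] at h1
  have := h1.unique (h.hasDerivAt x)
  linarith

lemma deriv_periodic (h : IsPeriodicSolution q bp bm a u v) (x : ℝ) :
    v (x + 2 * π) = v x := by
  have h1 := (h.hasDerivAt (x + 2 * π)).comp x ((hasDerivAt_id x).add_const (2 * π))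
  have h2 : u ∘ (fun x => id x + 2 * π) = u := funext h.periodic
  rw [h2] at h1
  have := h1.unique (h.hasDerivAt x)
  linarith

lemma neumann_right (h : IsPeriodicSolution q (c * Bp) bm (c * A.1, c * A.2) u v) (hD : 0 < D) :
    IsNeumannSolution q (c * D ^ (q - 2)) Bp (A.1 * D ^ (-(2 * q))) (π / 2)
      (fun y => u y / D) (fun y => v y / D) where
  pos y := div_pos (h.pos y) hD
  hasDerivAt y := (h.hasDerivAt y).div_const D
  continuous_deriv := h.continuous_deriv.div_const D
  hasDerivAt_deriv y hy := by
    have hs : 0 < sin y := sin_pos_of_pos_of_lt_pi hy.1 (by linarith [hy.2, pi_pos])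
    have := (h.hasDerivAt_deriv y hs.ne').div_const D
    simp only [stepCoeff, if_pos hs] at this
    rwa [reaction_rescale hD (h.pos y)] at this
  deriv_right := by
    have := h.deriv_symm (π / 2)
    rw [show π - π / 2 = π / 2 by ring] at this
    rw [show v (π / 2) = 0 by linarith, zero_div]

lemma neumann_left (h : IsPeriodicSolution q bp (c * Bm) (c * A.1, c * A.2) u v) (hD : 0 < D) :
    IsNeumannSolution q (c * D ^ (q - 2)) Bm (A.2 * D ^ (-(2 * q))) (π / 2)
      (fun y => u (-y) / D) (fun y => -v (-y) / D) where
  pos y := div_pos (h.pos _) hD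
  hasDerivAt y := by
    have := ((h.hasDerivAt (-y)).comp y (hasDerivAt_neg y)).div_const D
    simpa [Function.comp_def] using this
  continuous_deriv := (h.continuous_deriv.comp continuous_neg).neg.div_const D
  hasDerivAt_deriv y hy := by
    have hs : sin (-y) < 0 := by
      rw [sin_neg, neg_lt_zero]
      exact sin_pos_of_pos_of_lt_pi hy.1 (by linarith [hy.2, pi_pos])
    have := (((h.hasDerivAt_deriv (-y) hs.ne).comp y (hasDerivAt_neg y)).neg).div_const D
    simp only [stepCoeff, if_neg hs.not_gt, mul_neg, mul_one, neg_neg] at this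
    rwa [reaction_rescale hD (h.pos _)] at this
  deriv_right := by
    have h1 := h.deriv_symm (-(π / 2))
    have h2 := h.deriv_periodic (-(π / 2))
    rw [show π - -(π / 2) = -(π / 2) + 2 * π by ring] at h1
    rw [show v (-(π / 2)) = 0 by linarith, neg_zero, zero_div]

end IsPeriodicSolution

lemma tendsto_normalized_coeff {q : ℝ} (hq : 0 < q) (E μ σ : ℝ) :
    Tendsto (fun D : ℝ => (E + (μ + σ * D ^ q) ^ 2) * D ^ (-(2 * q))) atTop (𝓝 (σ ^ 2)) := by
  have h1 := (tendsto_rpow_neg_atTop (show 0 < 2 * q by linarith)).const_mul E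
  have h2 := (((tendsto_rpow_neg_atTop hq).const_mul μ).add_const σ).pow 2
  have h3 := h1.add h2
  simp only [mul_zero, zero_add] at h3
  refine h3.congr' ?_
  filter_upwards [eventually_gt_atTop 0] with D hD
  have h4 : D ^ (-(2 * q)) = D ^ (-q) * D ^ (-q) := by
    rw [← rpow_add hD]
    ring_nf
  have h5 : D ^ q * D ^ (-q) = 1 := by
    rw [← rpow_add hD, add_neg_cancel, rpow_zero]
  rw [h4]
  linear_combination (-σ ^ 2 * (D ^ q * D ^ (-q) + 1) - 2 * μ * σ * D ^ (-q)) * h5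

/-- For a suitable large scale `D`, the solution with the corresponding coefficients starts below
`D`. -/
lemma exists_start_lt {q c E t γ μ : ℝ} (hq : 2 < q) (hc : 0 < c) (ht : 1 < |t|)
    (hγ : -1 < γ) (hγ' : γ < 1) :
    ∃ D : ℝ, 0 < D ∧ ∀ u v : ℝ → ℝ,
      IsPeriodicSolution q (c * (t + 1) ^ 2) (c * (t - 1) ^ 2)
        (c * (E + (μ + (γ + 1) * D ^ q) ^ 2), c * (E + (μ + (γ - 1) * D ^ q) ^ 2)) u v →
      u 0 < D := by
  have hN : Tendsto (fun D : ℝ => c * D ^ (q - 2)) atTop atTop :=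
    (tendsto_rpow_atTop (by linarith)).const_mul_atTop hc
  have hp := tendsto_normalized_coeff (show 0 < q by linarith) E μ (γ + 1)
  have hm := tendsto_normalized_coeff (show 0 < q by linarith) E μ (γ - 1)
  rw [show (γ - 1) ^ 2 = (1 - γ) ^ 2 by ring] at hm
  have hsum : (γ + 1) + (1 - γ) < |t + 1| + |t - 1| := by
    have h1 := abs_add_le (t + 1) (t - 1)
    rw [show t + 1 + (t - 1) = 2 * t by ring, abs_mul, abs_two] at h1
    linarith
  have hL : 0 < π / 2 := by positivity
  have hbp : 0 < |t + 1| := by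
    refine abs_pos.2 fun h => ?_
    rw [show t = -1 by linarith, abs_neg, abs_one] at ht
    exact lt_irrefl _ ht
  have hbm : 0 < |t - 1| := by
    refine abs_pos.2 fun h => ?_
    rw [show t = 1 by linarith, abs_one] at ht
    exact lt_irrefl _ ht
  rcases lt_or_ge (γ + 1) |t + 1| with hlt | hge
  · have := eventually_left_value_lt_one hq hL (by linarith) hlt (by linarith) hbm hsum hN hp hm
    obtain ⟨D, h1, hD⟩ := (this.and (eventually_gt_atTop 0)).exists
    simp only [sq_abs] at h1
    refine ⟨D, hD, fun u v h => ?_⟩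
    have h2 := h1 _ _ _ _ (h.neumann_right (A := (_, _)) hD) (h.neumann_left (A := (_, _)) hD)
      (by simp) (by simp [neg_div])
    rwa [div_lt_one hD] at h2
  · have := eventually_left_value_lt_one hq hL (by linarith) (show 1 - γ < |t - 1| by linarith)
      (by linarith) hbp (by linarith) hN hm hp
    obtain ⟨D, h1, hD⟩ := (this.and (eventually_gt_atTop 0)).exists
    simp only [sq_abs] at h1
    refine ⟨D, hD, fun u v h => ?_⟩
    have h2 := h1 _ _ _ _ (h.neumann_left (A := (_, _)) hD) (h.neumann_right (A := (_, _)) hD)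
      (by simp) (by simp [neg_div])
    simpa [div_lt_one hD] using h2

/-- There is a scale `d` and a solution with the corresponding coefficients that starts at `d`. -/
lemma exists_start_eq {q c E t γ μ : ℝ} (hq : 2 < q) (hc : 0 < c) (ht : 1 < |t|)
    (hγ : -1 < γ) (hγ' : γ < 1) (hE : 0 ≤ E) (hEμ : E ≠ 0 ∨ μ ≠ 0) :
    ∃ d : ℝ, 0 < d ∧ ∃ u v : ℝ → ℝ,
      IsPeriodicSolution q (c * (t + 1) ^ 2) (c * (t - 1) ^ 2)
        (c * (E + (μ + (γ + 1) * d ^ q) ^ 2), c * (E + (μ + (γ - 1) * d ^ q) ^ 2)) u v ∧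
      u 0 = d := by
  obtain ⟨D, hD, hlt⟩ := exists_start_lt (E := E) (μ := μ) hq hc ht hγ hγ'
  set p : ℝ → ℝ × ℝ := fun d =>
    (c * (E + (μ + (γ + 1) * d ^ q) ^ 2), c * (E + (μ + (γ - 1) * d ^ q) ^ 2)) with hp
  have hpow : Continuous fun d : ℝ => d ^ q := continuous_rpow_const (by linarith)
  have hpc : Continuous p := by fun_prop
  have hsum : ∀ d, 0 < (p d).1 + (p d).2 := by
    intro d
    have h0 : 0 < E + (μ + (γ + 1) * d ^ q) ^ 2 + (E + (μ + (γ - 1) * d ^ q) ^ 2) := by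
      rcases hEμ with h | h
      · have := lt_of_le_of_ne hE h.symm
        positivity
      · refine lt_of_le_of_ne (by positivity) fun h0 => h ?_
        have h1 : μ + (γ + 1) * d ^ q = 0 := by
          rw [← sq_eq_zero_iff]
          linarith [sq_nonneg (μ + (γ + 1) * d ^ q), sq_nonneg (μ + (γ - 1) * d ^ q)]
        have h2 : μ + (γ - 1) * d ^ q = 0 := by
          rw [← sq_eq_zero_iff]
          linarith [sq_nonneg (μ + (γ + 1) * d ^ q), sq_nonneg (μ + (γ - 1) * d ^ q)]
        linear_combination (1 - γ) / 2 * h1 + (1 + γ) / 2 * h2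
    have := mul_pos hc h0
    simp only [hp]
    linarith
  have hne : (Icc 0 D).Nonempty := nonempty_Icc.2 hD.le
  obtain ⟨d₀, -, hd₀⟩ := isCompact_Icc.exists_isMinOn hne
    (f := fun d => (p d).1 + (p d).2) (by fun_prop)
  obtain ⟨d₁, -, hd₁⟩ := isCompact_Icc.exists_isMaxOn hne
    (f := fun d => (p d).1 + (p d).2) (by fun_prop)
  have hnn : ∀ d, 0 ≤ (p d).1 ∧ 0 ≤ (p d).2 := fun d => by
    simp only [hp]
    constructor <;> positivity
  have hmaps : MapsTo p (Icc 0 D)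
      (admissible ((p d₀).1 + (p d₀).2) ((p d₁).1 + (p d₁).2)) := by
    intro d hd
    have h1 := hd₁ hd
    simp only [mem_ofPred_eq] at h1
    obtain ⟨h2, h3⟩ := hnn d
    exact ⟨⟨h2, by linarith⟩, ⟨h3, by linarith⟩, hd₀ hd⟩
  have htp : t + 1 ≠ 0 := fun h => by
    rw [show t = -1 by linarith, abs_neg, abs_one] at ht
    exact lt_irrefl _ ht
  have htm : t - 1 ≠ 0 := fun h => by
    rw [show t = 1 by linarith, abs_one] at ht
    exact lt_irrefl _ ht
  obtain ⟨U, V, hUV, hU⟩ := exists_solution_family hq (show 0 < c * (t + 1) ^ 2 by positivity)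
    (show 0 < c * (t - 1) ^ 2 by positivity) (hsum d₀) (hsum d₁).le
  have hcont : ContinuousOn (fun d => U (p d) 0 - d) (Icc 0 D) :=
    (hU.comp hpc.continuousOn hmaps).sub continuousOn_id
  have h0 : 0 < U (p 0) 0 - 0 := by
    rw [sub_zero]
    exact (hUV _ (hmaps ⟨le_rfl, hD.le⟩)).pos 0
  have h1 : U (p D) 0 - D < 0 := sub_neg.2 (hlt _ _ (hUV _ (hmaps ⟨hD.le, le_rfl⟩)))
  obtain ⟨d, hd, hd0⟩ := intermediate_value_Icc' hD.le hcont ⟨h1.le, h0.le⟩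
  have hd1 : U (p d) 0 = d := sub_eq_zero.1 hd0
  have hsol := hUV _ (hmaps hd)
  exact ⟨d, hd1 ▸ hsol.pos 0, _, _, hsol, hd1⟩

/-- Rescaling a periodic solution that starts at `d` solves the model Lichnerowicz equation. -/
lemma IsPeriodicSolution.isModelSolution {n : ℕ} {t γ η μ d : ℝ} {u v : ℝ → ℝ}
    (hq : 0 < qex n) (hκ : 0 < kap n) (hd : 0 < d)
    (h : IsPeriodicSolution (qex n) (1 / (2 * qex n) * (t + 1) ^ 2)
      (1 / (2 * qex n) * (t - 1) ^ 2)
      (1 / (2 * qex n) * (2 * η ^ 2 / kap n + (μ + (γ + 1) * d ^ qex n) ^ 2),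
        1 / (2 * qex n) * (2 * η ^ 2 / kap n + (μ + (γ - 1) * d ^ qex n) ^ 2)) u v) :
    IsModelSolution n t γ η μ d (fun x => u x / d) := by
  have hder : ∀ x, HasDerivAt (fun x => u x / d) (v x / d) x := fun x =>
    (h.hasDerivAt x).div_const d
  have hderiv : deriv (fun x => u x / d) = fun x => v x / d := funext fun x => (hder x).deriv
  refine ⟨fun x => by simp only [h.periodic], fun x => div_pos (h.pos x) hd,
    contDiff_one_iff_deriv.2 ⟨fun x => (hder x).differentiableAt, ?_⟩, fun x hx => ?_⟩
  · rw [hderiv]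
    exact h.continuous_deriv.div_const d
  have hs : sin x ≠ 0 := fun h0 => by
    obtain ⟨k, hk⟩ := sin_eq_zero_iff.1 h0
    exact hx k hk.symm
  have h2 := (h.hasDerivAt_deriv x hs).div_const d
  have e1 : stepCoeff (1 / (2 * qex n) * (t + 1) ^ 2) (1 / (2 * qex n) * (t - 1) ^ 2) x =
      1 / (2 * qex n) * (t + lam x) ^ 2 := by
    unfold stepCoeff lam
    split_ifs <;> ring
  have e2 : stepCoeff (1 / (2 * qex n) * (2 * η ^ 2 / kap n + (μ + (γ + 1) * d ^ qex n) ^ 2))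
      (1 / (2 * qex n) * (2 * η ^ 2 / kap n + (μ + (γ - 1) * d ^ qex n) ^ 2)) x =
      1 / (2 * qex n) * (2 * η ^ 2 / kap n + (μ + (γ + lam x) * d ^ qex n) ^ 2) := by
    unfold stepCoeff lam
    split_ifs <;> ring
  simp only [e1, e2] at h2
  rw [reaction_rescale hd (h.pos x)] at h2
  rw [hderiv]
  refine ⟨h2.differentiableAt, ?_⟩
  rw [h2.deriv, reaction]
  beta_reduce
  generalize lam x = l
  have hy := div_pos (h.pos x) hd
  generalize u x / d = y at hy ⊢
  generalize kap n = κ at hκ ⊢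
  generalize qex n = q at hq ⊢
  have e3 : d ^ (-(q - 2)) * d ^ (q - 2) = 1 := by
    rw [← rpow_add hd, neg_add_cancel, rpow_zero]
  have e4 : d ^ (-(2 * q)) = d ^ (-q) * d ^ (-q) := by
    rw [← rpow_add hd]
    ring_nf
  have e5 : d ^ q * d ^ (-q) = 1 := by
    rw [← rpow_add hd, add_neg_cancel, rpow_zero]
  rw [e4]
  generalize d ^ (-(q - 2)) = N at e3 ⊢
  generalize d ^ (q - 2) = M at e3 ⊢
  generalize d ^ (-q) = P at e5 ⊢
  generalize d ^ q = Q at e5 ⊢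
  generalize y ^ (q - 1) = Y
  generalize y ^ (-q - 1) = Z
  have e6 : (2 * η ^ 2 / κ + (μ + (γ + l) * Q) ^ 2) * (P * P) =
      2 * η ^ 2 / κ * (P * P) + (μ * P + γ + l) ^ 2 := by
    linear_combination ((γ + l) ^ 2 * (Q * P + 1) + 2 * μ * (γ + l) * P) * e5
  rw [e6]
  have e7 : -2 * κ * q * N * (1 / (2 * q) * M * ((t + l) ^ 2 * Y -
      (2 * η ^ 2 / κ * (P * P) + (μ * P + γ + l) ^ 2) * Z)) =
      -(N * M) * (κ * (t + l) ^ 2 * Y - (2 * η ^ 2 * (P * P) + κ * (μ * P + γ + l) ^ 2) * Z) := by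
    field_simp
  rw [e7, e3]
  ring

end Existence

/-- Existence for non-vanishing mean curvature (Theorem 3.6 / Proposition 3.26). -/
theorem nonvanishing_mean_curvature_existence (n : ℕ) (hn : 3 ≤ n) (t γ η μ : ℝ)
    (hγ : -1 < γ ∧ γ < 1) (ht : 1 < |t|) (hTT : η ≠ 0 ∨ μ ≠ 0) :
    ∃ d : ℝ, 0 < d ∧ ∃ ψ : ℝ → ℝ, IsModelSolution n t γ η μ d ψ ∧ ψ 0 = 1 := by
  have hn3 : (3 : ℝ) ≤ n := by exact_mod_cast hn
  have hq : 2 < qex n := by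
    rw [qex, lt_div_iff₀ (by linarith)]
    linarith
  have hκ : 0 < kap n := div_pos (by linarith) (by linarith)
  obtain ⟨d, hd, u, v, h, hu⟩ := exists_start_eq (c := 1 / (2 * qex n)) (E := 2 * η ^ 2 / kap n)
    hq (by positivity) ht hγ.1 hγ.2 (by positivity)
    (hTT.imp_left fun h => by positivity)
  exact ⟨d, hd, _, h.isModelSolution (by linarith) hκ hd, by rw [hu, div_self hd.ne']⟩
end

section
/- Critical transverse-traceless threshold (Theorem 3.7 / Proposition 3.30): Suppose |t| < 1 and μ = 0. For each real η let S(η) denote the set of d > 0 for which some solution ψ of the model Lichnerowicz equation L_d (with parameters t, γ, η, μ = 0) satisfies ψ(0) = 1. Then there exists η₀ ≥ 0 such that: (i) if 0 < |η| < η₀ then S(η) contains at least two distinct elements; (ii) if |η| > η₀ then S(η) is empty; and (iii) if moreover |t| > |γ| then η₀ > 0. -/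
open Real Filter

open Topology Set MeasureTheory

/-- The periodic boundary value problem `u'' = B u^(q-1) - A u^(-q-1)` whose coefficients depend on
the position only through the value of `lam`. -/
def IsPeriodicSolution_s6 (q : ℝ) (A B : ℝ → ℝ) (u : ℝ → ℝ) : Prop :=
  (∀ x, u (x + 2 * Real.pi) = u x) ∧
  (∀ x, 0 < u x) ∧
  ContDiff ℝ 1 u ∧
  ∀ x : ℝ, (∀ k : ℤ, x ≠ (k : ℝ) * Real.pi) →
    HasDerivAt (deriv u) (B (lam x) * u x ^ (q - 1) - A (lam x) * u x ^ (-q - 1)) x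

theorem lam_eq_one_or_neg_one (x : ℝ) : lam x = 1 ∨ lam x = -1 := by
  unfold lam; split_ifs <;> simp

theorem lam_of_sin_pos {x : ℝ} (hx : 0 < Real.sin x) : lam x = 1 := if_pos hx

theorem lam_of_sin_neg {x : ℝ} (hx : Real.sin x < 0) : lam x = -1 := if_neg hx.not_gt

theorem forall_lam {P : ℝ → Prop} : (∀ x, P (lam x)) ↔ P 1 ∧ P (-1) := by
  constructor
  · intro h
    refine ⟨?_, ?_⟩
    · have := h (π / 2)
      rwa [lam_of_sin_pos (by simp)] at this
    · have := h (-(π / 2))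
      rwa [lam_of_sin_neg (by simp)] at this
  · rintro ⟨h1, h2⟩ x
    rcases lam_eq_one_or_neg_one x with h | h <;> rwa [h]

theorem sin_ne_zero_iff_forall_ne {x : ℝ} : Real.sin x ≠ 0 ↔ ∀ k : ℤ, x ≠ (k : ℝ) * π := by
  rw [Ne, Real.sin_eq_zero_iff]
  push Not
  exact forall_congr' fun k => ne_comm

theorem eventually_nhdsGT_lam_eq (x : ℝ) :
    ∃ z, ∀ᶠ y in 𝓝[>] x, Real.sin y ≠ 0 ∧ lam y = lam z := by
  rcases lt_trichotomy (Real.sin x) 0 with h | h | h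
  · refine ⟨x, Filter.Eventually.filter_mono nhdsWithin_le_nhds ?_⟩
    filter_upwards [Real.continuous_sin.continuousAt.eventually_lt_const h] with y hy
    exact ⟨hy.ne, by rw [lam_of_sin_neg hy, lam_of_sin_neg h]⟩
  · have hcos : Real.cos x ≠ 0 := fun h0 => by
      have := Real.sin_sq_add_cos_sq x
      simp [h, h0] at this
    have hs : ∀ y ∈ Ioo x (x + π), Real.sin y = Real.cos x * Real.sin (y - x) ∧
        0 < Real.sin (y - x) := fun y hy => by
      refine ⟨?_, Real.sin_pos_of_pos_of_lt_pi (by linarith [hy.1]) (by linarith [hy.2])⟩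
      have := Real.sin_add x (y - x)
      rw [h] at this
      simpa using this
    have hmem : Ioo x (x + π) ∈ 𝓝[>] x := Ioo_mem_nhdsGT (by linarith [Real.pi_pos])
    rcases lt_or_gt_of_ne hcos with hc | hc
    · refine ⟨-(π / 2), ?_⟩
      filter_upwards [hmem] with y hy
      have : Real.sin y < 0 := by
        rw [(hs y hy).1]; exact mul_neg_of_neg_of_pos hc (hs y hy).2
      exact ⟨this.ne, by rw [lam_of_sin_neg this, lam_of_sin_neg (by simp)]⟩
    · refine ⟨π / 2, ?_⟩
      filter_upwards [hmem] with y hy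
      have : 0 < Real.sin y := by
        rw [(hs y hy).1]; exact mul_pos hc (hs y hy).2
      exact ⟨this.ne', by rw [lam_of_sin_pos this, lam_of_sin_pos (by simp)]⟩
  · refine ⟨x, Filter.Eventually.filter_mono nhdsWithin_le_nhds ?_⟩
    filter_upwards [Real.continuous_sin.continuousAt.eventually_const_lt h] with y hy
    exact ⟨hy.ne', by rw [lam_of_sin_pos hy, lam_of_sin_pos h]⟩

/-- A `C¹` function has no global maximum at a point to the right of which it is strictly convex. -/
theorem not_forall_le_of_eventually_hasDerivAt_deriv_pos {w : ℝ → ℝ} {x : ℝ}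
    (hw : ContDiff ℝ 1 w) (hconv : ∀ᶠ y in 𝓝[>] x, ∃ c > 0, HasDerivAt (deriv w) c y) :
    ¬ ∀ y, w y ≤ w x := by
  intro hmax
  obtain ⟨b, hb, hsub⟩ := mem_nhdsGT_iff_exists_Ioo_subset.1 hconv
  have hb : x < b := hb
  have h0 : deriv w x = 0 := IsLocalMax.deriv_eq_zero (Filter.Eventually.of_forall hmax)
  have hcont : Continuous (deriv w) := hw.continuous_deriv le_rfl
  have hmono : StrictMonoOn (deriv w) (Icc x ((x + b) / 2)) := by
    refine strictMonoOn_of_deriv_pos (convex_Icc _ _) hcont.continuousOn fun y hy => ?_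
    rw [interior_Icc] at hy
    obtain ⟨c, hc, hd⟩ := hsub (show y ∈ Ioo x b from ⟨hy.1, by linarith [hy.2]⟩)
    rwa [hd.deriv]
  have hmono' : StrictMonoOn w (Icc x ((x + b) / 2)) := by
    refine strictMonoOn_of_deriv_pos (convex_Icc _ _) hw.continuous.continuousOn fun y hy => ?_
    rw [interior_Icc] at hy
    have := hmono (left_mem_Icc.2 (by linarith)) ⟨hy.1.le, hy.2.le⟩ hy.1
    rwa [h0] at this
  have := hmono' (left_mem_Icc.2 (by linarith)) (right_mem_Icc.2 (by linarith))
    (by linarith : x < (x + b) / 2)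
  exact this.not_ge (hmax _)

theorem exists_forall_le_of_periodic {w : ℝ → ℝ} (hw : Continuous w)
    (hper : ∀ x, w (x + 2 * π) = w x) : ∃ x, ∀ y, w y ≤ w x := by
  obtain ⟨x, -, hx⟩ := isCompact_Icc.exists_isMaxOn
    (nonempty_Icc.2 (by positivity : (0 : ℝ) ≤ 2 * π)) hw.continuousOn
  refine ⟨x, fun y => ?_⟩
  obtain ⟨z, hz, hzy⟩ := Function.Periodic.exists_mem_Ico₀ (f := w) hper (by positivity) y
  rw [hzy]
  exact hx ⟨hz.1, hz.2.le⟩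

namespace IsPeriodicSolution_s6

variable {q : ℝ} {A B A' B' u v : ℝ → ℝ}

/-- The difference of two solutions has no global maximum where the right-hand sides are ordered. -/
theorem not_forall_sub_le (hu : IsPeriodicSolution_s6 q A B u) (hv : IsPeriodicSolution_s6 q A' B' v)
    {x : ℝ} (h : ∀ z, B' (lam z) * v x ^ (q - 1) - A' (lam z) * v x ^ (-q - 1) <
      B (lam z) * u x ^ (q - 1) - A (lam z) * u x ^ (-q - 1)) :
    ¬ ∀ y, u y - v y ≤ u x - v x := by
  obtain ⟨-, hup, huc, hud⟩ := hu
  obtain ⟨-, hvp, hvc, hvd⟩ := hv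
  refine not_forall_le_of_eventually_hasDerivAt_deriv_pos (huc.sub hvc) ?_
  obtain ⟨z, hz⟩ := eventually_nhdsGT_lam_eq x
  have hcu (a : ℝ) : Continuous fun y => u y ^ a :=
    huc.continuous.rpow_const fun y => Or.inl (hup y).ne'
  have hcv (a : ℝ) : Continuous fun y => v y ^ a :=
    hvc.continuous.rpow_const fun y => Or.inl (hvp y).ne'
  have h1 : ∀ᶠ y in 𝓝[>] x, B' (lam z) * v y ^ (q - 1) - A' (lam z) * v y ^ (-q - 1) <
      B (lam z) * u y ^ (q - 1) - A (lam z) * u y ^ (-q - 1) := by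
    refine Filter.Eventually.filter_mono nhdsWithin_le_nhds ?_
    exact ContinuousAt.eventually_lt
      (((hcv _).const_mul _).sub ((hcv _).const_mul _)).continuousAt
      (((hcu _).const_mul _).sub ((hcu _).const_mul _)).continuousAt (h z)
  filter_upwards [hz, h1] with y hy hlt
  have hy' := sin_ne_zero_iff_forall_ne.1 hy.1
  refine ⟨_, ?_, (HasDerivAt.sub (hud y hy') (hvd y hy')).congr_of_eventuallyEq ?_⟩
  · rw [hy.2]; linarith
  · exact Filter.Eventually.of_forall fun y => deriv_sub
      (huc.differentiable one_ne_zero y) (hvc.differentiable one_ne_zero y)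

theorem exists_forall_sub_le (hu : IsPeriodicSolution_s6 q A B u)
    (hv : IsPeriodicSolution_s6 q A' B' v) : ∃ x, ∀ y, u y - v y ≤ u x - v x :=
  exists_forall_le_of_periodic (w := fun y => u y - v y)
    (hu.2.2.1.continuous.sub hv.2.2.1.continuous) fun x => by rw [hu.1, hv.1]

theorem le_of_coeff_le (hq : 1 ≤ q) (hu : IsPeriodicSolution_s6 q A B u)
    (hv : IsPeriodicSolution_s6 q A' B' v) (hA' : ∀ x, 0 < A' (lam x)) (hB' : ∀ x, 0 ≤ B' (lam x))
    (hA : ∀ x, A (lam x) ≤ A' (lam x)) (hB : ∀ x, B' (lam x) ≤ B (lam x)) (x : ℝ) :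
    u x ≤ v x := by
  obtain ⟨x₀, hx₀⟩ := hu.exists_forall_sub_le hv
  by_contra! hlt
  refine hu.not_forall_sub_le hv (x := x₀) (fun z => ?_) hx₀
  have hvu : v x₀ < u x₀ := by linarith [hx₀ x]
  have h1 : v x₀ ^ (q - 1) ≤ u x₀ ^ (q - 1) :=
    Real.rpow_le_rpow (hv.2.1 x₀).le hvu.le (by linarith)
  have h2 : u x₀ ^ (-q - 1) < v x₀ ^ (-q - 1) :=
    Real.rpow_lt_rpow_of_neg (hv.2.1 x₀) hvu (by linarith)
  have h3 := Real.rpow_pos_of_pos (hv.2.1 x₀) (q - 1)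
  have h4 := Real.rpow_pos_of_pos (hu.2.1 x₀) (-q - 1)
  have h5 : B' (lam z) * v x₀ ^ (q - 1) ≤ B (lam z) * u x₀ ^ (q - 1) :=
    mul_le_mul (hB z) h1 h3.le ((hB' z).trans (hB z))
  have h6 : A (lam z) * u x₀ ^ (-q - 1) ≤ A' (lam z) * u x₀ ^ (-q - 1) :=
    mul_le_mul_of_nonneg_right (hA z) h4.le
  have h7 := mul_lt_mul_of_pos_left h2 (hA' z)
  linarith

theorem lt_of_coeff_lt (hq : 1 ≤ q) (hu : IsPeriodicSolution_s6 q A B u)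
    (hv : IsPeriodicSolution_s6 q A' B' v) (hA' : ∀ x, 0 < A' (lam x)) (hB' : ∀ x, 0 ≤ B' (lam x))
    (hA : ∀ x, A (lam x) < A' (lam x)) (hB : ∀ x, B' (lam x) ≤ B (lam x)) (x : ℝ) :
    u x < v x := by
  obtain ⟨x₀, hx₀⟩ := hu.exists_forall_sub_le hv
  by_contra! hlt
  refine hu.not_forall_sub_le hv (x := x₀) (fun z => ?_) hx₀
  have hvu : u x₀ = v x₀ :=
    (hu.le_of_coeff_le hq hv hA' hB' (fun x => (hA x).le) hB x₀).antisymm (by linarith [hx₀ x])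
  have h3 := Real.rpow_pos_of_pos (hv.2.1 x₀) (q - 1)
  have h4 := Real.rpow_pos_of_pos (hv.2.1 x₀) (-q - 1)
  rw [hvu]
  have h5 := mul_le_mul_of_nonneg_right (hB z) h3.le
  have h6 := mul_lt_mul_of_pos_right (hA z) h4
  linarith

theorem unique (hq : 1 ≤ q) (hu : IsPeriodicSolution_s6 q A B u) (hv : IsPeriodicSolution_s6 q A B v)
    (hA : ∀ x, 0 < A (lam x)) (hB : ∀ x, 0 ≤ B (lam x)) : u = v :=
  funext fun x => (hu.le_of_coeff_le hq hv hA hB (fun _ => le_rfl) (fun _ => le_rfl) x).antisymm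
    (hv.le_of_coeff_le hq hu hA hB (fun _ => le_rfl) (fun _ => le_rfl) x)

theorem const {c : ℝ} (hc : 0 < c) (B : ℝ → ℝ) :
    IsPeriodicSolution_s6 q (fun σ => B σ * c ^ (2 * q)) B fun _ => c := by
  refine ⟨fun _ => rfl, fun _ => hc, contDiff_const, fun x _ => ?_⟩
  have h : c ^ (2 * q) * c ^ (-q - 1) = c ^ (q - 1) := by
    rw [← Real.rpow_add hc]; ring_nf
  rw [mul_assoc, h, sub_self, deriv_const']
  exact hasDerivAt_const x 0

theorem const_mul {c : ℝ} (hc : 0 < c) (hu : IsPeriodicSolution_s6 q A B u) :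
    IsPeriodicSolution_s6 q (fun σ => c ^ (q + 2) * A σ) (fun σ => c ^ (2 - q) * B σ)
      fun x => c * u x := by
  refine ⟨fun x => congrArg (c * ·) (hu.1 x), fun x => mul_pos hc (hu.2.1 x), contDiff_const.mul hu.2.2.1,
    fun x hx => ?_⟩
  have h1 : c ^ (2 - q) * c ^ (q - 1) = c := by
    rw [← Real.rpow_add hc]; ring_nf; exact Real.rpow_one c
  have h2 : c ^ (q + 2) * c ^ (-q - 1) = c := by
    rw [← Real.rpow_add hc]; ring_nf; exact Real.rpow_one c
  have hd : deriv (fun x => c * u x) = fun x => c * deriv u x := by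
    funext y; exact deriv_const_mul_field c
  rw [hd]
  refine ((hu.2.2.2 x hx).const_mul c).congr_deriv ?_
  beta_reduce
  rw [Real.mul_rpow hc.le (hu.2.1 x).le, Real.mul_rpow hc.le (hu.2.1 x).le]
  linear_combination (A (lam x) * u x ^ (-q - 1)) * h2 - (B (lam x) * u x ^ (q - 1)) * h1

theorem comp_pi_sub (hu : IsPeriodicSolution_s6 q A B u) :
    IsPeriodicSolution_s6 q A B fun x => u (π - x) := by
  refine ⟨fun x => ?_, fun x => hu.2.1 _, hu.2.2.1.comp (contDiff_const.sub contDiff_id),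
    fun x hx => ?_⟩
  · simpa only [sub_add_eq_sub_sub, sub_add_cancel] using (hu.1 (π - x - 2 * π)).symm
  · have hd : deriv (fun x => u (π - x)) = fun x => -deriv u (π - x) := by
      funext y; exact deriv_comp_const_sub _ _ _
    have hx' : ∀ k : ℤ, π - x ≠ k * π := by
      rw [← sin_ne_zero_iff_forall_ne] at hx ⊢
      rwa [Real.sin_pi_sub]
    have hl : lam (π - x) = lam x := by simp [lam]
    have := ((hu.2.2.2 _ hx').comp_const_sub π x).neg
    rw [hd]
    rw [hl, neg_neg] at this
    exact this

theorem comp_neg (hu : IsPeriodicSolution_s6 q A B u) :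
    IsPeriodicSolution_s6 q (fun σ => A (-σ)) (fun σ => B (-σ)) fun x => u (-x) := by
  refine ⟨fun x => ?_, fun x => hu.2.1 _, hu.2.2.1.comp contDiff_neg, fun x hx => ?_⟩
  · simpa only [neg_add', sub_add_cancel] using (hu.1 (-x - 2 * π)).symm
  · have hd : deriv (fun x => u (-x)) = fun x => -deriv u (-x) := by
      funext y; exact deriv_comp_neg _ _
    have hs := sin_ne_zero_iff_forall_ne.2 hx
    have hx' : ∀ k : ℤ, -x ≠ k * π := by
      rw [← sin_ne_zero_iff_forall_ne]
      simpa using hs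
    have hl : lam (-x) = -lam x := by
      rcases lt_or_gt_of_ne hs with h | h
      · rw [lam_of_sin_neg h, lam_of_sin_pos (by simpa using h), neg_neg]
      · rw [lam_of_sin_pos h, lam_of_sin_neg (by simpa using h)]
    have h0 := hu.2.2.2 _ hx'
    rw [hl] at h0
    have := (HasDerivAt.scomp x h0 (hasDerivAt_neg x)).neg
    rw [hd]
    exact this.congr_deriv (by simp)

end IsPeriodicSolution_s6

/-- The bounded solution `v` of `-v'' + k² v = g` on the real line. -/
noncomputable def helmholtz (k : ℝ) (g : ℝ → ℝ) (x : ℝ) : ℝ :=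
  (2 * k)⁻¹ * ∫ y, Real.exp (-k * |y|) * g (x + y)

section Helmholtz

variable {k : ℝ} {g : ℝ → ℝ} {C : ℝ}

theorem integral_exp_neg_mul_abs (hk : 0 < k) : ∫ y : ℝ, Real.exp (-k * |y|) = 2 / k := by
  rw [integral_comp_abs (f := fun y => Real.exp (-k * y)),
    integral_exp_mul_Ioi (neg_lt_zero.2 hk) 0]
  simp [div_eq_mul_inv]

theorem integrable_exp_neg_mul_abs (hk : 0 < k) :
    Integrable fun y : ℝ => Real.exp (-k * |y|) := by
  refine not_imp_comm.1 integral_undef ?_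
  rw [integral_exp_neg_mul_abs hk]
  positivity

theorem integrable_exp_neg_mul_abs_mul (hk : 0 < k) (hg : Measurable g) (hC : ∀ x, |g x| ≤ C)
    (x : ℝ) : Integrable fun y : ℝ => Real.exp (-k * |y|) * g (x + y) :=
  (integrable_exp_neg_mul_abs hk).mul_bdd (c := C)
    (hg.comp (measurable_const_add x)).aestronglyMeasurable
    (Filter.Eventually.of_forall fun _ => hC _)

theorem helmholtz_const (hk : 0 < k) (c x : ℝ) : helmholtz k (fun _ => k ^ 2 * c) x = c := by
  unfold helmholtz
  rw [integral_mul_const, integral_exp_neg_mul_abs hk]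
  field_simp

theorem helmholtz_mono (hk : 0 < k) {g₁ g₂ : ℝ → ℝ} {C₁ C₂ : ℝ} (hg₁ : Measurable g₁)
    (hC₁ : ∀ x, |g₁ x| ≤ C₁) (hg₂ : Measurable g₂) (hC₂ : ∀ x, |g₂ x| ≤ C₂)
    (hle : ∀ x, g₁ x ≤ g₂ x) (x : ℝ) : helmholtz k g₁ x ≤ helmholtz k g₂ x := by
  unfold helmholtz
  refine mul_le_mul_of_nonneg_left (integral_mono (integrable_exp_neg_mul_abs_mul hk hg₁ hC₁ x)
    (integrable_exp_neg_mul_abs_mul hk hg₂ hC₂ x) fun y => ?_) (by positivity)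
  exact mul_le_mul_of_nonneg_left (hle _) (Real.exp_nonneg _)

theorem abs_helmholtz_sub_le (hk : 0 < k) {g₁ g₂ : ℝ → ℝ} {C₁ C₂ : ℝ} (hg₁ : Measurable g₁)
    (hC₁ : ∀ x, |g₁ x| ≤ C₁) (hg₂ : Measurable g₂) (hC₂ : ∀ x, |g₂ x| ≤ C₂) {D : ℝ}
    (hD : ∀ x, |g₁ x - g₂ x| ≤ k ^ 2 * D) (x : ℝ) :
    |helmholtz k g₁ x - helmholtz k g₂ x| ≤ D := by
  have hsub : helmholtz k g₁ x - helmholtz k g₂ x = helmholtz k (fun y => g₁ y - g₂ y) x := by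
    unfold helmholtz
    rw [← mul_sub, ← integral_sub (integrable_exp_neg_mul_abs_mul hk hg₁ hC₁ x)
      (integrable_exp_neg_mul_abs_mul hk hg₂ hC₂ x)]
    simp only [mul_sub]
  rw [hsub, abs_le]
  constructor
  · rw [← helmholtz_const hk (-D) x]
    exact helmholtz_mono hk measurable_const (fun _ => le_rfl) (hg₁.sub hg₂) hD
      (fun y => by simpa using (abs_le.1 (hD y)).1) x
  · rw [← helmholtz_const hk D x]
    exact helmholtz_mono hk (hg₁.sub hg₂) hD measurable_const (fun _ => le_rfl)
      (fun y => (abs_le.1 (hD y)).2) x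

theorem helmholtz_comp_add_right (k c x : ℝ) (g : ℝ → ℝ) :
    helmholtz k (fun y => g (y + c)) x = helmholtz k g (x + c) := by
  unfold helmholtz
  simp only [add_right_comm]

theorem integrableOn_exp_mul_Iic_mul (hk : 0 < k) (hg : Measurable g) (hC : ∀ x, |g x| ≤ C)
    (x : ℝ) : IntegrableOn (fun y => Real.exp (k * y) * g y) (Iic x) :=
  (integrableOn_exp_mul_Iic hk x).mul_bdd (c := C) hg.aestronglyMeasurable
    (Filter.Eventually.of_forall hC)

theorem integrableOn_exp_mul_Ioi_mul (hk : 0 < k) (hg : Measurable g) (hC : ∀ x, |g x| ≤ C)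
    (x : ℝ) : IntegrableOn (fun y => Real.exp (-k * y) * g y) (Ioi x) :=
  (integrableOn_exp_mul_Ioi (neg_lt_zero.2 hk) x).mul_bdd (c := C) hg.aestronglyMeasurable
    (Filter.Eventually.of_forall hC)

theorem helmholtz_eq (hk : 0 < k) (hg : Measurable g) (hC : ∀ x, |g x| ≤ C) (x : ℝ) :
    helmholtz k g x = (2 * k)⁻¹ *
      (Real.exp (-k * x) * (∫ y in Iic x, Real.exp (k * y) * g y) +
        Real.exp (k * x) * ∫ y in Ioi x, Real.exp (-k * y) * g y) := by
  have hshift : ∫ y, Real.exp (-k * |y|) * g (x + y) = ∫ y, Real.exp (-k * |y - x|) * g y := by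
    rw [← integral_add_left_eq_self (fun y => Real.exp (-k * |y - x|) * g y) x]
    simp
  have hleft : ∀ y ∈ Iic x, Real.exp (-k * |y - x|) * g y =
      Real.exp (-k * x) * (Real.exp (k * y) * g y) := fun y hy => by
    rw [abs_of_nonpos (by linarith [mem_Iic.1 hy]), ← mul_assoc, ← Real.exp_add]
    ring_nf
  have hright : ∀ y ∈ Ioi x, Real.exp (-k * |y - x|) * g y =
      Real.exp (k * x) * (Real.exp (-k * y) * g y) := fun y hy => by
    rw [abs_of_nonneg (by linarith [mem_Ioi.1 hy]), ← mul_assoc, ← Real.exp_add]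
    ring_nf
  unfold helmholtz
  rw [hshift, ← intervalIntegral.integral_Iic_add_Ioi (b := x),
    setIntegral_congr_fun measurableSet_Iic hleft, setIntegral_congr_fun measurableSet_Ioi hright,
    integral_const_mul, integral_const_mul]
  · exact IntegrableOn.congr_fun ((integrableOn_exp_mul_Iic_mul hk hg hC x).const_mul _)
      (fun y hy => (hleft y hy).symm) measurableSet_Iic
  · exact IntegrableOn.congr_fun ((integrableOn_exp_mul_Ioi_mul hk hg hC x).const_mul _)
      (fun y hy => (hright y hy).symm) measurableSet_Ioi

/-- The Helmholtz potential of a bounded function `g` is `C¹`, and solves the equation wherever `g` is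
continuous, provided that `g` has only countably many discontinuities. -/
theorem helmholtz_contDiff_and_hasDerivAt (hk : 0 < k) (hg : Measurable g)
    (hC : ∀ x, |g x| ≤ C) (hcount : {x | ¬ ContinuousAt g x}.Countable) :
    ContDiff ℝ 1 (helmholtz k g) ∧ ∀ x, ContinuousAt g x →
      HasDerivAt (deriv (helmholtz k g)) (k ^ 2 * helmholtz k g x - g x) x := by
  have hint (a : ℝ) (x y : ℝ) :
      IntervalIntegrable (fun y => Real.exp (a * y) * g y) volume x y := by
    refine IntervalIntegrable.continuousOn_mul ?_ (by fun_prop)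
    exact (intervalIntegrable_const (c := C)).mono_fun hg.aestronglyMeasurable
      (Filter.Eventually.of_forall fun y => (hC y).trans (le_abs_self C))
  set L : ℝ → ℝ := fun x => ∫ y in Iic x, Real.exp (k * y) * g y with hL
  set R : ℝ → ℝ := fun x => ∫ y in Ioi x, Real.exp (-k * y) * g y with hR
  have hLeq : L = fun x => L 0 + ∫ y in (0 : ℝ)..x, Real.exp (k * y) * g y := by
    funext x
    rw [← intervalIntegral.integral_Iic_sub_Iic (integrableOn_exp_mul_Iic_mul hk hg hC 0)
      (integrableOn_exp_mul_Iic_mul hk hg hC x)]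
    simp [hL]
  have hReq : R = fun x => R 0 - ∫ y in (0 : ℝ)..x, Real.exp (-k * y) * g y := by
    funext x
    rw [eq_sub_iff_add_eq']
    exact intervalIntegral.integral_interval_add_Ioi (integrableOn_exp_mul_Ioi_mul hk hg hC 0)
      (integrableOn_exp_mul_Ioi_mul hk hg hC x)
  have hLc : Continuous L := by
    rw [hLeq]
    exact continuous_const.add (intervalIntegral.continuous_primitive (hint k) 0)
  have hRc : Continuous R := by
    rw [hReq]
    exact continuous_const.sub (intervalIntegral.continuous_primitive (hint (-k)) 0)
  have hLd : ∀ x, ContinuousAt g x → HasDerivAt L (Real.exp (k * x) * g x) x := fun x hx => by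
    rw [hLeq]
    exact (intervalIntegral.integral_hasDerivAt_right (hint k 0 x)
      (Measurable.stronglyMeasurable (by fun_prop)).stronglyMeasurableAtFilter
      (by fun_prop)).const_add _
  have hRd : ∀ x, ContinuousAt g x → HasDerivAt R (-(Real.exp (-k * x) * g x)) x :=
    fun x hx => by
    rw [hReq]
    exact (intervalIntegral.integral_hasDerivAt_right (hint (-k) 0 x)
      (Measurable.stronglyMeasurable (by fun_prop)).stronglyMeasurableAtFilter
      (by fun_prop)).const_sub _
  have hE (a x : ℝ) : HasDerivAt (fun x => Real.exp (a * x)) (a * Real.exp (a * x)) x := by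
    simpa [mul_comm] using ((hasDerivAt_id x).const_mul a).exp
  have hexp (x : ℝ) : Real.exp (-k * x) * Real.exp (k * x) = 1 := by
    rw [← Real.exp_add]; simp
  have hu : helmholtz k g = fun x => (2 * k)⁻¹ *
      (Real.exp (-k * x) * L x + Real.exp (k * x) * R x) := funext (helmholtz_eq hk hg hC)
  set V : ℝ → ℝ := fun x => 2⁻¹ * (Real.exp (k * x) * R x - Real.exp (-k * x) * L x) with hV
  have hVc : Continuous V := by fun_prop
  have huc : Continuous (helmholtz k g) := by rw [hu]; fun_prop
  have hud : ∀ x, ContinuousAt g x → HasDerivAt (helmholtz k g) (V x) x := fun x hx => by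
    rw [hu]
    refine ((((hE (-k) x).mul (hLd x hx)).add ((hE k x).mul (hRd x hx))).const_mul _).congr_deriv ?_
    simp only [hV]
    field_simp
    ring
  have hVd : ∀ x, ContinuousAt g x → HasDerivAt V (k ^ 2 * helmholtz k g x - g x) x :=
    fun x hx => by
    refine ((((hE k x).mul (hRd x hx)).sub
      ((hE (-k) x).mul (hLd x hx))).const_mul _).congr_deriv ?_
    rw [hu]
    have h1 := hexp x
    beta_reduce
    generalize Real.exp (-k * x) = a at h1 ⊢
    generalize Real.exp (k * x) = b at h1 ⊢
    field_simp
    linear_combination (-2 * g x) * h1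
  have huV : ∀ x, HasDerivAt (helmholtz k g) (V x) x := fun x => by
    have heq : helmholtz k g = fun x => helmholtz k g 0 + ∫ y in (0 : ℝ)..x, V y := by
      funext x
      rw [integral_eq_of_hasDerivAt_off_countable (helmholtz k g) V hcount huc.continuousOn
        (fun y hy => hud y (not_not.1 hy.2)) (hVc.intervalIntegrable _ _)]
      ring
    rw [heq]
    exact (hVc.integral_hasStrictDerivAt 0 x).hasDerivAt.const_add _
  have hderiv : deriv (helmholtz k g) = V := funext fun x => (huV x).deriv
  refine ⟨contDiff_one_iff_deriv.2 ⟨fun x => (huV x).differentiableAt, hderiv ▸ hVc⟩, ?_⟩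
  rw [hderiv]
  exact hVd

end Helmholtz

theorem countable_setOf_sin_eq_zero : {x : ℝ | Real.sin x = 0}.Countable := by
  refine (countable_range fun k : ℤ => (k : ℝ) * π).mono fun x hx => ?_
  exact Real.sin_eq_zero_iff.1 hx

theorem eventually_nhds_lam_eq {x : ℝ} (hx : Real.sin x ≠ 0) : ∀ᶠ y in 𝓝 x, lam y = lam x := by
  rcases lt_or_gt_of_ne hx with h | h
  · filter_upwards [Real.continuous_sin.continuousAt.eventually_lt_const h] with y hy
    rw [lam_of_sin_neg hy, lam_of_sin_neg h]
  · filter_upwards [Real.continuous_sin.continuousAt.eventually_const_lt h] with y hy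
    rw [lam_of_sin_pos hy, lam_of_sin_pos h]

theorem measurable_comp_lam {F : ℝ → ℝ → ℝ} (hF : ∀ x, Measurable (F (lam x))) :
    Measurable fun x => F (lam x) x := by
  rw [forall_lam (P := fun σ => Measurable (F σ))] at hF
  have : (fun x => F (lam x) x) = fun x => if 0 < Real.sin x then F 1 x else F (-1) x := by
    funext x; unfold lam; split_ifs <;> rfl
  rw [this]
  exact Measurable.ite (measurableSet_lt measurable_const Real.measurable_sin) hF.1 hF.2

theorem lam_add_two_pi (x : ℝ) : lam (x + 2 * π) = lam x := by simp [lam]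

/-- Existence of periodic solutions of `u'' = k² u - h (lam x) u` for `h` a strict contraction
(relative to `k²`) mapping the interval `[m, M]` to `[k² m, k² M]`. -/
theorem exists_periodic_of_lipschitz {k m M : ℝ} (hk : 0 < k) (hmM : m ≤ M) {ρ : NNReal}
    (hρ : ρ < 1) {h : ℝ → ℝ → ℝ}
    (hlip : ∀ x, ∀ s ∈ Icc m M, ∀ s' ∈ Icc m M,
      |h (lam x) s - h (lam x) s'| ≤ k ^ 2 * (ρ * |s - s'|))
    (hran : ∀ x, ∀ s ∈ Icc m M, h (lam x) s ∈ Icc (k ^ 2 * m) (k ^ 2 * M)) :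
    ∃ u : ℝ → ℝ, (∀ x, u (x + 2 * π) = u x) ∧ (∀ x, u x ∈ Icc m M) ∧ ContDiff ℝ 1 u ∧
      ∀ x, (∀ j : ℤ, x ≠ j * π) →
        HasDerivAt (deriv u) (k ^ 2 * u x - h (lam x) (u x)) x := by
  set N : (ℝ → ℝ) → ℝ → ℝ := fun u y => h (lam y) (projIcc m M hmM (u y)) with hN
  have hcont (x : ℝ) : Continuous fun s => h (lam x) (projIcc m M hmM s) := by
    refine (LipschitzWith.of_dist_le_mul (K := Real.toNNReal (k ^ 2) * ρ) fun s s' => ?_).continuous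
    rw [Real.dist_eq, Real.dist_eq, NNReal.coe_mul, Real.coe_toNNReal _ (sq_nonneg k), mul_assoc]
    refine (hlip x _ (projIcc m M hmM s).2 _ (projIcc m M hmM s').2).trans ?_
    exact mul_le_mul_of_nonneg_left (mul_le_mul_of_nonneg_left (abs_projIcc_sub_projIcc hmM)
      ρ.coe_nonneg) (sq_nonneg k)
  have hmeas (u : ℝ → ℝ) (hu : Continuous u) : Measurable (N u) :=
    measurable_comp_lam (F := fun σ y => h σ (projIcc m M hmM (u y)))
      fun x => ((hcont x).comp hu).measurable
  have hat (u : ℝ → ℝ) (hu : Continuous u) (x : ℝ) (hx : Real.sin x ≠ 0) :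
      ContinuousAt (N u) x := by
    refine ((hcont x).comp hu).continuousAt.congr ?_
    filter_upwards [eventually_nhds_lam_eq hx] with y hy
    simp [hN, hy]
  have hNran (u : ℝ → ℝ) (y : ℝ) : N u y ∈ Icc (k ^ 2 * m) (k ^ 2 * M) :=
    hran y _ (projIcc m M hmM (u y)).2
  have hbd (u : ℝ → ℝ) (y : ℝ) : |N u y| ≤ max |k ^ 2 * m| |k ^ 2 * M| :=
    abs_le_max_abs_abs (hNran u y).1 (hNran u y).2
  have hTran (u : ℝ → ℝ) (hu : Continuous u) (x : ℝ) : helmholtz k (N u) x ∈ Icc m M := by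
    constructor
    · rw [← helmholtz_const hk m x]
      exact helmholtz_mono hk measurable_const (fun _ => le_rfl) (hmeas u hu) (hbd u)
        (fun y => (hNran u y).1) x
    · rw [← helmholtz_const hk M x]
      exact helmholtz_mono hk (hmeas u hu) (hbd u) measurable_const (fun _ => le_rfl)
        (fun y => (hNran u y).2) x
  have hreg (u : ℝ → ℝ) (hu : Continuous u) := helmholtz_contDiff_and_hasDerivAt hk (hmeas u hu)
    (hbd u) (countable_setOf_sin_eq_zero.mono fun x hx => by
      by_contra h0; exact hx (hat u hu x h0))
  let T : BoundedContinuousFunction ℝ ℝ → BoundedContinuousFunction ℝ ℝ := fun u =>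
    BoundedContinuousFunction.ofNormedAddCommGroup (helmholtz k (N u))
      (hreg u u.continuous).1.continuous (max |m| |M|) fun x =>
        abs_le_max_abs_abs (hTran u u.continuous x).1 (hTran u u.continuous x).2
  have hT : ContractingWith ρ T := by
    refine ⟨hρ, LipschitzWith.of_dist_le_mul fun u v => ?_⟩
    rw [BoundedContinuousFunction.dist_le (by positivity)]
    intro x
    refine abs_helmholtz_sub_le hk (hmeas u u.continuous) (hbd u) (hmeas v v.continuous) (hbd v)
      (fun y => (hlip y _ (projIcc m M hmM (u y)).2 _ (projIcc m M hmM (v y)).2).trans ?_) x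
    refine mul_le_mul_of_nonneg_left (mul_le_mul_of_nonneg_left
      ((abs_projIcc_sub_projIcc hmM).trans ?_) ρ.coe_nonneg) (sq_nonneg k)
    rw [← Real.dist_eq]
    exact BoundedContinuousFunction.dist_coe_le_dist y
  obtain ⟨u, hu⟩ : ∃ u, Function.IsFixedPt T u := ⟨_, hT.fixedPoint_isFixedPt⟩
  have hfix : helmholtz k (N u) = u := congrArg (fun v : BoundedContinuousFunction ℝ ℝ => ⇑v) hu
  have hregu := hreg u u.continuous
  have hranu := hTran u u.continuous
  rw [hfix] at hregu hranu
  refine ⟨u, ?_, hranu, hregu.1, fun x hx => ?_⟩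
  · let v := u.compContinuous ⟨fun x => x + 2 * π, by fun_prop⟩
    have hv : Function.IsFixedPt T v := by
      ext x
      have hNv : N v = fun y => N u (y + 2 * π) := by
        funext y
        simp only [hN, lam_add_two_pi]
        rfl
      change helmholtz k (N v) x = u (x + 2 * π)
      rw [hNv, helmholtz_comp_add_right, hfix]
    exact fun x => DFunLike.congr_fun (hT.fixedPoint_unique' hv hu) x
  · have := hregu.2 x (hat u u.continuous x (sin_ne_zero_iff_forall_ne.2 hx))
    simpa only [hN, projIcc_of_mem hmM (hranu x)] using this

theorem hasDerivAt_rpow_sub_rpow (q a b : ℝ) {s : ℝ} (hs : 0 < s) :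
    HasDerivAt (fun s => b * s ^ (q - 1) - a * s ^ (-q - 1))
      (b * ((q - 1) * s ^ (q - 1 - 1)) - a * ((-q - 1) * s ^ (-q - 1 - 1))) s :=
  ((Real.hasDerivAt_rpow_const (Or.inl hs.ne')).const_mul b).sub
    ((Real.hasDerivAt_rpow_const (Or.inl hs.ne')).const_mul a)

theorem exists_bounds_deriv_rpow_sub_rpow {q a b m M : ℝ} (hq : 1 ≤ q) (ha : 0 < a) (hb : 0 < b)
    (hm : 0 < m) (hmM : m ≤ M) : ∃ c > 0, ∃ L, ∀ s ∈ Icc m M,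
      c ≤ b * ((q - 1) * s ^ (q - 1 - 1)) - a * ((-q - 1) * s ^ (-q - 1 - 1)) ∧
      b * ((q - 1) * s ^ (q - 1 - 1)) - a * ((-q - 1) * s ^ (-q - 1 - 1)) ≤ L := by
  have hcont : ContinuousOn (fun s : ℝ => b * ((q - 1) * s ^ (q - 1 - 1)) -
      a * ((-q - 1) * s ^ (-q - 1 - 1))) (Icc m M) := by
    have h (e : ℝ) : ContinuousOn (fun s : ℝ => s ^ e) (Icc m M) :=
      continuousOn_id.rpow_const fun s hs => Or.inl (hm.trans_le hs.1).ne'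
    exact (((h _).const_mul _).const_mul _).sub (((h _).const_mul _).const_mul _)
  obtain ⟨s₀, hs₀, hmin⟩ := isCompact_Icc.exists_isMinOn (nonempty_Icc.2 hmM) hcont
  obtain ⟨s₁, -, hmax⟩ := isCompact_Icc.exists_isMaxOn (nonempty_Icc.2 hmM) hcont
  refine ⟨_, ?_, _, fun s hs => ⟨hmin hs, hmax hs⟩⟩
  have hpos := hm.trans_le hs₀.1
  have h1 := Real.rpow_pos_of_pos hpos (q - 1 - 1)
  have h2 := Real.rpow_pos_of_pos hpos (-q - 1 - 1)
  have h3 : 0 ≤ b * ((q - 1) * s₀ ^ (q - 1 - 1)) := by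
    have : 0 ≤ q - 1 := by linarith
    positivity
  have h4 : 0 < a * ((q + 1) * s₀ ^ (-q - 1 - 1)) := by positivity
  change 0 < _ - _
  linarith

theorem exists_constant_bounds {q : ℝ} {A B : ℝ → ℝ} (hq : 0 < q) (hA : ∀ x, 0 < A (lam x))
    (hB : ∀ x, 0 < B (lam x)) : ∃ m M, 0 < m ∧ m ≤ M ∧
      (∀ x, B (lam x) * m ^ (2 * q) ≤ A (lam x)) ∧
      ∀ x, A (lam x) ≤ B (lam x) * M ^ (2 * q) := by
  set r : ℝ → ℝ := fun σ => (A σ / B σ) ^ (2 * q)⁻¹ with hr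
  have hpos (x : ℝ) : 0 < r (lam x) := Real.rpow_pos_of_pos (div_pos (hA x) (hB x)) _
  have hrA (x : ℝ) : B (lam x) * r (lam x) ^ (2 * q) = A (lam x) := by
    rw [hr, Real.rpow_inv_rpow (div_pos (hA x) (hB x)).le (by positivity)]
    exact mul_div_cancel₀ _ (hB x).ne'
  have hpos' := (forall_lam (P := fun σ => 0 < r σ)).1 hpos
  have hmin : 0 < min (r 1) (r (-1)) := lt_min hpos'.1 hpos'.2
  refine ⟨min (r 1) (r (-1)), max (r 1) (r (-1)), hmin, min_le_max, fun x => ?_, fun x => ?_⟩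
  · rw [← hrA x]
    have : min (r 1) (r (-1)) ≤ r (lam x) :=
      (forall_lam (P := fun σ => min (r 1) (r (-1)) ≤ r σ)).2 ⟨min_le_left _ _, min_le_right _ _⟩ x
    exact mul_le_mul_of_nonneg_left (Real.rpow_le_rpow hmin.le this (by positivity)) (hB x).le
  · nth_rw 1 [← hrA x]
    have : r (lam x) ≤ max (r 1) (r (-1)) :=
      (forall_lam (P := fun σ => r σ ≤ max (r 1) (r (-1)))).2
        ⟨le_max_left _ _, le_max_right _ _⟩ x
    exact mul_le_mul_of_nonneg_left (Real.rpow_le_rpow (hpos x).le this (by positivity)) (hB x).le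

theorem exists_isPeriodicSolution {q : ℝ} {A B : ℝ → ℝ} (hq : 1 ≤ q) (hA : ∀ x, 0 < A (lam x))
    (hB : ∀ x, 0 < B (lam x)) : ∃ u, IsPeriodicSolution_s6 q A B u := by
  obtain ⟨m, M, hm, hmM, hlow, hup⟩ := exists_constant_bounds (q := q) (by linarith) hA hB
  have hM := hm.trans_le hmM
  obtain ⟨c, hc, L, hcL⟩ : ∃ c > 0, ∃ L, ∀ x, ∀ s ∈ Icc m M,
      c ≤ B (lam x) * ((q - 1) * s ^ (q - 1 - 1)) -
        A (lam x) * ((-q - 1) * s ^ (-q - 1 - 1)) ∧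
      B (lam x) * ((q - 1) * s ^ (q - 1 - 1)) -
        A (lam x) * ((-q - 1) * s ^ (-q - 1 - 1)) ≤ L := by
    have hA' := (forall_lam (P := fun σ => 0 < A σ)).1 hA
    have hB' := (forall_lam (P := fun σ => 0 < B σ)).1 hB
    obtain ⟨c₁, hc₁, L₁, h₁⟩ := exists_bounds_deriv_rpow_sub_rpow hq hA'.1 hB'.1 hm hmM
    obtain ⟨c₂, hc₂, L₂, h₂⟩ := exists_bounds_deriv_rpow_sub_rpow hq hA'.2 hB'.2 hm hmM
    refine ⟨min c₁ c₂, lt_min hc₁ hc₂, max L₁ L₂, (forall_lam (P := fun σ => ∀ s ∈ Icc m M,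
      min c₁ c₂ ≤ B σ * ((q - 1) * s ^ (q - 1 - 1)) - A σ * ((-q - 1) * s ^ (-q - 1 - 1)) ∧
      B σ * ((q - 1) * s ^ (q - 1 - 1)) - A σ * ((-q - 1) * s ^ (-q - 1 - 1)) ≤
        max L₁ L₂)).2 ⟨fun s hs => ?_, fun s hs => ?_⟩⟩
    · exact ⟨(min_le_left _ _).trans (h₁ s hs).1, (h₁ s hs).2.trans (le_max_left _ _)⟩
    · exact ⟨(min_le_right _ _).trans (h₂ s hs).1, (h₂ s hs).2.trans (le_max_right _ _)⟩
  have hcL' : c ≤ L := (hcL 0 m ⟨le_rfl, hmM⟩).1.trans (hcL 0 m ⟨le_rfl, hmM⟩).2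
  have hL : 0 < L := hc.trans_le hcL'
  set k := √L with hk
  have hk2 : k ^ 2 = L := Real.sq_sqrt hL.le
  set h : ℝ → ℝ → ℝ := fun σ s => k ^ 2 * s - (B σ * s ^ (q - 1) - A σ * s ^ (-q - 1)) with hh
  have hder (x : ℝ) (s : ℝ) (hs : s ∈ Icc m M) : HasDerivAt (h (lam x)) (k ^ 2 * 1 -
      (B (lam x) * ((q - 1) * s ^ (q - 1 - 1)) - A (lam x) * ((-q - 1) * s ^ (-q - 1 - 1)))) s :=
    ((hasDerivAt_id s).const_mul _).sub
      (hasDerivAt_rpow_sub_rpow q (A (lam x)) (B (lam x)) (hm.trans_le hs.1))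
  have hlip : ∀ x, ∀ s ∈ Icc m M, ∀ s' ∈ Icc m M, |h (lam x) s - h (lam x) s'| ≤
      k ^ 2 * ((Real.toNNReal (1 - c / L) : NNReal) * |s - s'|) := by
    intro x s hs s' hs'
    have hcoe : k ^ 2 * (1 - c / L) = L - c := by rw [hk2]; field_simp
    rw [Real.coe_toNNReal _ (sub_nonneg.2 ((div_le_one hL).2 hcL')), ← mul_assoc, hcoe]
    refine (convex_Icc m M).norm_image_sub_le_of_norm_hasDerivWithin_le
      (fun y hy => (hder x y hy).hasDerivWithinAt) (fun y hy => ?_) hs' hs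
    have := hcL x y hy
    rw [Real.norm_eq_abs, abs_le, hk2]
    constructor <;> linarith
  have hmono (x : ℝ) : MonotoneOn (h (lam x)) (Icc m M) := by
    refine monotoneOn_of_deriv_nonneg (convex_Icc m M)
      (fun y hy => (hder x y hy).continuousAt.continuousWithinAt)
      (fun y hy => (hder x y (interior_subset hy)).differentiableAt.differentiableWithinAt)
      fun y hy => ?_
    rw [(hder x y (interior_subset hy)).deriv, hk2]
    linarith [(hcL x y (interior_subset hy)).2]
  have hrp (s : ℝ) (hs : 0 < s) : s ^ (2 * q) * s ^ (-q - 1) = s ^ (q - 1) := by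
    rw [← Real.rpow_add hs]; ring_nf
  have hran : ∀ x, ∀ s ∈ Icc m M, h (lam x) s ∈ Icc (k ^ 2 * m) (k ^ 2 * M) := by
    intro x s hs
    constructor
    · refine le_trans ?_ (hmono x ⟨le_rfl, hmM⟩ hs hs.1)
      have := mul_le_mul_of_nonneg_right (hlow x) (Real.rpow_pos_of_pos hm (-q - 1)).le
      rw [mul_assoc, hrp m hm] at this
      simp only [hh]
      linarith
    · refine (hmono x hs ⟨hmM, le_rfl⟩ hs.2).trans ?_
      have := mul_le_mul_of_nonneg_right (hup x) (Real.rpow_pos_of_pos hM (-q - 1)).le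
      rw [mul_assoc (B _), hrp M hM] at this
      simp only [hh]
      linarith
  obtain ⟨u, hper, hmem, hC, hd⟩ := exists_periodic_of_lipschitz (Real.sqrt_pos.2 hL) hmM
    (by rw [← NNReal.coe_lt_coe, Real.coe_toNNReal _ (sub_nonneg.2 ((div_le_one hL).2 hcL'))]
        simp only [NNReal.coe_one]
        linarith [div_pos hc hL]) hlip hran
  refine ⟨u, hper, fun x => hm.trans_le (hmem x).1, hC, fun x hx => (hd x hx).congr_deriv ?_⟩
  simp only [hh]
  ring

/-- The coefficient of `ψ ^ (-q - 1)` in the normal form of the Lichnerowicz equation. -/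
noncomputable def coeffA (q κ γ η d σ : ℝ) : ℝ :=
  d ^ (q - 2) / (2 * q) * ((γ + σ) ^ 2 + 2 * η ^ 2 * d ^ (-(2 * q)) / κ)

/-- The coefficient of `ψ ^ (q - 1)` in the normal form of the Lichnerowicz equation. -/
noncomputable def coeffB (q t d σ : ℝ) : ℝ := d ^ (q - 2) / (2 * q) * (t + σ) ^ 2

theorem two_lt_qex {n : ℕ} (hn : 3 ≤ n) : 2 < qex n := by
  have hn' : (3 : ℝ) ≤ n := by exact_mod_cast hn
  unfold qex
  rw [lt_div_iff₀ (by linarith)]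
  linarith

theorem kap_pos {n : ℕ} (hn : 3 ≤ n) : 0 < kap n := by
  have hn' : (3 : ℝ) ≤ n := by exact_mod_cast hn
  exact div_pos (by linarith) (by linarith)

theorem isModelSolution_iff {n : ℕ} (hn : 3 ≤ n) {t γ η d : ℝ} (hd : 0 < d) {ψ : ℝ → ℝ} :
    IsModelSolution n t γ η 0 d ψ ↔
      IsPeriodicSolution_s6 (qex n) (coeffA (qex n) (kap n) γ η d) (coeffB (qex n) t d) ψ := by
  have hq := two_lt_qex hn
  have hκ := kap_pos hn
  generalize hq0 : qex n = q at *
  generalize hk0 : kap n = κ at *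
  have hdp : d ^ (-(q - 2)) = (d ^ (q - 2))⁻¹ := Real.rpow_neg hd.le _
  have hdpos : 0 < d ^ (q - 2) := Real.rpow_pos_of_pos hd _
  unfold IsModelSolution IsPeriodicSolution_s6 coeffA coeffB
  refine and_congr_right fun _ => and_congr_right fun _ => and_congr_right fun _ =>
    forall_congr' fun x => forall_congr' fun _ => ?_
  rw [hq0, hk0, hdp, zero_mul, zero_add]
  generalize d ^ (q - 2) = D at *
  generalize d ^ (-(2 * q)) = E
  generalize ψ x ^ (q - 1) = P
  generalize ψ x ^ (-q - 1) = R
  constructor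
  · rintro ⟨h1, h2⟩
    refine h1.hasDerivAt.congr_deriv ?_
    field_simp
    field_simp at h2
    linarith
  · intro h
    refine ⟨h.differentiableAt, ?_⟩
    rw [h.deriv]
    field_simp
    ring

theorem lam_add_sq_pos {t : ℝ} (ht : |t| < 1) (x : ℝ) : 0 < (t + lam x) ^ 2 := by
  obtain ⟨h1, h2⟩ := abs_lt.1 ht
  rcases lam_eq_one_or_neg_one x with h | h <;> rw [h] <;> nlinarith

theorem coeffA_pos {q κ γ η d : ℝ} (hq : 2 < q) (hκ : 0 < κ) (hγ : |γ| < 1) (hd : 0 < d) (x : ℝ) :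
    0 < coeffA q κ γ η d (lam x) := by
  have := lam_add_sq_pos hγ x
  have := Real.rpow_pos_of_pos hd (q - 2)
  have := Real.rpow_pos_of_pos hd (-(2 * q))
  unfold coeffA
  positivity

theorem coeffB_pos {q t d : ℝ} (hq : 2 < q) (ht : |t| < 1) (hd : 0 < d) (x : ℝ) :
    0 < coeffB q t d (lam x) := by
  have := lam_add_sq_pos ht x
  have := Real.rpow_pos_of_pos hd (q - 2)
  unfold coeffB
  positivity

theorem coeffA_le {q κ γ η η' d : ℝ} (hq : 2 < q) (hκ : 0 < κ) (hd : 0 < d) (hη : |η| ≤ |η'|)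
    (σ : ℝ) : coeffA q κ γ η d σ ≤ coeffA q κ γ η' d σ := by
  have := Real.rpow_pos_of_pos hd (q - 2)
  have := Real.rpow_pos_of_pos hd (-(2 * q))
  have := sq_le_sq.2 hη
  unfold coeffA
  gcongr

theorem coeffA_lt {q κ γ η η' d : ℝ} (hq : 2 < q) (hκ : 0 < κ) (hd : 0 < d) (hη : |η| < |η'|)
    (σ : ℝ) : coeffA q κ γ η d σ < coeffA q κ γ η' d σ := by
  have := Real.rpow_pos_of_pos hd (q - 2)
  have := Real.rpow_pos_of_pos hd (-(2 * q))
  have := sq_lt_sq.2 hη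
  unfold coeffA
  gcongr

theorem IsPeriodicSolution_s6.one_lt {q : ℝ} {A B ψ : ℝ → ℝ} (hq : 1 ≤ q)
    (hψ : IsPeriodicSolution_s6 q A B ψ) (hB : ∀ x, 0 < B (lam x))
    (hBA : ∀ x, B (lam x) < A (lam x)) (x : ℝ) : 1 < ψ x :=
  (IsPeriodicSolution_s6.const one_pos B).lt_of_coeff_lt hq hψ (fun x => (hB x).trans (hBA x))
    (fun x => (hB x).le) (fun x => by simpa using hBA x) (fun _ => le_rfl) x

/-- The solution is larger than one when the transverse-traceless part dominates. -/
theorem one_lt_of_four_lt {q κ t γ η d : ℝ} (hq : 2 < q) (ht : |t| < 1)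
    (hd : 0 < d) {ψ : ℝ → ℝ} (h4 : 4 < 2 * η ^ 2 * d ^ (-(2 * q)) / κ)
    (hψ : IsPeriodicSolution_s6 q (coeffA q κ γ η d) (coeffB q t d) ψ) (x : ℝ) : 1 < ψ x := by
  refine hψ.one_lt (by linarith) (coeffB_pos hq ht hd) (fun x => ?_) x
  have := Real.rpow_pos_of_pos hd (q - 2)
  refine mul_lt_mul_of_pos_left ?_ (by positivity)
  obtain ⟨h1, h2⟩ := abs_lt.1 ht
  rcases lam_eq_one_or_neg_one x with h | h <;> rw [h] <;> nlinarith [sq_nonneg (γ + 1), sq_nonneg (γ + -1)]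

theorem exists_solution {q κ t γ : ℝ} (hq : 2 < q) (hκ : 0 < κ) (ht : |t| < 1) (hγ : |γ| < 1)
    (η : ℝ) {d : ℝ} (hd : 0 < d) :
    ∃ ψ, IsPeriodicSolution_s6 q (coeffA q κ γ η d) (coeffB q t d) ψ :=
  exists_isPeriodicSolution (by linarith) (coeffA_pos hq hκ hγ hd) (coeffB_pos hq ht hd)

/-- Rescaling a solution by `d` removes `d` from the top-order coefficient. -/
theorem IsPeriodicSolution_s6.rescale {q κ t γ η d : ℝ} (hd : 0 < d) {ψ : ℝ → ℝ}
    (hψ : IsPeriodicSolution_s6 q (coeffA q κ γ η d) (coeffB q t d) ψ) :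
    IsPeriodicSolution_s6 q (fun σ => ((γ + σ) ^ 2 * d ^ (2 * q) + 2 * η ^ 2 / κ) / (2 * q))
      (fun σ => (t + σ) ^ 2 / (2 * q)) fun x => d * ψ x := by
  have h1 : d ^ (q + 2) * d ^ (q - 2) = d ^ (2 * q) := by
    rw [← Real.rpow_add hd]; ring_nf
  have h2 : d ^ (2 - q) * d ^ (q - 2) = 1 := by
    rw [← Real.rpow_add hd]; ring_nf; exact Real.rpow_zero d
  have h3 : d ^ (2 * q) * d ^ (-(2 * q)) = 1 := by
    rw [← Real.rpow_add hd]; ring_nf; exact Real.rpow_zero d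
  convert hψ.const_mul hd using 2 with σ σ
  · unfold coeffA
    linear_combination (-(((γ + σ) ^ 2 + 2 * η ^ 2 * d ^ (-(2 * q)) / κ) / (2 * q))) * h1 -
      2 * η ^ 2 / κ / (2 * q) * h3
  · unfold coeffB
    linear_combination (-((t + σ) ^ 2 / (2 * q))) * h2

theorem continuousOn_of_monotone_of_le_rpow_mul {G : ℝ → ℝ} {p : ℝ}
    (hmono : ∀ d d', 0 < d → d ≤ d' → G d ≤ G d')
    (hle : ∀ d d', 0 < d → d ≤ d' → G d' ≤ (d' / d) ^ p * G d) : ContinuousOn G (Ioi 0) := by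
  intro d₀ (hd₀ : 0 < d₀)
  have hc : ContinuousAt (fun d : ℝ => (d / d₀) ^ p * G d₀) d₀ :=
    ((continuousAt_id.div_const d₀).rpow_const (Or.inl (by simp [hd₀.ne']))).mul_const _
  have hc1 : (d₀ / d₀) ^ p * G d₀ = G d₀ := by rw [div_self hd₀.ne', Real.one_rpow, one_mul]
  have hlo : Tendsto (fun d : ℝ => min ((d / d₀) ^ p * G d₀) (G d₀)) (𝓝 d₀) (𝓝 (G d₀)) := by
    simpa only [hc1, min_self] using (hc.tendsto.min (tendsto_const_nhds (x := G d₀)))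
  have hhi : Tendsto (fun d : ℝ => max ((d / d₀) ^ p * G d₀) (G d₀)) (𝓝 d₀) (𝓝 (G d₀)) := by
    simpa only [hc1, max_self] using (hc.tendsto.max (tendsto_const_nhds (x := G d₀)))
  refine ContinuousAt.continuousWithinAt
    (tendsto_of_tendsto_of_tendsto_of_le_of_le' hlo hhi ?_ ?_)
  · filter_upwards [lt_mem_nhds hd₀] with d hd
    rcases le_total d₀ d with h | h
    · exact (min_le_right _ _).trans (hmono _ _ hd₀ h)
    · refine (min_le_left _ _).trans ?_
      have hp : 0 < (d / d₀) ^ p := Real.rpow_pos_of_pos (div_pos hd hd₀) _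
      calc (d / d₀) ^ p * G d₀ ≤ (d / d₀) ^ p * ((d₀ / d) ^ p * G d) :=
            mul_le_mul_of_nonneg_left (hle _ _ hd h) hp.le
        _ = G d := by
            rw [← mul_assoc, ← Real.mul_rpow (by positivity) (by positivity),
              div_mul_div_cancel₀ hd₀.ne', div_self hd.ne', Real.one_rpow, one_mul]
  · filter_upwards [lt_mem_nhds hd₀] with d hd
    rcases le_total d₀ d with h | h
    · exact (hle _ _ hd₀ h).trans (le_max_left _ _)
    · exact (hmono _ _ hd h).trans (le_max_right _ _)

/-- The value at zero of the solution depends continuously on `d`. -/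
theorem exists_continuousOn_value {q κ t γ : ℝ} (hq : 2 < q) (hκ : 0 < κ) (ht : |t| < 1)
    (hγ : |γ| < 1) (η : ℝ) : ∃ F : ℝ → ℝ, ContinuousOn F (Ioi 0) ∧ ∀ d > 0, ∀ ψ,
      IsPeriodicSolution_s6 q (coeffA q κ γ η d) (coeffB q t d) ψ → ψ 0 = F d := by
  choose! Ψ hΨ using fun d (hd : 0 < d) => exists_solution hq hκ ht hγ η hd
  have hq1 : 1 ≤ q := by linarith
  have hA (d : ℝ) (hd : 0 < d) (x : ℝ) :
      0 < ((γ + lam x) ^ 2 * d ^ (2 * q) + 2 * η ^ 2 / κ) / (2 * q) := by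
    have := lam_add_sq_pos hγ x
    positivity
  have hB (x : ℝ) : 0 < (t + lam x) ^ 2 / (2 * q) := by
    have := lam_add_sq_pos ht x
    positivity
  have hG : ContinuousOn (fun d => d * Ψ d 0) (Ioi 0) := by
    refine continuousOn_of_monotone_of_le_rpow_mul (p := 2 * q / (q + 2))
      (fun d d' hd hdd' => ?_) fun d d' hd hdd' => ?_
    · have hd' := hd.trans_le hdd'
      refine ((hΨ d hd).rescale hd).le_of_coeff_le hq1 ((hΨ d' hd').rescale hd') (hA d' hd')
        (fun x => (hB x).le) (fun x => ?_) (fun _ => le_rfl) 0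
      gcongr
    · have hd' := hd.trans_le hdd'
      have hr : 1 ≤ d' / d := (one_le_div hd).2 hdd'
      set c := (d' / d) ^ (2 * q / (q + 2)) with hc
      have hc1 : 1 ≤ c := Real.one_le_rpow hr (by positivity)
      have hcq : c ^ (q + 2) = (d' / d) ^ (2 * q) := by
        rw [hc, ← Real.rpow_mul (by positivity), div_mul_cancel₀ _ (by positivity)]
      refine ((hΨ d' hd').rescale hd').le_of_coeff_le hq1
        (((hΨ d hd).rescale hd).const_mul (one_pos.trans_le hc1))
        (fun x => mul_pos (Real.rpow_pos_of_pos (one_pos.trans_le hc1) _) (hA d hd x))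
        (fun x => mul_nonneg (Real.rpow_nonneg (one_pos.trans_le hc1).le _) (hB x).le)
        (fun x => ?_) (fun x => ?_) 0
      · rw [hcq, ← mul_div_assoc, mul_add, mul_left_comm,
          ← Real.mul_rpow (by positivity) hd.le, div_mul_cancel₀ _ hd.ne']
        have : 1 ≤ (d' / d) ^ (2 * q) := Real.one_le_rpow hr (by positivity)
        gcongr
        exact le_mul_of_one_le_left (by positivity) this
      · exact mul_le_of_le_one_left (hB x).le
          (Real.rpow_le_one_of_one_le_of_nonpos hc1 (by linarith))
  refine ⟨fun d => d * Ψ d 0 / d, hG.div continuousOn_id fun d hd => hd.ne', fun d hd ψ hψ => ?_⟩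
  rw [hψ.unique hq1 (hΨ d hd) (coeffA_pos hq hκ hγ hd) fun x => (coeffB_pos hq ht hd x).le]
  exact (mul_div_cancel_left₀ _ hd.ne').symm

theorem forall_ne_int_mul_pi_of_mem_Ioo {x : ℝ} (hx : x ∈ Ioo 0 π) (k : ℤ) : x ≠ k * π :=
  sin_ne_zero_iff_forall_ne.1 (Real.sin_pos_of_mem_Ioo hx).ne' k

theorem lam_of_mem_Ioo {x : ℝ} (hx : x ∈ Ioo 0 π) : lam x = 1 :=
  lam_of_sin_pos (Real.sin_pos_of_mem_Ioo hx)

namespace IsPeriodicSolution_s6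

variable {q : ℝ} {A B u : ℝ → ℝ}

theorem hasDerivAt_deriv_of_mem_Ioo (hu : IsPeriodicSolution_s6 q A B u) {x : ℝ} (hx : x ∈ Ioo 0 π) :
    HasDerivAt (deriv u) (B 1 * u x ^ (q - 1) - A 1 * u x ^ (-q - 1)) x := by
  have := hu.2.2.2 x (forall_ne_int_mul_pi_of_mem_Ioo hx)
  rwa [lam_of_mem_Ioo hx] at this

theorem hasDerivAt (hu : IsPeriodicSolution_s6 q A B u) (x : ℝ) : HasDerivAt u (deriv u x) x :=
  (hu.2.2.1.differentiable one_ne_zero x).hasDerivAt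

theorem continuous_deriv (hu : IsPeriodicSolution_s6 q A B u) : Continuous (deriv u) :=
  hu.2.2.1.continuous_deriv le_rfl

theorem le_const (hq : 1 ≤ q) (hu : IsPeriodicSolution_s6 q A B u) (hB : ∀ x, 0 < B (lam x))
    {M : ℝ} (hM : 0 < M) (h : ∀ x, A (lam x) ≤ B (lam x) * M ^ (2 * q)) (x : ℝ) : u x ≤ M :=
  hu.le_of_coeff_le hq (IsPeriodicSolution_s6.const hM B)
    (fun x => mul_pos (hB x) (Real.rpow_pos_of_pos hM _)) (fun x => (hB x).le) h
    (fun _ => le_rfl) x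

theorem const_le (hq : 1 ≤ q) (hu : IsPeriodicSolution_s6 q A B u) (hA : ∀ x, 0 < A (lam x))
    (hB : ∀ x, 0 < B (lam x)) {m : ℝ} (hm : 0 < m)
    (h : ∀ x, B (lam x) * m ^ (2 * q) ≤ A (lam x)) (x : ℝ) : m ≤ u x :=
  (IsPeriodicSolution_s6.const hm B).le_of_coeff_le hq hu hA (fun x => (hB x).le) h
    (fun _ => le_rfl) x

theorem apply_pi_sub (hq : 1 ≤ q) (hu : IsPeriodicSolution_s6 q A B u) (hA : ∀ x, 0 < A (lam x))
    (hB : ∀ x, 0 < B (lam x)) (x : ℝ) : u (π - x) = u x :=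
  congrFun (hu.comp_pi_sub.unique hq hu hA fun x => (hB x).le) x

/-- On `[0, π]` a solution stays above its boundary values up to a multiple of the largest value
of the right-hand side. -/
theorem sub_le_of_mem_Icc (hq : 1 ≤ q) (hu : IsPeriodicSolution_s6 q A B u)
    (hA : ∀ x, 0 < A (lam x)) (hB : ∀ x, 0 < B (lam x)) {M : ℝ} (hM : ∀ x, u x ≤ M) {x : ℝ}
    (hx : x ∈ Icc 0 π) : u 0 - B 1 * M ^ (q - 1) * π ^ 2 ≤ u x := by
  have hA1 := ((forall_lam (P := fun σ => 0 < A σ)).1 hA).1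
  have hB1 := ((forall_lam (P := fun σ => 0 < B σ)).1 hB).1
  have hM0 : 0 < M := (hu.2.1 0).trans_le (hM 0)
  set C := B 1 * M ^ (q - 1) with hC
  have hC0 : 0 ≤ C := by positivity
  have hd (y : ℝ) : HasDerivAt (fun y => u y + C * (y * (π - y))) (deriv u y + C * (π - 2 * y)) y := by
    refine (hu.hasDerivAt y).add ((((hasDerivAt_id y).mul
      ((hasDerivAt_id y).const_sub π)).congr_deriv ?_).const_mul C)
    simp only [id]
    ring
  have hderiv : deriv (fun y => u y + C * (y * (π - y))) =
      fun y => deriv u y + C * (π - 2 * y) := funext fun y => (hd y).deriv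
  have hd2 (y : ℝ) (hy : y ∈ Ioo 0 π) : HasDerivAt (fun y => deriv u y + C * (π - 2 * y))
      (B 1 * u y ^ (q - 1) - A 1 * u y ^ (-q - 1) + C * (-(2 * 1))) y :=
    (hu.hasDerivAt_deriv_of_mem_Ioo hy).add
      ((((hasDerivAt_id y).const_mul 2).const_sub π).const_mul C)
  have hconc : ConcaveOn ℝ (Icc 0 π) fun y => u y + C * (y * (π - y)) := by
    refine concaveOn_of_deriv2_nonpos (convex_Icc 0 π)
      (fun y _ => (hd y).continuousAt.continuousWithinAt)
      (fun y _ => (hd y).differentiableAt.differentiableWithinAt) ?_ ?_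
    · rw [hderiv, interior_Icc]
      exact fun y hy => (hd2 y hy).differentiableAt.differentiableWithinAt
    · rw [interior_Icc]
      intro y hy
      rw [Function.iterate_succ_apply, Function.iterate_one, hderiv, (hd2 y hy).deriv]
      have h1 : B 1 * u y ^ (q - 1) ≤ C :=
        mul_le_mul_of_nonneg_left (Real.rpow_le_rpow (hu.2.1 y).le (hM y) (by linarith)) hB1.le
      have h2 : 0 < A 1 * u y ^ (-q - 1) := mul_pos hA1 (Real.rpow_pos_of_pos (hu.2.1 y) _)
      linarith
  have hmin := hconc.min_le_of_mem_Icc (left_mem_Icc.2 Real.pi_nonneg)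
    (right_mem_Icc.2 Real.pi_nonneg) hx
  have hpi : u π = u 0 := by simpa using hu.apply_pi_sub hq hA hB 0
  rw [hpi, sub_self, mul_zero, zero_mul, mul_zero, min_self, add_zero] at hmin
  have : C * (x * (π - x)) ≤ C * π ^ 2 := by
    refine mul_le_mul_of_nonneg_left ?_ hC0
    nlinarith [hx.1, hx.2]
  linarith

theorem le_deriv_pi_sub_deriv_zero (hq : 1 ≤ q) (hu : IsPeriodicSolution_s6 q A B u)
    (hA : ∀ x, 0 < A (lam x)) (hB : ∀ x, 0 < B (lam x)) {M s : ℝ} (hM : ∀ x, u x ≤ M) (hs : 0 < s)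
    (h : s + B 1 * M ^ (q - 1) * π ^ 2 ≤ u 0) :
    π * (B 1 * s ^ (q - 1) - A 1 * s ^ (-q - 1)) ≤ deriv u π - deriv u 0 := by
  have hA1 := ((forall_lam (P := fun σ => 0 < A σ)).1 hA).1
  have hB1 := ((forall_lam (P := fun σ => 0 < B σ)).1 hB).1
  obtain ⟨ξ, hξ, hslope⟩ := exists_hasDerivAt_eq_slope (deriv u) _ Real.pi_pos
    hu.continuous_deriv.continuousOn fun x hx => hu.hasDerivAt_deriv_of_mem_Ioo hx
  rw [sub_zero, eq_div_iff Real.pi_ne_zero, mul_comm] at hslope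
  rw [← hslope]
  have hsξ : s ≤ u ξ := by
    linarith [hu.sub_le_of_mem_Icc hq hA hB hM (Ioo_subset_Icc_self hξ)]
  have h1 : s ^ (q - 1) ≤ u ξ ^ (q - 1) := Real.rpow_le_rpow hs.le hsξ (by linarith)
  have h2 : u ξ ^ (-q - 1) ≤ s ^ (-q - 1) := Real.rpow_le_rpow_of_nonpos hs hsξ (by linarith)
  gcongr

theorem deriv_pi_eq (hu : IsPeriodicSolution_s6 q A B u) : deriv u π = deriv u (-π) := by
  have h : (fun x => u (x + 2 * π)) = u := funext hu.1
  have := deriv_comp_add_const (f := u) (2 * π) (-π)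
  rw [h] at this
  rw [this]
  congr 1
  ring

end IsPeriodicSolution_s6

theorem forall_lam_neg {P : ℝ → Prop} (h : ∀ x, P (lam x)) (x : ℝ) : P (-lam x) := by
  rw [forall_lam] at h
  refine (forall_lam (P := fun σ => P (-σ))).2 ⟨h.2, ?_⟩ x
  rw [neg_neg]
  exact h.1

/-- For small coefficients the sign of the averaged right-hand side at one decides on which side
of one the solution lies. -/
theorem exists_forall_lt_one {q : ℝ} {a b : ℝ → ℝ} (hq : 1 ≤ q) (ha : ∀ x, 0 < a (lam x))
    (hb : ∀ x, 0 < b (lam x)) (hab : a 1 + a (-1) < b 1 + b (-1)) :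
    ∃ K₀ > 0, ∀ K > 0, K ≤ K₀ → ∀ u,
      IsPeriodicSolution_s6 q (fun σ => K * a σ) (fun σ => K * b σ) u → u 0 < 1 := by
  obtain ⟨m, M, hm, hmM, -, hup⟩ := exists_constant_bounds (q := q) (by linarith) ha hb
  have hM := hm.trans_le hmM
  have hb' := (forall_lam (P := fun σ => 0 < b σ)).1 hb
  obtain ⟨s, hs0, hs1, hs⟩ : ∃ s : ℝ, 0 < s ∧ s < 1 ∧
      0 < b 1 * s ^ (q - 1) - a 1 * s ^ (-q - 1) +
        (b (-1) * s ^ (q - 1) - a (-1) * s ^ (-q - 1)) := by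
    have hc (e : ℝ) : ContinuousAt (fun s : ℝ => s ^ e) 1 :=
      continuousAt_id.rpow_const (Or.inl one_ne_zero)
    have hcont : ContinuousAt (fun s : ℝ => b 1 * s ^ (q - 1) - a 1 * s ^ (-q - 1) +
        (b (-1) * s ^ (q - 1) - a (-1) * s ^ (-q - 1))) 1 :=
      (((hc _).const_mul _).sub ((hc _).const_mul _)).add
        (((hc _).const_mul _).sub ((hc _).const_mul _))
    have hpos := hcont.eventually_const_lt (u := 0) (by
      simp only [Real.one_rpow]
      linarith)
    obtain ⟨s, ⟨h1, h2⟩, h3⟩ := (((hpos.and (lt_mem_nhds one_pos)).filter_mono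
      nhdsWithin_le_nhds).and (self_mem_nhdsWithin (a := (1 : ℝ)) (s := Iio 1))).exists
    exact ⟨s, h2, h3, h1⟩
  have hC : 0 < (b 1 + b (-1)) * M ^ (q - 1) * π ^ 2 := by
    have := hb'.1
    have := hb'.2
    positivity
  refine ⟨(1 - s) / ((b 1 + b (-1)) * M ^ (q - 1) * π ^ 2), div_pos (by linarith) hC,
    fun K hK hKle u hu => ?_⟩
  rw [le_div_iff₀ hC] at hKle
  by_contra! hu1
  have hA (x : ℝ) : 0 < K * a (lam x) := mul_pos hK (ha x)
  have hB (x : ℝ) : 0 < K * b (lam x) := mul_pos hK (hb x)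
  have huM : ∀ x, u x ≤ M := hu.le_const hq hB hM fun x => by
    rw [mul_assoc]
    exact mul_le_mul_of_nonneg_left (hup x) hK.le
  have hM1 : 0 < K * (M ^ (q - 1) * π ^ 2) := by positivity
  have h1 := hu.le_deriv_pi_sub_deriv_zero hq hA hB huM hs0
    (by nlinarith [mul_pos hM1 hb'.2])
  have h2 := hu.comp_neg.le_deriv_pi_sub_deriv_zero hq (forall_lam_neg (P := fun σ => 0 < K * a σ) hA)
    (forall_lam_neg (P := fun σ => 0 < K * b σ) hB) (fun x => huM _) hs0
    (by rw [neg_zero]; nlinarith [mul_pos hM1 hb'.1])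
  have h3 : deriv (fun x => u (-x)) = fun x => -deriv u (-x) := funext fun y => deriv_comp_neg _ _
  simp only [h3, neg_zero] at h2
  simp only [hu.deriv_pi_eq] at h1
  have := mul_pos (mul_pos Real.pi_pos hK) hs
  linarith

/-- If `|γ| < |t|` then for suitable `d` and `η ≠ 0` the solution is smaller than one at zero. -/
theorem exists_solution_lt_one {q κ t γ : ℝ} (hq : 2 < q) (hκ : 0 < κ) (ht : |t| < 1)
    (hγ : |γ| < 1) (htγ : |γ| < |t|) : ∃ d > 0, ∃ η > 0, ∀ ψ,
      IsPeriodicSolution_s6 q (coeffA q κ γ η d) (coeffB q t d) ψ → ψ 0 < 1 := by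
  set δ := (t ^ 2 - γ ^ 2) / 2 with hδ
  have hδ0 : 0 < δ := by linarith [sq_lt_sq.2 htγ]
  obtain ⟨K, hK, h⟩ := exists_forall_lt_one (q := q) (a := fun σ => (γ + σ) ^ 2 + δ)
    (b := fun σ => (t + σ) ^ 2) (by linarith)
    (fun x => add_pos (lam_add_sq_pos hγ x) hδ0) (lam_add_sq_pos ht)
    (by linarith [sq_lt_sq.2 htγ])
  have hq2 : 0 < q - 2 := by linarith
  set d := (2 * q * K) ^ (q - 2)⁻¹ with hd
  have hd0 : 0 < d := Real.rpow_pos_of_pos (by positivity) _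
  have hdK : d ^ (q - 2) / (2 * q) = K := by
    rw [hd, Real.rpow_inv_rpow (by positivity) hq2.ne', mul_div_cancel_left₀ _ (by positivity)]
  have hdq := Real.rpow_pos_of_pos hd0 (2 * q)
  refine ⟨d, hd0, √(δ * κ * d ^ (2 * q) / 2), Real.sqrt_pos.2 (by positivity), fun ψ hψ => ?_⟩
  refine h K hK le_rfl ψ ?_
  convert hψ using 2 with σ σ
  · unfold coeffA
    rw [hdK, Real.sq_sqrt (by positivity), Real.rpow_neg hd0.le]
    field_simp
  · unfold coeffB
    rw [hdK]

namespace IsPeriodicSolution_s6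

variable {q : ℝ} {A B u : ℝ → ℝ}

theorem deriv_pi_div_two (hq : 1 ≤ q) (hu : IsPeriodicSolution_s6 q A B u) (hA : ∀ x, 0 < A (lam x))
    (hB : ∀ x, 0 < B (lam x)) : deriv u (π / 2) = 0 := by
  have h : (fun x => u (π - x)) = u := funext (hu.apply_pi_sub hq hA hB)
  have h2 := deriv_comp_const_sub (f := u) π (π / 2)
  rw [h, sub_half] at h2
  linarith

/-- Conservation of energy between the points `0` and `π / 2`. -/
theorem energy_eq (hq : 1 ≤ q) (hu : IsPeriodicSolution_s6 q A B u) (hA : ∀ x, 0 < A (lam x))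
    (hB : ∀ x, 0 < B (lam x)) :
    q * deriv u 0 ^ 2 - 2 * (B 1 * u 0 ^ q + A 1 * u 0 ^ (-q)) =
      -(2 * (B 1 * u (π / 2) ^ q + A 1 * u (π / 2) ^ (-q))) := by
  have hcont (e : ℝ) : Continuous fun x => u x ^ e :=
    hu.2.2.1.continuous.rpow_const fun x => Or.inl (hu.2.1 x).ne'
  have hE : Continuous fun x =>
      q * deriv u x ^ 2 - 2 * (B 1 * u x ^ q + A 1 * u x ^ (-q)) :=
    ((hu.continuous_deriv.pow 2).const_mul q).sub
      ((((hcont _).const_mul _).add ((hcont _).const_mul _)).const_mul 2)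
  obtain ⟨c, -, hc⟩ := exists_hasDerivAt_eq_slope _ (fun _ => 0) Real.pi_div_two_pos
    hE.continuousOn fun x hx => by
      have hx' : x ∈ Ioo 0 π := ⟨hx.1, hx.2.trans (by linarith [Real.pi_pos])⟩
      refine ((((hu.hasDerivAt_deriv_of_mem_Ioo hx').pow 2).const_mul q).sub
        (((((hu.hasDerivAt x).rpow_const (p := q) (Or.inl (hu.2.1 x).ne')).const_mul (B 1)).add
          (((hu.hasDerivAt x).rpow_const (p := -q) (Or.inl (hu.2.1 x).ne')).const_mul
            (A 1))).const_mul 2)).congr_deriv ?_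
      ring
  rw [eq_div_iff (by linarith [Real.pi_pos]), zero_mul] at hc
  rw [hu.deriv_pi_div_two hq hA hB] at hc
  linarith

/-- Exponential approach to the constant equilibrium on `[0, π]`, from below. -/
theorem sub_mul_cosh_le (hq : 2 ≤ q) (hu : IsPeriodicSolution_s6 q A B u) (hA : ∀ x, 0 < A (lam x))
    (hB : ∀ x, 0 < B (lam x)) {p : ℝ} (hp : 1 ≤ p) (hAB : A 1 = B 1 * p ^ (2 * q))
    (hup : ∀ x, u x ≤ p) : (p - u (π / 2)) * Real.cosh (√(B 1) * (π / 2)) ≤ p - u 0 := by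
  have hp0 : 0 < p := by linarith
  have hB1 := ((forall_lam (P := fun σ => 0 < B σ)).1 hB).1
  have hbound (x : ℝ) : B 1 * u x ^ (q - 1) - A 1 * u x ^ (-q - 1) ≤ -(B 1 * (p - u x)) := by
    have hux := hu.2.1 x
    have h1 : p ^ (-q - 1) ≤ u x ^ (-q - 1) :=
      Real.rpow_le_rpow_of_nonpos hux (hup x) (by linarith)
    have h2 : p ^ (2 * q) * p ^ (-q - 1) = p * p ^ (q - 2) := by
      rw [← Real.rpow_add hp0, ← Real.rpow_one_add' hp0.le (by linarith)]
      ring_nf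
    have h3 : u x ^ (q - 1) = u x * u x ^ (q - 2) := by
      rw [← Real.rpow_one_add' hux.le (by linarith)]
      ring_nf
    have h4 : u x ^ (q - 2) ≤ p ^ (q - 2) := Real.rpow_le_rpow hux.le (hup x) (by linarith)
    have h5 : 1 ≤ p ^ (q - 2) := Real.one_le_rpow hp (by linarith)
    have h6 : p * p ^ (q - 2) ≤ p ^ (2 * q) * u x ^ (-q - 1) := by
      rw [← h2]
      exact mul_le_mul_of_nonneg_left h1 (Real.rpow_nonneg hp0.le _)
    have h7 : u x ^ (q - 1) - p ^ (2 * q) * u x ^ (-q - 1) ≤ -(p - u x) := by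
      rw [h3]
      nlinarith [mul_le_mul_of_nonneg_left h4 hux.le,
        mul_nonneg (sub_nonneg.2 (hup x)) (sub_nonneg.2 h5)]
    rw [hAB]
    nlinarith [mul_le_mul_of_nonneg_left h7 hB1.le]
  set k := √(B 1) with hk
  have hk2 : k * k = B 1 := Real.mul_self_sqrt hB1.le
  have hpi := Real.pi_pos
  have harg (x : ℝ) : HasDerivAt (fun x => k * (π / 2 - x)) (k * (-1)) x :=
    ((hasDerivAt_id x).const_sub _).const_mul k
  have hcosh (x : ℝ) := (harg x).cosh
  have hsinh (x : ℝ) := (harg x).sinh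
  have hv (x : ℝ) : HasDerivAt (fun x => p - u x) (-deriv u x) x := (hu.hasDerivAt x).const_sub p
  set h : ℝ → ℝ := fun x => -deriv u x * Real.cosh (k * (π / 2 - x)) -
    (p - u x) * (Real.sinh (k * (π / 2 - x)) * (k * (-1))) with hh
  have hmono : MonotoneOn h (Icc 0 (π / 2)) := by
    have hd (x : ℝ) (hx : x ∈ Ioo 0 (π / 2)) := by
      have hx' : x ∈ Ioo 0 π := ⟨hx.1, hx.2.trans (by linarith)⟩
      exact (((hu.hasDerivAt_deriv_of_mem_Ioo hx').neg).mul (hcosh x)).sub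
        ((hv x).mul ((hsinh x).mul_const (k * (-1))))
    refine monotoneOn_of_deriv_nonneg (convex_Icc _ _) ?_ ?_ ?_
    · have := hu.continuous_deriv
      have := hu.2.2.1.continuous
      exact Continuous.continuousOn (by fun_prop)
    · rw [interior_Icc]
      exact fun x hx => (hd x hx).differentiableAt.differentiableWithinAt
    · rw [interior_Icc]
      intro x hx
      refine le_of_le_of_eq ?_ (hd x hx).deriv.symm
      have hc := Real.cosh_pos (k * (π / 2 - x))
      have := mul_le_mul_of_nonneg_right (hbound x) hc.le
      rw [← hk2] at this ⊢
      rw [Pi.neg_apply]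
      linarith
  have hanti : AntitoneOn (fun x => (p - u x) / Real.cosh (k * (π / 2 - x))) (Icc 0 (π / 2)) := by
    have hd (x : ℝ) := (hv x).div (hcosh x) (Real.cosh_pos _).ne'
    refine antitoneOn_of_deriv_nonpos (convex_Icc _ _)
      (fun x _ => (hd x).continuousAt.continuousWithinAt)
      (fun x _ => (hd x).differentiableAt.differentiableWithinAt) ?_
    rw [interior_Icc]
    intro x hx
    refine le_of_eq_of_le (hd x).deriv (div_nonpos_of_nonpos_of_nonneg ?_ (sq_nonneg _))
    refine (hmono (Ioo_subset_Icc_self hx) (right_mem_Icc.2 (by linarith)) hx.2.le).trans_eq ?_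
    simp [hh, hu.deriv_pi_div_two (by linarith) hA hB]
  have := hanti (left_mem_Icc.2 (by linarith)) (right_mem_Icc.2 (by linarith)) (by linarith)
  simp only [sub_self, mul_zero, Real.cosh_zero, div_one, sub_zero] at this
  rwa [le_div_iff₀ (Real.cosh_pos _)] at this

end IsPeriodicSolution_s6

/-- Comparison of the two energy balances at a common value `X`. -/
theorem sq_sub_sq_le_of_energy_eq {α₁ α₂ β₁ β₂ X Y Z : ℝ} (hα₁ : 0 < α₁) (h₁ : α₁ ≤ β₁)
    (hβ₂ : 0 < β₂) (h₂ : β₂ ≤ α₂) (hX : α₁ / β₁ ≤ X) (hX1 : X ≤ 1) (hY : 0 < Y) (hZ : 0 < Z)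
    (h : β₁ ^ 2 * X + α₁ ^ 2 * X⁻¹ - (β₁ ^ 2 * Z + α₁ ^ 2 * Z⁻¹) =
      β₂ ^ 2 * X + α₂ ^ 2 * X⁻¹ - (β₂ ^ 2 * Y + α₂ ^ 2 * Y⁻¹)) :
    (α₂ - β₂) ^ 2 - (β₁ - α₁) ^ 2 ≤ β₂ ^ 2 * (α₂ / β₂ - Y) ^ 2 / Y := by
  have hβ₁ : 0 < β₁ := hα₁.trans_le h₁
  have hX0 : 0 < X := (div_pos hα₁ hβ₁).trans_le hX
  rw [div_le_iff₀ hβ₁] at hX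
  have hZ1 : 2 * (α₁ * β₁) ≤ β₁ ^ 2 * Z + α₁ ^ 2 * Z⁻¹ := by
    have : β₁ ^ 2 * Z + α₁ ^ 2 * Z⁻¹ - 2 * (α₁ * β₁) = (β₁ * Z - α₁) ^ 2 / Z := by
      field_simp
      ring
    linarith [div_nonneg (sq_nonneg (β₁ * Z - α₁)) hZ.le]
  have hY1 : β₂ ^ 2 * Y + α₂ ^ 2 * Y⁻¹ = 2 * (α₂ * β₂) + β₂ ^ 2 * (α₂ / β₂ - Y) ^ 2 / Y := by
    field_simp
    ring
  have hX1' : β₁ ^ 2 * X + α₁ ^ 2 * X⁻¹ ≤ α₁ ^ 2 + β₁ ^ 2 := by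
    have : α₁ ^ 2 + β₁ ^ 2 - (β₁ ^ 2 * X + α₁ ^ 2 * X⁻¹) =
        (1 - X) * (β₁ ^ 2 * X - α₁ ^ 2) / X := by
      field_simp
      ring
    have h3 : 0 ≤ (1 - X) * (β₁ ^ 2 * X - α₁ ^ 2) / X := by
      refine div_nonneg (mul_nonneg (by linarith) ?_) hX0.le
      nlinarith
    linarith
  have hX2 : α₂ ^ 2 + β₂ ^ 2 ≤ β₂ ^ 2 * X + α₂ ^ 2 * X⁻¹ := by
    have : β₂ ^ 2 * X + α₂ ^ 2 * X⁻¹ - (α₂ ^ 2 + β₂ ^ 2) =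
        (1 - X) * (α₂ ^ 2 - β₂ ^ 2 * X) / X := by
      field_simp
      ring
    have h3 : 0 ≤ (1 - X) * (α₂ ^ 2 - β₂ ^ 2 * X) / X := by
      refine div_nonneg (mul_nonneg (by linarith) ?_) hX0.le
      nlinarith [sq_nonneg β₂]
    linarith
  linarith

theorem add_div_five_le_sqrt {g δ : ℝ} (hg2 : g ≤ 2) (hδ : 0 ≤ δ) (hδ1 : δ ≤ 1) :
    g + δ / 5 ≤ √(g ^ 2 + δ) :=
  Real.le_sqrt_of_sq_le (by nlinarith)

/-- Bernoulli's inequality as a mean value bound. -/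
theorem rpow_sub_rpow_le {q p y : ℝ} (hq : 1 ≤ q) (hp : 0 < p) (hy : 0 ≤ y) :
    p ^ q - y ^ q ≤ p ^ q * (q * ((p - y) / p)) := by
  have h := one_add_mul_self_le_rpow_one_add (s := y / p - 1)
    (by linarith [div_nonneg hy hp.le]) hq
  rw [add_sub_cancel, Real.div_rpow hy hp.le, le_div_iff₀ (Real.rpow_pos_of_pos hp q)] at h
  have : (p - y) / p = -(y / p - 1) := by
    field_simp
    ring
  rw [this]
  linarith

theorem exp_div_four_le_cosh_sq (x : ℝ) : Real.exp (2 * x) / 4 ≤ Real.cosh x ^ 2 := by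
  have h : Real.exp (2 * x) = Real.exp x ^ 2 := by rw [sq, ← Real.exp_add, two_mul]
  rw [h, Real.cosh_eq]
  nlinarith [Real.exp_pos x, Real.exp_pos (-x)]

theorem sq_mul_sq_sub_div_le {q α β Y g c E : ℝ} (hβ : 0 < β) (hg : 0 < g) (hgY : g ≤ Y)
    (hc : 0 < c) (hE : 0 < E) (h0 : 0 ≤ α / β - Y) (h : α / β - Y ≤ α / β * (q * (1 / c)))
    (hα : α ^ 2 ≤ 5) (hEc : E / 4 ≤ c ^ 2) :
    β ^ 2 * (α / β - Y) ^ 2 / Y ≤ 20 * q ^ 2 / (g * E) := by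
  calc β ^ 2 * (α / β - Y) ^ 2 / Y ≤ β ^ 2 * (α / β * (q * (1 / c))) ^ 2 / g := by gcongr
    _ = α ^ 2 * q ^ 2 / g * (1 / c ^ 2) := by field_simp
    _ ≤ 5 * q ^ 2 / g * (1 / (E / 4)) := by gcongr
    _ = 20 * q ^ 2 / (g * E) := by
        field_simp
        ring

set_option maxHeartbeats 400000 in
/-- If the coefficients are so large that the boundary layers are thin, then the solution is larger
than one at zero. -/
theorem one_lt_of_exp_lt {q K t γ δ : ℝ} (hq : 2 < q) (hK : 0 < K) (ht : |t| < 1) (hγ : |γ| < 1)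
    (hγt : γ < t) (hδ : 0 < δ) (hδ1 : δ ≤ 1) (hδt : (1 + γ) ^ 2 + δ ≤ (1 + t) ^ 2)
    (hexp : 50 * q ^ 2 * (1 + t) / (1 + γ) * Real.exp (-(π * √(K * (t - 1) ^ 2))) < (t - γ) * δ)
    {u : ℝ → ℝ} (hu : IsPeriodicSolution_s6 q (fun σ => K * ((γ + σ) ^ 2 + δ))
      (fun σ => K * (t + σ) ^ 2) u) : 1 < u 0 := by
  have hq0 : 0 < q := by linarith
  have hq1 : 1 ≤ q := by linarith
  obtain ⟨ht1, ht2⟩ := abs_lt.1 ht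
  obtain ⟨hγ1, hγ2⟩ := abs_lt.1 hγ
  by_contra! hu1
  have hA (x : ℝ) : 0 < K * ((γ + lam x) ^ 2 + δ) :=
    mul_pos hK (add_pos (lam_add_sq_pos hγ x) hδ)
  have hB (x : ℝ) : 0 < K * (t + lam x) ^ 2 := mul_pos hK (lam_add_sq_pos ht x)
  have hA' := forall_lam_neg (P := fun σ => 0 < K * ((γ + σ) ^ 2 + δ)) hA
  have hB' := forall_lam_neg (P := fun σ => 0 < K * (t + σ) ^ 2) hB
  set α₁ := √((1 + γ) ^ 2 + δ) with hα₁
  set α₂ := √((1 - γ) ^ 2 + δ) with hα₂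
  have hα₁s : α₁ ^ 2 = (1 + γ) ^ 2 + δ := Real.sq_sqrt (by positivity)
  have hα₂s : α₂ ^ 2 = (1 - γ) ^ 2 + δ := Real.sq_sqrt (by positivity)
  have hα₁l : 1 + γ + δ / 5 ≤ α₁ := add_div_five_le_sqrt (by linarith) hδ.le hδ1
  have hα₂l : 1 - γ + δ / 5 ≤ α₂ := add_div_five_le_sqrt (by linarith) hδ.le hδ1
  have hα₁0 : 0 < α₁ := by linarith
  have hα₂0 : 0 < α₂ := by linarith
  have hα₁u : α₁ ≤ 1 + t := Real.sqrt_le_iff.2 ⟨by linarith, hδt⟩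
  have hβ₁ : 0 < 1 + t := by linarith
  have hβ₂ : 0 < 1 - t := by linarith
  clear_value α₁ α₂
  -- the constant equilibria
  have hP0 : 0 < α₂ / (1 - t) := div_pos hα₂0 hβ₂
  have hR0 : 0 < α₁ / (1 + t) := div_pos hα₁0 hβ₁
  set p := (α₂ / (1 - t)) ^ q⁻¹ with hp
  set r := (α₁ / (1 + t)) ^ q⁻¹ with hr
  have hp0 : 0 < p := Real.rpow_pos_of_pos hP0 _
  have hr0 : 0 < r := Real.rpow_pos_of_pos hR0 _
  have hpq : p ^ q = α₂ / (1 - t) := Real.rpow_inv_rpow hP0.le hq0.ne'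
  have hrq : r ^ q = α₁ / (1 + t) := Real.rpow_inv_rpow hR0.le hq0.ne'
  have hp1 : 1 ≤ p := Real.one_le_rpow ((one_le_div hβ₂).2 (by linarith)) (by positivity)
  have hr1 : r ≤ 1 := Real.rpow_le_one hR0.le ((div_le_one hβ₁).2 hα₁u) (by positivity)
  have hp2 : p ^ (2 * q) = (α₂ / (1 - t)) ^ 2 := by
    rw [mul_comm, Real.rpow_mul hp0.le, hpq, Real.rpow_two]
  have hr2 : r ^ (2 * q) = (α₁ / (1 + t)) ^ 2 := by
    rw [mul_comm, Real.rpow_mul hr0.le, hrq, Real.rpow_two]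
  clear_value p r
  have hAB : K * ((γ + -1) ^ 2 + δ) = K * (t + -1) ^ 2 * p ^ (2 * q) := by
    rw [hp2, div_pow, hα₂s]
    field_simp
    ring
  have hAB' : K * ((γ + 1) ^ 2 + δ) = K * (t + 1) ^ 2 * r ^ (2 * q) := by
    rw [hr2, div_pow, hα₁s]
    field_simp
    ring
  have hle1 : K * ((γ + 1) ^ 2 + δ) ≤ K * (t + 1) ^ 2 :=
    mul_le_mul_of_nonneg_left (by linarith) hK.le
  have hle2 : K * (t + -1) ^ 2 ≤ K * ((γ + -1) ^ 2 + δ) :=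
    by
    have := pow_le_pow_left₀ hβ₂.le (by linarith : 1 - t ≤ 1 - γ) 2
    exact mul_le_mul_of_nonneg_left (by linarith) hK.le
  have hup : ∀ x, u x ≤ p := hu.le_const hq1 hB hp0 <| (forall_lam (P := fun σ =>
      K * ((γ + σ) ^ 2 + δ) ≤ K * (t + σ) ^ 2 * p ^ (2 * q))).2
    ⟨hle1.trans (le_mul_of_one_le_right (by positivity) (Real.one_le_rpow hp1 (by linarith))),
      hAB.le⟩
  have hlow : ∀ x, r ≤ u x := hu.const_le hq1 hA hB hr0 <| (forall_lam (P := fun σ =>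
      K * (t + σ) ^ 2 * r ^ (2 * q) ≤ K * ((γ + σ) ^ 2 + δ))).2
    ⟨hAB'.ge, (mul_le_of_le_one_right (by positivity)
      (Real.rpow_le_one hr0.le hr1 (by linarith))).trans hle2⟩
  have hlowq (x : ℝ) : α₁ / (1 + t) ≤ u x ^ q := by
    rw [← hrq]
    exact Real.rpow_le_rpow hr0.le (hlow x) hq0.le
  -- energy
  have hE₁ := hu.energy_eq hq1 hA hB
  have hE₂ := hu.comp_neg.energy_eq hq1 hA' hB'
  have hdneg : deriv (fun x => u (-x)) = fun x => -deriv u (-x) :=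
    funext fun y => deriv_comp_neg _ _
  simp only [hdneg, neg_zero] at hE₂
  have hneg (x : ℝ) : u x ^ (-q) = (u x ^ q)⁻¹ := Real.rpow_neg (hu.2.1 x).le q
  rw [hneg, hneg] at hE₁ hE₂
  have hgap := sq_sub_sq_le_of_energy_eq (α₂ := α₂) hα₁0 hα₁u hβ₂ (by linarith) (hlowq 0)
    (Real.rpow_le_one (hu.2.1 0).le hu1 hq0.le)
    (Real.rpow_pos_of_pos (hu.2.1 (-(π / 2))) q) (Real.rpow_pos_of_pos (hu.2.1 (π / 2)) q) (by
      rw [hα₁s, hα₂s]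
      refine mul_left_cancel₀ hK.ne' ?_
      linear_combination (hE₂ - hE₁) / 2)
  -- decay
  have hdecay := hu.comp_neg.sub_mul_cosh_le hq.le hA' hB' hp1 hAB fun x => hup _
  simp only [neg_zero] at hdecay
  set y := u (-(π / 2)) with hy
  have hy0 : 0 < y := hu.2.1 _
  set c := Real.cosh (√(K * (t + -1) ^ 2) * (π / 2)) with hc
  have hc0 : 0 < c := Real.cosh_pos _
  have hexpc : Real.exp (π * √(K * (t - 1) ^ 2)) / 4 ≤ c ^ 2 := by
    refine le_of_eq_of_le ?_ (exp_div_four_le_cosh_sq _)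
    rw [sub_eq_add_neg]
    ring_nf
  clear_value c
  have hYq : α₁ / (1 + t) ≤ y ^ q := hlowq _
  have hY0 := hR0.trans_le hYq
  have hpy : (p - y) / p ≤ 1 / c := by
    rw [div_le_div_iff₀ hp0 hc0]
    linarith [hu.2.1 0]
  have hPY : α₂ / (1 - t) - y ^ q ≤ α₂ / (1 - t) * (q * (1 / c)) := by
    rw [← hpq]
    refine (rpow_sub_rpow_le hq1 hp0 hy0.le).trans ?_
    gcongr
  have hPY0 : 0 ≤ α₂ / (1 - t) - y ^ q := by
    rw [← hpq, sub_nonneg]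
    exact Real.rpow_le_rpow hy0.le (hup _) hq0.le
  have hg : (1 + γ) / (1 + t) ≤ y ^ q :=
    ((div_le_div_iff_of_pos_right hβ₁).2 (by linarith)).trans hYq
  have hα₂5 : α₂ ^ 2 ≤ 5 := by
    rw [hα₂s]
    linarith [pow_le_pow_left₀ (by linarith : 0 ≤ 1 - γ) (by linarith : 1 - γ ≤ 2) 2]
  have herr := sq_mul_sq_sub_div_le hβ₂ (div_pos (by linarith) hβ₁) hg hc0 (Real.exp_pos _) hPY0
    hPY hα₂5 hexpc
  have hfac : (t - γ) * (2 * δ / 5) ≤ (α₂ - (1 - t)) ^ 2 - (1 + t - α₁) ^ 2 := by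
    have h1 : t - γ ≤ α₂ - (1 - t) + (1 + t - α₁) := by linarith
    have h2 : 2 * δ / 5 ≤ α₂ - (1 - t) - (1 + t - α₁) := by linarith
    have h3 := mul_le_mul h1 h2 (by positivity) (by linarith)
    linarith
  have h20 : 20 * q ^ 2 / ((1 + γ) / (1 + t) * Real.exp (π * √(K * (t - 1) ^ 2))) =
      2 / 5 * (50 * q ^ 2 * (1 + t) / (1 + γ) * Real.exp (-(π * √(K * (t - 1) ^ 2)))) := by
    rw [Real.exp_neg]
    field_simp
    norm_num
  rw [h20] at herr
  linarith [hfac.trans (hgap.trans herr)]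

/-- For `γ < t` and `η ≠ 0` all solutions with large `d` are larger than one at zero. -/
theorem eventually_one_lt_of_lt {q κ t γ η : ℝ} (hq : 2 < q) (hκ : 0 < κ) (ht : |t| < 1)
    (hγ : |γ| < 1) (hγt : γ < t) (hη : η ≠ 0) : ∀ᶠ d in atTop, ∀ ψ,
      IsPeriodicSolution_s6 q (coeffA q κ γ η d) (coeffB q t d) ψ → 1 < ψ 0 := by
  obtain ⟨ht1, ht2⟩ := abs_lt.1 ht
  obtain ⟨hγ1, hγ2⟩ := abs_lt.1 hγ
  have hq0 : 0 < q := by linarith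
  have hq2 : 0 < q - 2 := by linarith
  have hδ : Tendsto (fun d : ℝ => 2 * η ^ 2 * d ^ (-(2 * q)) / κ) atTop (𝓝 0) := by
    simpa using ((tendsto_rpow_neg_atTop (by positivity : 0 < 2 * q)).const_mul
      (2 * η ^ 2)).div_const κ
  set C := 50 * q ^ 2 * (1 + t) / (1 + γ) with hC
  set ω := π * (√(1 / (2 * q)) * (1 - t)) with hω
  have hω0 : 0 < ω := by
    have := Real.sqrt_pos.2 (by positivity : 0 < 1 / (2 * q))
    have := Real.pi_pos
    have : 0 < 1 - t := by linarith
    positivity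
  have hexp : Tendsto (fun d : ℝ => C * (κ / (2 * η ^ 2)) *
      ((d ^ ((q - 2) / 2)) ^ (4 * q / (q - 2)) * Real.exp (-ω * d ^ ((q - 2) / 2))))
      atTop (𝓝 0) := by
    simpa using (((tendsto_rpow_mul_exp_neg_mul_atTop_nhds_zero (4 * q / (q - 2)) ω hω0).comp
      (tendsto_rpow_atTop (by positivity : 0 < (q - 2) / 2))).const_mul (C * (κ / (2 * η ^ 2))))
  filter_upwards [eventually_gt_atTop 0, hδ.eventually_le_const one_pos,
    hδ.eventually_le_const (by nlinarith : 0 < (1 + t) ^ 2 - (1 + γ) ^ 2),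
    hexp.eventually_lt_const (sub_pos.2 hγt)] with d hd h1 h2 h3 ψ hψ
  have hD := Real.rpow_pos_of_pos hd (q - 2)
  have hE := Real.rpow_pos_of_pos hd (2 * q)
  refine one_lt_of_exp_lt (K := d ^ (q - 2) / (2 * q)) (δ := 2 * η ^ 2 * d ^ (-(2 * q)) / κ) hq
    (by positivity) ht hγ hγt ?_ h1 (by linarith) ?_ hψ
  · have := Real.rpow_pos_of_pos hd (-(2 * q))
    positivity
  · have hs : π * √(d ^ (q - 2) / (2 * q) * (t - 1) ^ 2) = ω * d ^ ((q - 2) / 2) := by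
      have e1 : d ^ (q - 2) = (d ^ ((q - 2) / 2)) ^ 2 := by
        rw [← Real.rpow_mul_natCast hd.le]
        norm_num
      have e2 : d ^ (q - 2) / (2 * q) * (t - 1) ^ 2 =
          (d ^ ((q - 2) / 2) * (1 - t)) ^ 2 * (1 / (2 * q)) := by
        rw [e1]
        ring
      rw [e2, Real.sqrt_mul (sq_nonneg _), Real.sqrt_sq (mul_nonneg (Real.rpow_nonneg hd.le _)
        (by linarith)), hω]
      ring
    have hp : (d ^ ((q - 2) / 2)) ^ (4 * q / (q - 2)) = d ^ (2 * q) := by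
      rw [← Real.rpow_mul hd.le]
      congr 1
      field_simp
      ring
    rw [hs, Real.rpow_neg hd.le, ← hC]
    rw [hp, neg_mul] at h3
    have hpos : 0 < 2 * η ^ 2 * (d ^ (2 * q))⁻¹ / κ := by positivity
    have := mul_lt_mul_of_pos_right h3 hpos
    refine lt_of_eq_of_lt ?_ this
    field_simp

theorem coeffA_neg (q κ γ η d σ : ℝ) : coeffA q κ γ η d (-σ) = coeffA q κ (-γ) η d σ := by
  unfold coeffA
  ring_nf

theorem coeffB_neg (q t d σ : ℝ) : coeffB q t d (-σ) = coeffB q (-t) d σ := by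
  unfold coeffB
  ring_nf

/-- For `t ≠ γ` and `η ≠ 0` all solutions with large `d` are larger than one at zero. -/
theorem eventually_one_lt {q κ t γ η : ℝ} (hq : 2 < q) (hκ : 0 < κ) (ht : |t| < 1)
    (hγ : |γ| < 1) (hγt : t ≠ γ) (hη : η ≠ 0) : ∀ᶠ d in atTop, ∀ ψ,
      IsPeriodicSolution_s6 q (coeffA q κ γ η d) (coeffB q t d) ψ → 1 < ψ 0 := by
  rcases hγt.lt_or_gt with h | h
  · filter_upwards [eventually_one_lt_of_lt hq hκ ((abs_neg t).trans_lt ht)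
      ((abs_neg γ).trans_lt hγ) (neg_lt_neg h) hη] with d hd ψ hψ
    have := hψ.comp_neg
    simp only [coeffA_neg, coeffB_neg] at this
    simpa using hd _ this
  · exact eventually_one_lt_of_lt hq hκ ht hγ h hη

theorem exists_lt_forall_one_lt {q κ t γ η : ℝ} (hq : 2 < q) (hκ : 0 < κ) (ht : |t| < 1)
    (hη : η ≠ 0) {d₀ : ℝ} (hd₀ : 0 < d₀) : ∃ d, 0 < d ∧ d < d₀ ∧ ∀ ψ,
      IsPeriodicSolution_s6 q (coeffA q κ γ η d) (coeffB q t d) ψ → 1 < ψ 0 := by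
  have h : Tendsto (fun d : ℝ => 2 * η ^ 2 * d ^ (-(2 * q)) / κ) (𝓝[>] 0) atTop :=
    ((tendsto_rpow_neg_nhdsGT_zero (by linarith)).const_mul_atTop (by positivity)).atTop_div_const hκ
  obtain ⟨d, hd4, hd, hdd₀⟩ := ((h.eventually_gt_atTop 4).and
    (Ioo_mem_nhdsGT hd₀)).exists
  exact ⟨d, hd, hdd₀, fun ψ hψ => one_lt_of_four_lt hq ht hd hd4 hψ 0⟩

/-- The values of `|η|` for which some solution takes the value one at zero are bounded. -/
theorem bddAbove_setOf_abs {q κ t γ : ℝ} (hq : 2 < q) (hκ : 0 < κ) (ht : |t| < 1) (hγ : |γ| < 1)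
    (hγt : t ≠ γ) : BddAbove {e | ∃ η d : ℝ, |η| = e ∧ 0 < d ∧ ∃ ψ,
      IsPeriodicSolution_s6 q (coeffA q κ γ η d) (coeffB q t d) ψ ∧ ψ 0 = 1} := by
  obtain ⟨D, hD⟩ := eventually_atTop.1
    ((eventually_one_lt hq hκ ht hγ hγt one_ne_zero).and (eventually_gt_atTop 0))
  have hD0 : 0 < D := (hD D le_rfl).2
  have hDq := Real.rpow_pos_of_pos hD0 (2 * q)
  refine ⟨1 + √(2 * κ * D ^ (2 * q)), ?_⟩
  rintro _ ⟨η, d, rfl, hd, ψ, hψ, hψ1⟩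
  by_contra! hη
  have hs := Real.sqrt_nonneg (2 * κ * D ^ (2 * q))
  rcases le_total D d with h | h
  · obtain ⟨φ, hφ⟩ := exists_solution hq hκ ht hγ 1 hd
    have h1 := hφ.le_of_coeff_le (by linarith) hψ (coeffA_pos hq hκ hγ hd)
      (fun x => (coeffB_pos hq ht hd x).le)
      (fun x => coeffA_le hq hκ hd (by rw [abs_one]; linarith) _) (fun _ => le_rfl) 0
    linarith [(hD d h).1 φ hφ]
  · refine (one_lt_of_four_lt hq ht hd ?_ hψ 0).ne' hψ1
    have hdq := Real.rpow_pos_of_pos hd (2 * q)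
    rw [Real.rpow_neg hd.le, lt_div_iff₀ hκ, ← div_eq_mul_inv, lt_div_iff₀ hdq]
    have h1 : d ^ (2 * q) ≤ D ^ (2 * q) := Real.rpow_le_rpow hd.le h (by linarith)
    have h2 : 2 * κ * D ^ (2 * q) < η ^ 2 := by
      rw [← sq_abs]
      exact Real.lt_sq_of_sqrt_lt (by linarith)
    nlinarith

/-- The threshold for the normal form of the equation. -/
theorem exists_threshold {q κ t γ : ℝ} (hq : 2 < q) (hκ : 0 < κ) (ht : |t| < 1) (hγ : |γ| < 1) :
    ∃ η₀ : ℝ, 0 ≤ η₀ ∧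
      (∀ η : ℝ, 0 < |η| → |η| < η₀ → ∃ d₁ d₂ : ℝ, 0 < d₁ ∧ 0 < d₂ ∧ d₁ ≠ d₂ ∧
        (∃ ψ, IsPeriodicSolution_s6 q (coeffA q κ γ η d₁) (coeffB q t d₁) ψ ∧ ψ 0 = 1) ∧
        ∃ ψ, IsPeriodicSolution_s6 q (coeffA q κ γ η d₂) (coeffB q t d₂) ψ ∧ ψ 0 = 1) ∧
      (∀ η : ℝ, η₀ < |η| → ∀ d > 0, ∀ ψ,
        IsPeriodicSolution_s6 q (coeffA q κ γ η d) (coeffB q t d) ψ → ψ 0 ≠ 1) ∧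
      (|γ| < |t| → 0 < η₀) := by
  have hq1 : 1 ≤ q := by linarith
  by_cases hγt : t = γ
  · subst hγt
    refine ⟨0, le_rfl, fun η h1 h2 => absurd h1 h2.not_gt, fun η hη d hd ψ hψ => ?_,
      fun h => absurd h (lt_irrefl _)⟩
    refine (hψ.one_lt hq1 (coeffB_pos hq ht hd) (fun x => ?_) 0).ne'
    have hη0 := abs_pos.1 hη
    have := Real.rpow_pos_of_pos hd (q - 2)
    have := Real.rpow_pos_of_pos hd (-(2 * q))
    exact mul_lt_mul_of_pos_left (lt_add_of_pos_right _ (by positivity)) (by positivity)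
  set E := {e | ∃ η d : ℝ, |η| = e ∧ 0 < d ∧ ∃ ψ,
      IsPeriodicSolution_s6 q (coeffA q κ γ η d) (coeffB q t d) ψ ∧ ψ 0 = 1} with hE
  have hbdd : BddAbove E := bddAbove_setOf_abs hq hκ ht hγ hγt
  have hsol (η d : ℝ) (hd : 0 < d) (F : ℝ → ℝ) (hF : ∀ d > 0, ∀ ψ,
      IsPeriodicSolution_s6 q (coeffA q κ γ η d) (coeffB q t d) ψ → ψ 0 = F d) (h1 : F d = 1) :
      ∃ ψ, IsPeriodicSolution_s6 q (coeffA q κ γ η d) (coeffB q t d) ψ ∧ ψ 0 = 1 := by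
    obtain ⟨ψ, hψ⟩ := exists_solution hq hκ ht hγ η hd
    exact ⟨ψ, hψ, (hF d hd ψ hψ).trans h1⟩
  refine ⟨sSup E, Real.sSup_nonneg ?_, fun η hη hηE => ?_, fun η hηE d hd ψ hψ hψ1 => ?_,
    fun h => ?_⟩
  · rintro _ ⟨η, d, rfl, -⟩
    exact abs_nonneg η
  · have hne : E.Nonempty := by
      by_contra h
      rw [not_nonempty_iff_eq_empty.1 h, Real.sSup_empty] at hηE
      exact hηE.not_ge (abs_nonneg η)
    obtain ⟨_, ⟨η', d, rfl, hd, ψ, hψ, hψ1⟩, hηη'⟩ := exists_lt_of_lt_csSup hne hηE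
    obtain ⟨F, hFc, hF⟩ := exists_continuousOn_value hq hκ ht hγ η
    have hFd : F d < 1 := by
      obtain ⟨φ, hφ⟩ := exists_solution hq hκ ht hγ η hd
      rw [← hF d hd φ hφ, ← hψ1]
      exact hφ.lt_of_coeff_lt hq1 hψ (coeffA_pos hq hκ hγ hd)
        (fun x => (coeffB_pos hq ht hd x).le) (fun x => coeffA_lt hq hκ hd hηη' _)
        (fun _ => le_rfl) 0
    have hη0 := abs_pos.1 hη
    obtain ⟨a, ha, had, ha1⟩ := exists_lt_forall_one_lt (γ := γ) hq hκ ht hη0 hd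
    obtain ⟨b, hb1, hdb⟩ := ((eventually_one_lt hq hκ ht hγ hγt hη0).and
      (eventually_gt_atTop d)).exists
    have hFa : 1 < F a := by
      obtain ⟨φ, hφ⟩ := exists_solution hq hκ ht hγ η ha
      rw [← hF a ha φ hφ]
      exact ha1 φ hφ
    have hFb : 1 < F b := by
      obtain ⟨φ, hφ⟩ := exists_solution hq hκ ht hγ η (hd.trans hdb)
      rw [← hF b (hd.trans hdb) φ hφ]
      exact hb1 φ hφ
    obtain ⟨d₁, hd₁, hFd₁⟩ := intermediate_value_Ioo' had.le
      (hFc.mono fun x hx => ha.trans_le hx.1) ⟨hFd, hFa⟩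
    obtain ⟨d₂, hd₂, hFd₂⟩ := intermediate_value_Ioo hdb.le
      (hFc.mono fun x hx => hd.trans_le hx.1) ⟨hFd, hFb⟩
    exact ⟨d₁, d₂, ha.trans hd₁.1, hd.trans hd₂.1, (hd₁.2.trans hd₂.1).ne,
      hsol η d₁ (ha.trans hd₁.1) F hF hFd₁, hsol η d₂ (hd.trans hd₂.1) F hF hFd₂⟩
  · exact hηE.not_ge (le_csSup hbdd ⟨η, d, rfl, hd, ψ, hψ, hψ1⟩)
  · obtain ⟨d, hd, η, hη, hlt⟩ := exists_solution_lt_one hq hκ ht hγ h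
    obtain ⟨F, hFc, hF⟩ := exists_continuousOn_value hq hκ ht hγ η
    obtain ⟨a, ha, had, ha1⟩ := exists_lt_forall_one_lt (γ := γ) hq hκ ht hη.ne' hd
    have hFd : F d < 1 := by
      obtain ⟨φ, hφ⟩ := exists_solution hq hκ ht hγ η hd
      rw [← hF d hd φ hφ]
      exact hlt φ hφ
    have hFa : 1 < F a := by
      obtain ⟨φ, hφ⟩ := exists_solution hq hκ ht hγ η ha
      rw [← hF a ha φ hφ]
      exact ha1 φ hφ
    obtain ⟨d₁, hd₁, hFd₁⟩ := intermediate_value_Ioo' had.le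
      (hFc.mono fun x hx => ha.trans_le hx.1) ⟨hFd, hFa⟩
    have hd₁0 := ha.trans hd₁.1
    exact (abs_pos.2 hη.ne').trans_le
      (le_csSup hbdd ⟨η, d₁, rfl, hd₁0, hsol η d₁ hd₁0 F hF hFd₁⟩)

/-- Critical transverse-traceless threshold (Theorem 3.7 / Proposition 3.30). -/
theorem critical_TT_threshold (n : ℕ) (hn : 3 ≤ n) (t γ : ℝ)
    (hγ : -1 < γ ∧ γ < 1) (ht : |t| < 1) :
    ∃ η₀ : ℝ, 0 ≤ η₀ ∧
      (∀ η : ℝ, 0 < |η| → |η| < η₀ →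
        ∃ d₁ d₂ : ℝ, 0 < d₁ ∧ 0 < d₂ ∧ d₁ ≠ d₂ ∧
          (∃ ψ : ℝ → ℝ, IsModelSolution n t γ η 0 d₁ ψ ∧ ψ 0 = 1) ∧
          (∃ ψ : ℝ → ℝ, IsModelSolution n t γ η 0 d₂ ψ ∧ ψ 0 = 1)) ∧
      (∀ η : ℝ, η₀ < |η| →
        ∀ d : ℝ, 0 < d → ∀ ψ : ℝ → ℝ, IsModelSolution n t γ η 0 d ψ → ψ 0 ≠ 1) ∧
      (|γ| < |t| → 0 < η₀) := by
  obtain ⟨η₀, h0, h1, h2, h3⟩ :=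
    exists_threshold (two_lt_qex hn) (kap_pos hn) ht (abs_lt.2 hγ)
  refine ⟨η₀, h0, fun η hη hη₀ => ?_, fun η hη₀ d hd ψ hψ => ?_, h3⟩
  · obtain ⟨d₁, d₂, hd₁, hd₂, hne, ⟨ψ₁, hψ₁, e₁⟩, ψ₂, hψ₂, e₂⟩ := h1 η hη hη₀
    exact ⟨d₁, d₂, hd₁, hd₂, hne, ⟨ψ₁, (isModelSolution_iff hn hd₁).2 hψ₁, e₁⟩,
      ψ₂, (isModelSolution_iff hn hd₂).2 hψ₂, e₂⟩
  · exact h2 η hη₀ d hd ψ ((isModelSolution_iff hn hd).1 hψ)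
end
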